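/- The set 𝔊₁₄ of isometry classes of unimodular hermitian 𝓞-lattices of rank 14 is finite, and the mass M₁₄ = Σ_{L ∈ 𝔊₁₄} 1/|G(L)|, where G(L) is the automorphism group of L, equals 689532652191539 / (2²⁵·3¹⁹·5³·11). -/

import Mathlib

noncomputable section
open Matrix Complex
open scoped ComplexOrder

/-- A primitive cube root of unity in `ℂ`. -/
def ω : ℂ := ⟨-1/2, Real.sqrt 3 / 2⟩

/-- The ring of Eisenstein integers `𝓞 = ℤ[ω]`, the ring of integers of `ℚ(√-3)`,
realized as a subalgebra of `ℂ` (so that complex conjugation is available). -/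
def 𝓞 : Subalgebra ℤ ℂ := Algebra.adjoin ℤ {ω}

/-- All entries of the matrix are Eisenstein integers. -/
def EntriesIn {n : ℕ} (H : Matrix (Fin n) (Fin n) ℂ) : Prop := ∀ i j, H i j ∈ 𝓞

/-- `U ∈ GLₙ(𝓞)`: entries in `𝓞`, with a two-sided inverse having entries in `𝓞`. -/
def InGL {n : ℕ} (U : Matrix (Fin n) (Fin n) ℂ) : Prop :=
  EntriesIn U ∧ ∃ V : Matrix (Fin n) (Fin n) ℂ, EntriesIn V ∧ U * V = 1 ∧ V * U = 1

/-- `H` is the Gram matrix of a hermitian `𝓞`-lattice of rank `n`: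
entries in `𝓞`, equal to its conjugate transpose, positive definite as a complex matrix. -/
def IsHermLattice {n : ℕ} (H : Matrix (Fin n) (Fin n) ℂ) : Prop :=
  EntriesIn H ∧ H.IsHermitian ∧ H.PosDef

/-- A unimodular hermitian `𝓞`-lattice: discriminant `det H = 1`. -/
def IsUnimodular {n : ℕ} (H : Matrix (Fin n) (Fin n) ℂ) : Prop :=
  IsHermLattice H ∧ H.det = 1

/-- Isometry of lattices given by Gram matrices: `H' = U * H * U*` for some `U ∈ GLₙ(𝓞)`. -/
def LatIsometric {n : ℕ} (H H' : Matrix (Fin n) (Fin n) ℂ) : Prop :=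
  ∃ U : Matrix (Fin n) (Fin n) ℂ, InGL U ∧ H' = U * H * Uᴴ

/-- A lattice is decomposable if it is isometric to one whose Gram matrix is block
diagonal with two blocks of smaller positive size. -/
def Decomposable {n : ℕ} (H : Matrix (Fin n) (Fin n) ℂ) : Prop :=
  ∃ H' : Matrix (Fin n) (Fin n) ℂ, LatIsometric H H' ∧ ∃ k : ℕ, 0 < k ∧ k < n ∧
    ∀ i j : Fin n, (((i : ℕ) < k ∧ ¬ (j : ℕ) < k) ∨ (¬ (i : ℕ) < k ∧ (j : ℕ) < k)) → H' i j = 0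

/-- The norm `x* H x` of a vector. -/
def latNorm {n : ℕ} (H : Matrix (Fin n) (Fin n) ℂ) (x : Fin n → ℂ) : ℂ :=
  star x ⬝ᵥ H.mulVec x

/-- A vector of `𝓞ⁿ`. -/
def IsLatVec {n : ℕ} (x : Fin n → ℂ) : Prop := ∀ i, x i ∈ 𝓞

/-- A root: a lattice vector of norm 2. -/
def IsRoot {n : ℕ} (H : Matrix (Fin n) (Fin n) ℂ) (x : Fin n → ℂ) : Prop :=
  IsLatVec x ∧ latNorm H x = 2

/-- The lattice contains no roots. -/
def RootFree {n : ℕ} (H : Matrix (Fin n) (Fin n) ℂ) : Prop :=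
  ∀ x : Fin n → ℂ, ¬ IsRoot H x

/-- The minimal norm of the lattice is `3`. -/
def MinNormThree {n : ℕ} (H : Matrix (Fin n) (Fin n) ℂ) : Prop :=
  (∀ x : Fin n → ℂ, IsLatVec x → x ≠ 0 → 3 ≤ (latNorm H x).re) ∧
  (∃ x : Fin n → ℂ, IsLatVec x ∧ latNorm H x = 3)

/-- The order of the automorphism group `{U ∈ GLₙ(𝓞) : U H U* = H}` of the lattice. -/
def autCard {n : ℕ} (H : Matrix (Fin n) (Fin n) ℂ) : ℕ :=
  Nat.card {U : Matrix (Fin n) (Fin n) ℂ // InGL U ∧ U * H * Uᴴ = H}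

namespace EisMass

/-- The Eisenstein integers in coordinates `a + b ω`. -/
abbrev Eis : Type := QuadraticAlgebra ℤ (-1) (-1)

namespace Eis

lemma star_re (z : Eis) : (star z).re = z.re - z.im := by
  rw [QuadraticAlgebra.re_star]; ring

lemma star_im (z : Eis) : (star z).im = -z.im := QuadraticAlgebra.im_star z

lemma mul_re (z w : Eis) : (z * w).re = z.re * w.re - z.im * w.im := by
  rw [QuadraticAlgebra.re_mul]; ring

lemma mul_im (z w : Eis) : (z * w).im = z.re * w.im + z.im * w.re - z.im * w.im := by
  rw [QuadraticAlgebra.im_mul]; ring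

/-- The norm `z * star z` as an integer. -/
def nrm (z : Eis) : ℤ := z.re ^ 2 - z.re * z.im + z.im ^ 2

lemma mul_star_self (z : Eis) : z * star z = (nrm z : Eis) := by
  ext
  · rw [mul_re, star_re, star_im, QuadraticAlgebra.re_intCast, Int.cast_id, nrm]; ring
  · rw [mul_im, star_re, star_im, QuadraticAlgebra.im_intCast]; ring

lemma nrm_mul (z w : Eis) : nrm (z * w) = nrm z * nrm w := by
  simp only [nrm, mul_re, mul_im]; ring

lemma nrm_star (z : Eis) : nrm (star z) = nrm z := by
  simp only [nrm, star_re, star_im]; ring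

lemma nrm_nonneg (z : Eis) : 0 ≤ nrm z := by
  unfold nrm; nlinarith [sq_nonneg (z.re - z.im), sq_nonneg (z.re), sq_nonneg z.im]

lemma nrm_eq_zero {z : Eis} : nrm z = 0 ↔ z = 0 := by
  constructor
  · intro h
    unfold nrm at h
    have h1 : z.re = 0 := by nlinarith [sq_nonneg (z.re - 2 * z.im), sq_nonneg (z.re)]
    have h2 : z.im = 0 := by nlinarith [sq_nonneg (z.im - 2 * z.re), sq_nonneg (z.im)]
    ext <;> simp [h1, h2]
  · rintro rfl; simp [nrm]

lemma nrm_pos {z : Eis} (hz : z ≠ 0) : 0 < nrm z :=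
  lt_of_le_of_ne (nrm_nonneg z) fun h => hz (nrm_eq_zero.1 h.symm)

instance : NoZeroDivisors Eis where
  eq_zero_or_eq_zero_of_mul_eq_zero {a b} h := by
    have : nrm a * nrm b = 0 := by rw [← nrm_mul, h]; simp [nrm]
    rcases mul_eq_zero.1 this with h | h
    · exact Or.inl (nrm_eq_zero.1 h)
    · exact Or.inr (nrm_eq_zero.1 h)

instance : IsDomain Eis := NoZeroDivisors.to_isDomain _

/-- Nearest integer quotient, as an integer. -/
def rdiv (a : ℤ) (m : ℤ) : ℤ := (2 * a + m) / (2 * m)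

lemma rdiv_spec (a : ℤ) {m : ℤ} (hm : 0 < m) :
    -m ≤ 2 * (a - rdiv a m * m) ∧ 2 * (a - rdiv a m * m) ≤ m := by
  have h1 := Int.emod_add_mul_ediv (2 * a + m) (2 * m)
  have h2 := Int.emod_nonneg (2 * a + m) (by omega : 2 * m ≠ 0)
  have h3 := Int.emod_lt_of_pos (2 * a + m) (by omega : 0 < 2 * m)
  unfold rdiv
  constructor <;> nlinarith

/-- Coordinatewise rounded division by a positive integer. -/
def rquo (z : Eis) (m : ℤ) : Eis := ⟨rdiv z.re m, rdiv z.im m⟩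

lemma nrm_sub_rquo (z : Eis) {m : ℤ} (hm : 0 < m) :
    4 * nrm (z - rquo z m * (m : Eis)) ≤ 3 * m ^ 2 := by
  have h1 := rdiv_spec z.re hm
  have h2 := rdiv_spec z.im hm
  have e1 : (z - rquo z m * (m : Eis)).re = z.re - rdiv z.re m * m := by
    simp [rquo]
  have e2 : (z - rquo z m * (m : Eis)).im = z.im - rdiv z.im m * m := by
    simp [rquo]
  simp only [nrm, e1, e2]
  set x := z.re - rdiv z.re m * m
  set y := z.im - rdiv z.im m * m
  have hx : (2 * x) ^ 2 ≤ m ^ 2 := by nlinarith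
  have hy : (2 * y) ^ 2 ≤ m ^ 2 := by nlinarith
  have hxy : -(2 * x * (2 * y)) ≤ m ^ 2 := by
    nlinarith [sq_nonneg (2 * x + 2 * y)]
  nlinarith

lemma exists_div (a b : Eis) (hb : b ≠ 0) : ∃ q, nrm (a - q * b) < nrm b := by
  have hm := nrm_pos hb
  refine ⟨rquo (a * star b) (nrm b), ?_⟩
  have h := nrm_sub_rquo (a * star b) hm
  set q := rquo (a * star b) (nrm b)
  have h2 : a * star b - q * (nrm b : Eis) = (a - q * b) * star b := by
    rw [← mul_star_self]; ring
  rw [h2, nrm_mul, nrm_star] at h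
  nlinarith [nrm_nonneg (a - q * b)]

instance : EuclideanDomain Eis where
  quotient a b := if hb : b = 0 then 0 else (exists_div a b hb).choose
  quotient_zero a := by simp
  remainder a b := a - b * (if hb : b = 0 then 0 else (exists_div a b hb).choose)
  quotient_mul_add_remainder_eq a b := by ring
  r a b := (nrm a).toNat < (nrm b).toNat
  r_wellFounded := (measure fun a => (nrm a).toNat).wf
  remainder_lt a b hb := by
    have h := (exists_div a b hb).choose_spec
    simp only [dif_neg hb]
    rw [mul_comm] at h
    have := nrm_pos hb
    omega
  mul_left_not_lt a b hb := by
    have h1 := nrm_pos hb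
    have h2 := nrm_nonneg a
    rw [nrm_mul]
    have : nrm a ≤ nrm a * nrm b := by nlinarith
    omega

instance : IsPrincipalIdealRing Eis := inferInstance

lemma nrm_eq_one_of_isUnit {z : Eis} (h : IsUnit z) : nrm z = 1 := by
  obtain ⟨w, hw⟩ := h.exists_right_inv
  have h1 : nrm z * nrm w = 1 := by rw [← nrm_mul, hw]; rfl
  exact (Int.mul_eq_one_iff_eq_one_or_neg_one.1 h1).elim (·.1)
    fun h => by have := nrm_nonneg z; omega

lemma isUnit_of_nrm_eq_one {z : Eis} (h : nrm z = 1) : IsUnit z :=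
  .of_mul_eq_one (star z) (by rw [mul_star_self, h]; simp)

/-- The embedding of the Eisenstein integers into `ℂ`. -/
def toC : Eis →+* ℂ where
  toFun z := z.re + z.im * ω
  map_one' := by simp [QuadraticAlgebra.re_one, QuadraticAlgebra.im_one]
  map_zero' := by simp
  map_add' z w := by simp; ring
  map_mul' z w := by
    have hω : ω * ω = -1 - ω := by
      have h3 : Real.sqrt 3 * Real.sqrt 3 = 3 := Real.mul_self_sqrt (by norm_num)
      apply Complex.ext <;> simp [ω] <;> nlinarith
    rw [mul_re, mul_im]; push_cast
    linear_combination (-(z.im : ℂ) * w.im) * hω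

lemma toC_apply (z : Eis) : toC z = z.re + z.im * ω := rfl

lemma ω_re : ω.re = -1 / 2 := rfl

lemma ω_im : ω.im = Real.sqrt 3 / 2 := rfl

lemma toC_re (z : Eis) : (toC z).re = z.re - z.im / 2 := by
  simp [toC_apply, ω_re]; ring

lemma toC_im (z : Eis) : (toC z).im = z.im * (Real.sqrt 3 / 2) := by
  simp [toC_apply, ω_im]

lemma toC_star (z : Eis) : toC (star z) = star (toC z) := by
  apply Complex.ext
  · simp [toC_re]; ring
  · simp [toC_im]

lemma toC_injective : Function.Injective toC := by
  intro z w h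
  have h3 : Real.sqrt 3 ≠ 0 := by positivity
  have h1 := congrArg Complex.im h
  have h2 := congrArg Complex.re h
  rw [toC_im, toC_im] at h1
  rw [toC_re, toC_re] at h2
  have e1 : (z.im : ℝ) = w.im := mul_right_cancel₀ (by positivity) h1
  have e2 : (z.re : ℝ) = w.re := by rw [e1] at h2; linarith
  ext
  · exact_mod_cast e2
  · exact_mod_cast e1

lemma normSq_toC (z : Eis) : Complex.normSq (toC z) = nrm z := by
  have h3 : Real.sqrt 3 * Real.sqrt 3 = 3 := Real.mul_self_sqrt (by norm_num)
  rw [Complex.normSq_apply, toC_re, toC_im, nrm]; push_cast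
  linear_combination ((z.im : ℝ) ^ 2 / 4) * h3

lemma toC_mem (z : Eis) : toC z ∈ 𝓞 := by
  have h : ω ∈ 𝓞 := Algebra.subset_adjoin rfl
  rw [toC_apply]
  have h1 : ∀ k : ℤ, (k : ℂ) ∈ 𝓞 := fun k => by
    simp
  exact add_mem (h1 _) (mul_mem (h1 _) h)

lemma exists_toC {x : ℂ} (hx : x ∈ 𝓞) : ∃ z, toC z = x := by
  have : 𝓞 ≤ toC.toIntAlgHom.range := by
    refine Algebra.adjoin_le ?_
    rintro _ rfl
    exact ⟨⟨0, 1⟩, by simp [toC_apply]⟩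
  obtain ⟨z, hz⟩ := this hx
  exact ⟨z, hz⟩

end Eis
end EisMass

namespace EisMass
open Eis
set_option linter.unusedSectionVars false

section

section generic
variable {R : Type*} [CommRing R] [StarRing R] {ι κ : Type*} [Fintype ι] [Fintype κ]

/-- The hermitian form with Gram matrix `H`, linear in the first variable. -/
def hf (H : Matrix ι ι R) (x y : ι → R) : R := x ⬝ᵥ (H *ᵥ star y)

lemma hf_add_left (H : Matrix ι ι R) (x x' y : ι → R) : hf H (x + x') y = hf H x y + hf H x' y :=
  add_dotProduct _ _ _

lemma hf_add_right (H : Matrix ι ι R) (x y y' : ι → R) : hf H x (y + y') = hf H x y + hf H x y' := by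
  simp [hf, mulVec_add, dotProduct_add]

lemma hf_smul_left (H : Matrix ι ι R) (a : R) (x y : ι → R) : hf H (a • x) y = a * hf H x y :=
  smul_dotProduct _ _ _

lemma hf_smul_right (H : Matrix ι ι R) (a : R) (x y : ι → R) :
    hf H x (a • y) = star a * hf H x y := by
  have : star (a • y) = star a • star y := by ext i; simp
  simp [hf, this, mulVec_smul, dotProduct_smul]

lemma hf_star {H : Matrix ι ι R} (hH : H.IsHermitian) (x y : ι → R) :
    star (hf H x y) = hf H y x := by
  unfold hf
  rw [← star_dotProduct_star, star_mulVec, star_star, hH.eq,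
    ← dotProduct_mulVec]

lemma hf_congr (H : Matrix ι ι R) (U : Matrix κ ι R) (x y : κ → R) :
    hf (U * H * Uᴴ) x y = hf H (x ᵥ* U) (y ᵥ* U) := by
  unfold hf
  rw [star_vecMul, ← mulVec_mulVec, ← mulVec_mulVec, dotProduct_mulVec]

lemma congr_apply (H : Matrix ι ι R) (U : Matrix κ ι R) (i j : κ) :
    (U * H * Uᴴ) i j = hf H (U i) (U j) := by
  rw [hf, dotProduct_mulVec, mul_apply]
  rfl

lemma hf_smul_matrix (H : Matrix ι ι R) (a : R) (x y : ι → R) : hf (a • H) x y = a * hf H x y := by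
  simp [hf, smul_mulVec, dotProduct_smul]

end generic

variable {ι κ : Type*} [Fintype ι] [Fintype κ]

lemma exists_lower_bound [DecidableEq ι] {H : Matrix ι ι ℂ} (hH : H.PosDef) :
    ∃ c > 0, ∀ x : ι → ℂ, c * ∑ i, Complex.normSq (x i) ≤ (hf H x x).re := by
  classical
  have hpos : ∀ x : ι → ℂ, x ≠ 0 → 0 < (hf H x x).re := fun x hx => by
    have := hH.re_dotProduct_pos (x := star x) (by simpa using hx)
    simpa [hf] using this
  rcases isEmpty_or_nonempty ι with h | h
  · exact ⟨1, one_pos, fun x => by simp [hf]⟩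
  have hcont : Continuous fun x : ι → ℂ => (hf H x x).re := by
    unfold hf; simp only [dotProduct, mulVec]; fun_prop
  obtain ⟨x₀, hx₀, hmin⟩ := (isCompact_sphere (0 : ι → ℂ) 1).exists_isMinOn
    (NormedSpace.sphere_nonempty.2 zero_le_one) hcont.continuousOn
  have hx0 : x₀ ≠ 0 := by rintro rfl; simp at hx₀
  have hm := hpos x₀ hx0
  set m := (hf H x₀ x₀).re
  have hcard : (0 : ℝ) < Fintype.card ι := by exact_mod_cast Fintype.card_pos
  refine ⟨m / Fintype.card ι, by positivity, fun x => ?_⟩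
  have h1 : ∑ i, Complex.normSq (x i) ≤ Fintype.card ι * ‖x‖ ^ 2 := by
    calc ∑ i, Complex.normSq (x i) ≤ ∑ _i : ι, ‖x‖ ^ 2 := Finset.sum_le_sum fun i _ => by
          rw [Complex.normSq_eq_norm_sq]
          exact pow_le_pow_left₀ (norm_nonneg _) (norm_le_pi_norm x i) 2
      _ = _ := by simp
  have h2 : m * ‖x‖ ^ 2 ≤ (hf H x x).re := by
    rcases eq_or_ne x 0 with rfl | hx
    · simp [hf]
    have hn : ‖x‖ ≠ 0 := norm_ne_zero_iff.2 hx
    have hy : ((‖x‖ : ℂ)⁻¹ • x) ∈ Metric.sphere (0 : ι → ℂ) 1 := by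
      simp [norm_smul, hn]
    have h3 : m ≤ (hf H ((‖x‖ : ℂ)⁻¹ • x) ((‖x‖ : ℂ)⁻¹ • x)).re := hmin hy
    rw [hf_smul_left, hf_smul_right, ← Complex.ofReal_inv] at h3
    simp only [RCLike.star_def, Complex.conj_ofReal, Complex.re_ofReal_mul] at h3
    rw [← mul_assoc, ← mul_inv, inv_mul_eq_div, le_div_iff₀ (by positivity)] at h3
    nlinarith
  calc m / Fintype.card ι * ∑ i, Complex.normSq (x i)
      ≤ m / Fintype.card ι * (Fintype.card ι * ‖x‖ ^ 2) := by gcongr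
    _ = m * ‖x‖ ^ 2 := by field_simp
    _ ≤ _ := h2

/-- Positive definiteness of an integral hermitian matrix. -/
def PD (H : Matrix ι ι Eis) : Prop := (H.map toC).PosDef

lemma map_conjTranspose (U : Matrix ι κ Eis) : (Uᴴ).map toC = (U.map toC)ᴴ := by
  ext i j; simp [toC_star]

lemma map_mul_toC {l : Type*} (U : Matrix l ι Eis) (V : Matrix ι κ Eis) :
    (U * V).map toC = U.map toC * V.map toC := Matrix.map_mul

lemma map_toC_injective : Function.Injective fun U : Matrix ι κ Eis => U.map toC :=
  Matrix.map_injective toC_injective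

lemma PD.isHermitian {H : Matrix ι ι Eis} (hH : PD H) : H.IsHermitian := by
  apply map_toC_injective
  simp only [map_conjTranspose]
  exact hH.1

/-- The norm of a vector, as an integer. -/
def hnorm (H : Matrix ι ι Eis) (x : ι → Eis) : ℤ := (hf H x x).re

lemma eq_intCast_of_star_eq {z : Eis} (h : star z = z) : z = (z.re : Eis) := by
  have := congrArg QuadraticAlgebra.im h
  rw [star_im] at this
  ext
  · simp
  · simp; omega

lemma hf_self {H : Matrix ι ι Eis} (hH : H.IsHermitian) (x : ι → Eis) :
    hf H x x = (hnorm H x : Eis) := eq_intCast_of_star_eq (hf_star hH x x)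

lemma toC_hf (H : Matrix ι ι Eis) (x y : ι → Eis) :
    toC (hf H x y) = hf (H.map toC) (toC ∘ x) (toC ∘ y) := by
  simp [hf, dotProduct, mulVec, toC_star]

lemma hf_map_self {H : Matrix ι ι Eis} (hH : H.IsHermitian) (x : ι → Eis) :
    hf (H.map toC) (toC ∘ x) (toC ∘ x) = (hnorm H x : ℂ) := by
  rw [← toC_hf, hf_self hH]; simp

lemma hnorm_zero (H : Matrix ι ι Eis) : hnorm H 0 = 0 := by simp [hnorm, hf]

lemma intCast_injective : Function.Injective (Int.cast : ℤ → Eis) := fun a b h => by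
  simpa using congrArg QuadraticAlgebra.re h

lemma hnorm_smul {H : Matrix ι ι Eis} (hH : H.IsHermitian) (a : Eis) (x : ι → Eis) :
    hnorm H (a • x) = nrm a * hnorm H x := by
  apply intCast_injective
  rw [← hf_self hH, hf_smul_left, hf_smul_right, hf_self hH]
  push_cast
  rw [← mul_star_self]; ring

lemma hnorm_congr (H : Matrix ι ι Eis) (U : Matrix κ ι Eis) (x : κ → Eis) :
    hnorm (U * H * Uᴴ) x = hnorm H (x ᵥ* U) := by simp only [hnorm, hf_congr]

lemma exists_lower_bound_eis [DecidableEq ι] {H : Matrix ι ι Eis} (hH : PD H) :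
    ∃ c > (0 : ℝ), ∀ x : ι → Eis, c * ∑ i, (nrm (x i) : ℝ) ≤ hnorm H x := by
  obtain ⟨c, hc, h⟩ := exists_lower_bound hH
  refine ⟨c, hc, fun x => ?_⟩
  have := h (toC ∘ x)
  rw [hf_map_self hH.isHermitian] at this
  simpa [normSq_toC] using this

lemma hnorm_pos [DecidableEq ι] {H : Matrix ι ι Eis} (hH : PD H) {x : ι → Eis} (hx : x ≠ 0) :
    0 < hnorm H x := by
  obtain ⟨c, hc, h⟩ := exists_lower_bound_eis hH
  obtain ⟨i, hi⟩ := Function.ne_iff.1 hx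
  have h1 : (0 : ℝ) < ∑ i, (nrm (x i) : ℝ) := by
    refine Finset.sum_pos' (fun j _ => by exact_mod_cast nrm_nonneg _) ⟨i, Finset.mem_univ _, ?_⟩
    exact_mod_cast nrm_pos hi
  have : (0 : ℝ) < hnorm H x := lt_of_lt_of_le (by positivity) (h x)
  exact_mod_cast this

lemma hnorm_nonneg [DecidableEq ι] {H : Matrix ι ι Eis} (hH : PD H) (x : ι → Eis) :
    0 ≤ hnorm H x := by
  rcases eq_or_ne x 0 with rfl | hx
  · rw [hnorm_zero]
  · exact (hnorm_pos hH hx).le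

lemma finite_nrm_le (m : ℤ) : {z : Eis | nrm z ≤ m}.Finite := by
  have h : (Set.Icc (-2 * |m|) (2 * |m|) ×ˢ Set.Icc (-2 * |m|) (2 * |m|)).Finite :=
    (Set.finite_Icc _ _).prod (Set.finite_Icc _ _)
  refine (h.image fun p => (⟨p.1, p.2⟩ : Eis)).subset fun z hz => ⟨(z.re, z.im), ?_, rfl⟩
  have hm := le_abs_self m
  have hz : nrm z ≤ |m| := le_trans hz hm
  have hm0 := abs_nonneg m
  unfold nrm at hz
  have a1 : z.re ^ 2 ≤ 2 * |m| := by nlinarith [sq_nonneg (z.re - 2 * z.im)]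
  have a2 : z.im ^ 2 ≤ 2 * |m| := by nlinarith [sq_nonneg (z.im - 2 * z.re)]
  have b (t : ℤ) (ht : t ^ 2 ≤ 2 * |m|) : -2 * |m| ≤ t ∧ t ≤ 2 * |m| := by
    have := Int.le_self_sq t; have := Int.le_self_sq (-t)
    constructor <;> nlinarith
  exact ⟨b _ a1, b _ a2⟩

lemma finite_hnorm_le [DecidableEq ι] {H : Matrix ι ι Eis} (hH : PD H) (m : ℤ) :
    {x : ι → Eis | hnorm H x ≤ m}.Finite := by
  obtain ⟨c, hc, h⟩ := exists_lower_bound_eis hH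
  have := Set.Finite.pi' (ι := ι) (fun _ => finite_nrm_le ⌈(m : ℝ) / c⌉)
  refine this.subset fun x hx i => ?_
  have h1 : (nrm (x i) : ℝ) ≤ ∑ i, (nrm (x i) : ℝ) :=
    Finset.single_le_sum (f := fun i => (nrm (x i) : ℝ))
      (fun j _ => by exact_mod_cast nrm_nonneg _) (Finset.mem_univ i)
  have h2 : c * (nrm (x i) : ℝ) ≤ m :=
    (mul_le_mul_of_nonneg_left h1 hc.le).trans ((h x).trans (by exact_mod_cast hx))
  have h3 : (nrm (x i) : ℝ) ≤ m / c := by rw [le_div_iff₀ hc]; linarith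
  exact_mod_cast h3.trans (Int.le_ceil _)

lemma finite_congr_eq [DecidableEq ι] {H : Matrix ι ι Eis} (hH : PD H) (K : Matrix κ κ Eis) :
    {U : Matrix κ ι Eis | U * H * Uᴴ = K}.Finite := by
  have := Set.Finite.pi' (ι := κ) (fun i => finite_hnorm_le hH (K i i).re)
  refine this.subset fun (U : Matrix κ ι Eis) hU i => ?_
  have h1 := congr_apply H U i i
  rw [show U * H * Uᴴ = K from hU] at h1
  exact (congrArg QuadraticAlgebra.re h1).ge

lemma PD.congr [DecidableEq κ] [DecidableEq ι] {H : Matrix ι ι Eis} (hH : PD H) {U V: Matrix ι ι Eis}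
    (hU : U * V = 1) : PD (U * H * Uᴴ) := by
  unfold PD
  rw [map_mul_toC, map_mul_toC, map_conjTranspose]
  refine hH.mul_mul_conjTranspose_same ?_
  have h : U.map toC * V.map toC = 1 := by rw [← map_mul_toC, hU]; simp
  exact Function.HasLeftInverse.injective ⟨fun x => x ᵥ* V.map toC, fun x => by simp [h]⟩

/-- Unimodular lattices. -/
structure IsUL [DecidableEq ι] (H : Matrix ι ι Eis) : Prop where
  pd : PD H
  det : H.det = 1

lemma det_of_unit [DecidableEq ι] (U : (Matrix ι ι Eis)ˣ) :
    (U : Matrix ι ι Eis).det * star (U : Matrix ι ι Eis).det = 1 := by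
  have h : IsUnit (U : Matrix ι ι Eis).det := (Matrix.isUnit_iff_isUnit_det _).1 U.isUnit
  rw [mul_star_self, nrm_eq_one_of_isUnit h]; simp

lemma IsUL.congr [DecidableEq ι] {H : Matrix ι ι Eis} (hH : IsUL H) (U : (Matrix ι ι Eis)ˣ) :
    IsUL ((U : Matrix ι ι Eis) * H * (U : Matrix ι ι Eis)ᴴ) where
  pd := hH.pd.congr (κ := ι) U.mul_inv
  det := by
    rw [det_mul, det_mul, hH.det, mul_one, det_conjTranspose]
    exact det_of_unit U

/-- Equivalence of Gram matrices. -/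
def Equi [DecidableEq ι] (H H' : Matrix ι ι Eis) : Prop :=
  ∃ U : (Matrix ι ι Eis)ˣ, H' = U * H * (U : Matrix ι ι Eis)ᴴ

lemma Equi.refl [DecidableEq ι] (H : Matrix ι ι Eis) : Equi H H := ⟨1, by simp⟩

lemma Equi.trans [DecidableEq ι] {H H' H'' : Matrix ι ι Eis} (h : Equi H H') (h' : Equi H' H'') :
    Equi H H'' := by
  obtain ⟨U, rfl⟩ := h
  obtain ⟨V, rfl⟩ := h'
  exact ⟨V * U, by simp [Matrix.mul_assoc]⟩

lemma unit_conj_cancel [DecidableEq ι] (U : (Matrix ι ι Eis)ˣ) :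
    ((U : Matrix ι ι Eis))ᴴ * ((U⁻¹ : (Matrix ι ι Eis)ˣ) : Matrix ι ι Eis)ᴴ = 1 := by
  rw [← conjTranspose_mul, U.inv_mul, conjTranspose_one]

lemma Equi.symm [DecidableEq ι] {H H' : Matrix ι ι Eis} (h : Equi H H') : Equi H' H := by
  obtain ⟨U, rfl⟩ := h
  refine ⟨U⁻¹, ?_⟩
  rw [← Matrix.mul_assoc, ← Matrix.mul_assoc, U.inv_mul, Matrix.one_mul, Matrix.mul_assoc,
    unit_conj_cancel, Matrix.mul_one]

end

section

section schur
variable {R : Type*} [CommRing R] {n : ℕ}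

/-- The Schur complement of the top left entry, scaled to stay integral. -/
def schur (H : Matrix (Fin (n + 1)) (Fin (n + 1)) R) : Matrix (Fin n) (Fin n) R :=
  of fun i j => H 0 0 * H i.succ j.succ - H i.succ 0 * H 0 j.succ

/-- The block lower triangular matrix with rows `(1, 0)` and `(t, W)`. -/
def lower (t : Fin n → R) (W : Matrix (Fin n) (Fin n) R) : Matrix (Fin (n + 1)) (Fin (n + 1)) R :=
  of (Fin.cons (Fin.cons 1 0) fun i => Fin.cons (t i) (W i))

lemma lower_zero (t : Fin n → R) (W : Matrix (Fin n) (Fin n) R) :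
    lower t W 0 = Fin.cons 1 0 := rfl

lemma lower_succ (t : Fin n → R) (W : Matrix (Fin n) (Fin n) R) (i : Fin n) :
    lower t W i.succ = Fin.cons (t i) (W i) := rfl

lemma det_lower (t : Fin n → R) (W : Matrix (Fin n) (Fin n) R) : (lower t W).det = W.det := by
  rw [det_succ_row_zero, Fin.sum_univ_succ]
  have : (lower t W).submatrix Fin.succ Fin.succ = W := by
    ext i j; simp [lower_succ]
  simp [lower_zero, this]

lemma det_schur (H : Matrix (Fin (n + 1)) (Fin (n + 1)) R) :
    H 0 0 * (schur H).det = H 0 0 ^ n * H.det := by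
  set T : Matrix (Fin (n + 1)) (Fin (n + 1)) R :=
    lower (fun i => - H i.succ 0) (diagonal fun _ => H 0 0) with hT
  have h1 : T.det = H 0 0 ^ n := by rw [hT, det_lower, det_diagonal]; simp
  rw [← h1, ← det_mul, det_succ_column_zero, Fin.sum_univ_succ]
  have h2 : ∀ j, (T * H) 0 j = H 0 j := fun j => by
    simp [mul_apply, Fin.sum_univ_succ, hT, lower_zero]
  have h3 : ∀ i j, (T * H) (Fin.succ i) j = H 0 0 * H i.succ j - H i.succ 0 * H 0 j :=
    fun i j => by
      simp [mul_apply, Fin.sum_univ_succ, hT, lower_succ, diagonal_apply]; ring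
  have h4 : (T * H).submatrix (Fin.succAbove 0) Fin.succ = schur H := by
    ext i j; simp [h3, schur]
  rw [h4, h2]
  simp [h3, mul_comm]

variable [StarRing R]

lemma hf_schur (H : Matrix (Fin (n + 1)) (Fin (n + 1)) R) (x y : Fin (n + 1) → R) :
    H 0 0 * hf H x y =
      hf H x (Fin.cons 1 0) * hf H (Fin.cons 1 0) y + hf (schur H) (Fin.tail x) (Fin.tail y) := by
  have e1 : hf (schur H) (Fin.tail x) (Fin.tail y) =
      H 0 0 * (∑ i : Fin n, x i.succ * ∑ j : Fin n, H i.succ j.succ * star (y j.succ)) -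
      (∑ i : Fin n, x i.succ * H i.succ 0) * ∑ j : Fin n, H 0 j.succ * star (y j.succ) := by
    simp only [hf, dotProduct, mulVec, schur, of_apply, sub_mul, Finset.sum_sub_distrib, mul_sub,
      Finset.mul_sum, Finset.sum_mul, Fin.tail, Pi.star_apply]
    congr 1
    · refine Finset.sum_congr rfl fun i _ => Finset.sum_congr rfl fun j _ => by ring
    · rw [Finset.sum_comm]
      refine Finset.sum_congr rfl fun i _ => Finset.sum_congr rfl fun j _ => by ring
  rw [e1]
  simp only [hf, dotProduct, mulVec, Fin.sum_univ_succ, Pi.star_apply, Fin.cons_zero, Fin.cons_succ,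
    Pi.zero_apply, star_zero, star_one, mul_zero, zero_mul, Finset.sum_const_zero, mul_one, one_mul,
    add_zero, mul_add, Finset.sum_add_distrib, ← mul_assoc, ← Finset.sum_mul]
  ring

lemma hf_cons_one (H : Matrix (Fin (n + 1)) (Fin (n + 1)) R) (x : Fin (n + 1) → R) :
    hf H x (Fin.cons 1 0) = H 0 0 * x 0 + ∑ i : Fin n, x i.succ * H i.succ 0 := by
  simp [hf, dotProduct, mulVec, Fin.sum_univ_succ, mul_comm]

lemma hf_cons_one_left (H : Matrix (Fin (n + 1)) (Fin (n + 1)) R) (y : Fin (n + 1) → R) :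
    hf H (Fin.cons 1 0) y = H 0 0 * star (y 0) + ∑ i : Fin n, H 0 i.succ * star (y i.succ) := by
  simp [hf, dotProduct, mulVec, Fin.sum_univ_succ]

lemma hf_cons_one_cons_one (H : Matrix (Fin (n + 1)) (Fin (n + 1)) R) :
    hf H (Fin.cons 1 0) (Fin.cons 1 0) = H 0 0 := by
  simp [hf_cons_one]

lemma lower_congr_zero_zero (H : Matrix (Fin (n + 1)) (Fin (n + 1)) R) (t : Fin n → R)
    (W : Matrix (Fin n) (Fin n) R) : (lower t W * H * (lower t W)ᴴ) 0 0 = H 0 0 := by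
  rw [congr_apply, lower_zero, hf_cons_one_cons_one]

lemma lower_congr_zero_succ (H : Matrix (Fin (n + 1)) (Fin (n + 1)) R) (t : Fin n → R)
    (W : Matrix (Fin n) (Fin n) R) (j : Fin n) : (lower t W * H * (lower t W)ᴴ) 0 j.succ =
      H 0 0 * star (t j) + ∑ i : Fin n, H 0 i.succ * star (W j i) := by
  rw [congr_apply, lower_zero, hf_cons_one_left, lower_succ]; simp

lemma schur_lower_congr (H : Matrix (Fin (n + 1)) (Fin (n + 1)) R) (t : Fin n → R)
    (W : Matrix (Fin n) (Fin n) R) : schur (lower t W * H * (lower t W)ᴴ) = W * schur H * Wᴴ := by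
  ext i j
  rw [congr_apply, schur, of_apply]
  simp only [congr_apply, lower_zero, lower_succ, hf_cons_one_cons_one]
  rw [hf_schur]
  simp

end schur

variable {n : ℕ}

lemma map_schur {R S : Type*} [CommRing R] [CommRing S] (f : R →+* S)
    (H : Matrix (Fin (n + 1)) (Fin (n + 1)) R) : schur (H.map f) = (schur H).map f := by
  ext i j; simp [schur]

lemma schur_isHermitian {R : Type*} [CommRing R] [StarRing R]
    {H : Matrix (Fin (n + 1)) (Fin (n + 1)) R} (hH : H.IsHermitian) : (schur H).IsHermitian := by
  ext i j
  simp only [conjTranspose_apply, schur, of_apply, star_sub, star_mul, hH.apply]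
  ring

lemma posDef_iff_hf {ι : Type*} [Fintype ι] {H : Matrix ι ι ℂ} :
    H.PosDef ↔ H.IsHermitian ∧ ∀ x ≠ 0, 0 < hf H x x := by
  rw [posDef_iff_dotProduct_mulVec]
  refine and_congr_right fun _ => ⟨fun h x hx => ?_, fun h x hx => ?_⟩
  · have := h (x := star x) (by simpa using hx)
    simpa [hf] using this
  · have := h (star x) (by simpa using hx)
    simpa [hf] using this

lemma posDef_zero_zero {H : Matrix (Fin (n + 1)) (Fin (n + 1)) ℂ} (hH : H.PosDef) :
    0 < H 0 0 := hH.diag_pos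

lemma posDef_schur {H : Matrix (Fin (n + 1)) (Fin (n + 1)) ℂ} (hH : H.PosDef) :
    (schur H).PosDef := by
  rw [posDef_iff_hf]
  refine ⟨schur_isHermitian hH.1, fun y hy => ?_⟩
  have hm := posDef_zero_zero hH
  set x : Fin (n + 1) → ℂ := Fin.cons (-(∑ i : Fin n, y i * H i.succ 0) / H 0 0) y with hx
  have hx0 : x ≠ 0 := fun h => hy (by
    have := congrArg Fin.tail h
    rw [hx, Fin.tail_cons] at this
    rw [this]; rfl)
  have h1 := hf_schur H x x
  have h2 : hf H x (Fin.cons 1 0) = 0 := by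
    rw [hf_cons_one, hx]; simp only [Fin.cons_zero, Fin.cons_succ]
    field_simp [hm.ne']; ring
  rw [h2, zero_mul, zero_add] at h1
  have h3 := (posDef_iff_hf.1 hH).2 x hx0
  have : Fin.tail x = y := by rw [hx, Fin.tail_cons]
  rw [this] at h1
  rw [← h1]
  exact mul_pos hm h3

lemma PD.schur {H : Matrix (Fin (n + 1)) (Fin (n + 1)) Eis} (hH : PD H) : PD (schur H) := by
  unfold PD; rw [← map_schur]; exact posDef_schur hH

lemma entry_zero_zero {H : Matrix (Fin (n + 1)) (Fin (n + 1)) Eis} (hH : H.IsHermitian) :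
    H 0 0 = (hnorm H (Fin.cons 1 0) : Eis) := by
  rw [← hf_self hH, hf_cons_one_cons_one]

lemma hnorm_schur {H : Matrix (Fin (n + 1)) (Fin (n + 1)) Eis} (hH : H.IsHermitian)
    (x : Fin (n + 1) → Eis) :
    hnorm H (Fin.cons 1 0) * hnorm H x =
      nrm (hf H x (Fin.cons 1 0)) + hnorm (schur H) (Fin.tail x) := by
  apply intCast_injective
  push_cast
  rw [← hf_self hH x, ← entry_zero_zero hH, hf_schur, ← hf_self (schur_isHermitian hH),
    ← mul_star_self, hf_star hH]

lemma minimum_schur {H : Matrix (Fin (n + 1)) (Fin (n + 1)) Eis} (hH : PD H)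
    (hmin : ∀ x ≠ 0, hnorm H (Fin.cons 1 0) ≤ hnorm H x) {y : Fin n → Eis} (hy : y ≠ 0) :
    hnorm H (Fin.cons 1 0) ^ 2 ≤ 4 * hnorm (schur H) y := by
  set m := hnorm H (Fin.cons 1 0) with hm
  have hm0 : 0 < m := hnorm_pos hH fun h => by simpa using congrFun h 0
  set s := ∑ i : Fin n, y i * H i.succ 0
  set x : Fin (n + 1) → Eis := Fin.cons (-rquo s m) y with hx
  have hx0 : x ≠ 0 := fun h => hy (by
    have := congrArg Fin.tail h
    rw [hx, Fin.tail_cons] at this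
    rw [this]; rfl)
  have h1 := hnorm_schur hH.isHermitian x
  have h2 : hf H x (Fin.cons 1 0) = s - rquo s m * (m : Eis) := by
    rw [hf_cons_one, entry_zero_zero hH.isHermitian, ← hm, hx]
    simp only [Fin.cons_zero, Fin.cons_succ]; ring
  have h3 := nrm_sub_rquo s hm0
  have h4 := hmin x hx0
  have : Fin.tail x = y := by rw [hx, Fin.tail_cons]
  rw [h2, this, ← hm] at h1
  nlinarith

lemma exists_unit_of_unimodular (v f : Fin (n + 1) → Eis) (h : f ⬝ᵥ v = 1) :
    ∃ W : (Matrix (Fin (n + 1)) (Fin (n + 1)) Eis)ˣ, (W : Matrix (Fin (n + 1)) (Fin (n + 1)) Eis) 0 = v := by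
  let φ : (Fin (n + 1) → Eis) →ₗ[Eis] Eis := Fintype.linearCombination Eis f
  have hφ : ∀ x, φ x = x ⬝ᵥ f := fun x => by
    simp [φ, Fintype.linearCombination_apply, dotProduct]
  have hv : φ v = 1 := by rw [hφ, dotProduct_comm, h]
  obtain ⟨m, b⟩ := Submodule.basisOfPid (Pi.basisFun Eis (Fin (n + 1))) (LinearMap.ker φ)
  let B := Module.Basis.mkFinCons v b (fun c x hx hc => by
      have := congrArg φ hc
      simpa [hv, LinearMap.mem_ker.1 hx] using this)
    (fun z => ⟨-φ z, by simp [hv]⟩)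
  have hm : m + 1 = n + 1 := by
    have h1 := Module.finrank_eq_card_basis B
    rw [Module.finrank_fin_fun, Fintype.card_fin] at h1
    exact h1.symm
  obtain rfl : m = n := by omega
  have hB0 : B 0 = v := by simp [B]
  set W : Matrix (Fin (m + 1)) (Fin (m + 1)) Eis := ((Pi.basisFun Eis (Fin (m + 1))).toMatrix B)ᵀ
  have hW : IsUnit W := by
    have := (Pi.basisFun Eis (Fin (m + 1))).invertibleToMatrix B
    rw [Matrix.isUnit_transpose]
    exact isUnit_of_invertible _
  obtain ⟨U, hU⟩ := hW
  refine ⟨U, ?_⟩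
  rw [hU, ← hB0]
  funext j
  simp [W, Module.Basis.toMatrix_apply]

lemma exists_unit_of_minimal {H : Matrix (Fin (n + 1)) (Fin (n + 1)) Eis} (hH : PD H)
    {v : Fin (n + 1) → Eis} (hv : v ≠ 0) (hmin : ∀ x ≠ 0, hnorm H v ≤ hnorm H x) :
    ∃ W : (Matrix (Fin (n + 1)) (Fin (n + 1)) Eis)ˣ, (W : Matrix (Fin (n + 1)) (Fin (n + 1)) Eis) 0 = v := by
  obtain ⟨g, hg⟩ := (IsPrincipalIdealRing.principal (Ideal.span (Set.range v))).principal
  have h1 : ∀ i, ∃ a, v i = g * a := fun i => by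
    have : v i ∈ Ideal.span {g} := by
      rw [← Ideal.submodule_span_eq, ← hg]; exact Ideal.subset_span ⟨i, rfl⟩
    exact Ideal.mem_span_singleton.1 this
  choose w hw using h1
  have hvw : v = g • w := funext hw
  have hw0 : w ≠ 0 := by rintro rfl; simp at hvw; exact hv hvw
  have h2 := hmin w hw0
  have h3 := hnorm_pos hH hw0
  rw [hvw, hnorm_smul hH.isHermitian] at h2
  have hg0 : g ≠ 0 := by rintro rfl; simp at hvw; exact hv hvw
  have h4 := nrm_pos hg0
  have hg1 : nrm g = 1 := by nlinarith
  have hu := isUnit_of_nrm_eq_one hg1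
  have h5 : (1 : Eis) ∈ Ideal.span (Set.range v) := by
    rw [show Ideal.span (Set.range v) = Ideal.span {g} from hg, Ideal.span_singleton_eq_top.2 hu]
    trivial
  obtain ⟨f, hf⟩ := Ideal.mem_span_range_iff_exists_fun.1 h5
  exact exists_unit_of_unimodular v f (by simpa [dotProduct] using hf)

lemma exists_minimal {H : Matrix (Fin (n + 1)) (Fin (n + 1)) Eis} (hH : PD H) :
    ∃ v ≠ 0, ∀ x ≠ 0, hnorm H v ≤ hnorm H x := by
  set S : Set (Fin (n + 1) → Eis) := {x | x ≠ 0}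
  have hS : S.Nonempty := ⟨Fin.cons 1 0, fun h => by simpa using congrFun h 0⟩
  obtain ⟨v, hv, hmin⟩ := exists_minimalFor_of_wellFoundedLT (· ∈ S) (fun x => (hnorm H x).toNat) hS
  refine ⟨v, hv, fun x hx => ?_⟩
  by_contra! hlt
  have h1 := hnorm_nonneg hH x
  have := hmin hx (by dsimp only; omega)
  dsimp only at this
  omega

/-- Change of basis making the first basis vector minimal. -/
lemma exists_equi_minimal {H : Matrix (Fin (n + 1)) (Fin (n + 1)) Eis} (hH : PD H) :
    ∃ H', Equi H H' ∧ PD H' ∧ ∀ x ≠ 0, hnorm H' (Fin.cons 1 0) ≤ hnorm H' x := by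
  obtain ⟨v, hv, hmin⟩ := exists_minimal hH
  obtain ⟨W, hW⟩ := exists_unit_of_minimal hH hv hmin
  refine ⟨_, ⟨W, rfl⟩, hH.congr (κ := Fin (n + 1)) W.mul_inv, fun x hx => ?_⟩
  have h1 : (Fin.cons 1 0 : Fin (n + 1) → Eis) ᵥ* (W : Matrix (Fin (n + 1)) (Fin (n + 1)) Eis) = v := by
    rw [← hW]
    funext j; simp [vecMul, dotProduct, Fin.sum_univ_succ]
  rw [hnorm_congr, hnorm_congr, h1]
  refine hmin _ fun h => hx ?_
  have := congrArg (· ᵥ* ((W⁻¹ : (Matrix (Fin (n + 1)) (Fin (n + 1)) Eis)ˣ) : Matrix (Fin (n + 1)) (Fin (n + 1)) Eis)) h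
  simpa using this

lemma Equi.det {ι : Type*} [Fintype ι] [DecidableEq ι] {H H' : Matrix ι ι Eis} (h : Equi H H') :
    H'.det = H.det := by
  obtain ⟨U, rfl⟩ := h
  rw [det_mul, det_mul, det_conjTranspose, mul_right_comm, det_of_unit, one_mul]

lemma PD.det_re {H : Matrix (Fin n) (Fin n) Eis} (hH : PD H) :
    H.det = (H.det.re : Eis) ∧ 0 < H.det.re := by
  have h1 : H.det = (H.det.re : Eis) := by
    apply eq_intCast_of_star_eq
    rw [← det_conjTranspose, hH.isHermitian.eq]
  refine ⟨h1, ?_⟩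
  have h2 : (0 : ℂ) < (H.map toC).det := hH.det_pos
  have h3 : (H.map toC).det = toC H.det := (RingHom.map_det _ _).symm
  rw [h3, h1, map_intCast] at h2
  have h4 := (Complex.pos_iff.1 h2).1
  simpa using h4

lemma det_schur_re {H : Matrix (Fin (n + 1)) (Fin (n + 1)) Eis} (hH : PD H) :
    hnorm H (Fin.cons 1 0) * (schur H).det.re = hnorm H (Fin.cons 1 0) ^ n * H.det.re := by
  apply intCast_injective
  push_cast
  rw [← hH.det_re.1, ← hH.schur.det_re.1, ← entry_zero_zero hH.isHermitian, det_schur]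

/-- Hermite's bound. -/
lemma exists_hermite (n : ℕ) : ∃ K : ℤ, 0 < K ∧ ∀ H : Matrix (Fin n) (Fin n) Eis, PD H →
    ∀ m k : ℤ, 0 < m → 0 < k → (∀ x ≠ 0, m ≤ k * hnorm H x) → m ^ n ≤ K * k ^ n * H.det.re := by
  induction n with
  | zero => exact ⟨1, one_pos, fun H _ m k _ _ _ => by simp [QuadraticAlgebra.re_one]⟩
  | succ n ih =>
    obtain ⟨K, hK, ih⟩ := ih
    refine ⟨K * 4 ^ n, by positivity, fun H hH m k hm hk hb => ?_⟩
    obtain ⟨H', heq, hH', hmin⟩ := exists_equi_minimal hH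
    have hm0 : 0 < hnorm H' (Fin.cons 1 0) := hnorm_pos hH' fun h => by simpa using congrFun h 0
    have h1 := ih (schur H') hH'.schur (hnorm H' (Fin.cons 1 0) ^ 2) 4 (by positivity) (by norm_num)
      fun x hx => minimum_schur hH' hmin hx
    have h2 := det_schur_re hH'
    have hd := hH'.det_re.2
    rw [heq.det] at h2 hd
    set m0 := hnorm H' (Fin.cons 1 0) with hm0'
    have h3 : m ≤ k * m0 := by
      obtain ⟨U, rfl⟩ := heq
      rw [hm0', hnorm_congr]
      refine hb _ fun h => ?_
      have := congrArg (· ᵥ* ((U⁻¹ : (Matrix (Fin (n + 1)) (Fin (n + 1)) Eis)ˣ) : Matrix (Fin (n + 1)) (Fin (n + 1)) Eis)) h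
      simp only [vecMul_vecMul, Units.mul_inv, vecMul_one, zero_vecMul] at this
      simpa using congrFun this 0
    have h4 : m0 ^ n * m0 ^ (n + 1) ≤ m0 ^ n * (K * 4 ^ n * H.det.re) := by
      calc m0 ^ n * m0 ^ (n + 1) = m0 * (m0 ^ 2) ^ n := by ring
        _ ≤ m0 * (K * 4 ^ n * (schur H').det.re) := by gcongr
        _ = K * 4 ^ n * (m0 * (schur H').det.re) := by ring
        _ = _ := by rw [h2]; ring
    have h5 := le_of_mul_le_mul_left h4 (by positivity)
    calc m ^ (n + 1) ≤ (k * m0) ^ (n + 1) := by gcongr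
      _ = k ^ (n + 1) * m0 ^ (n + 1) := by ring
      _ ≤ k ^ (n + 1) * (K * 4 ^ n * H.det.re) := by gcongr
      _ = _ := by ring

end

section
variable {n : ℕ}

lemma isUnit_lower (t : Fin n → Eis) (W : (Matrix (Fin n) (Fin n) Eis)ˣ) :
    IsUnit (lower t (W : Matrix (Fin n) (Fin n) Eis)) := by
  rw [Matrix.isUnit_iff_isUnit_det, det_lower]
  exact (Matrix.isUnit_iff_isUnit_det _).1 W.isUnit

lemma eq_of_schur_eq {R : Type*} [CommRing R] [IsDomain R] [StarRing R]
    {H H' : Matrix (Fin (n + 1)) (Fin (n + 1)) R} (hH : H.IsHermitian)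
    (hH' : H'.IsHermitian) (h0 : H 0 0 ≠ 0) (h00 : H 0 0 = H' 0 0)
    (h0s : ∀ j : Fin n, H 0 j.succ = H' 0 j.succ) (hs : schur H = schur H') : H = H' := by
  have h1 : ∀ j : Fin n, H j.succ 0 = H' j.succ 0 := fun j => by
    rw [← hH.apply, ← hH'.apply, h0s]
  ext i j
  refine Fin.cases ?_ (fun i => ?_) i <;> refine Fin.cases ?_ (fun j => ?_) j
  · exact h00
  · exact h0s j
  · exact h1 i
  · have := congrFun (congrFun hs i) j
    simp only [schur, of_apply, ← h00, h0s, h1, sub_left_inj] at this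
    exact mul_left_cancel₀ h0 this

lemma exists_equi_reduced {H : Matrix (Fin (n + 1)) (Fin (n + 1)) Eis} (hH : PD H)
    {B : Matrix (Fin n) (Fin n) Eis} (hB : Equi (schur H) B) :
    ∃ H', Equi H H' ∧ H' 0 0 = H 0 0 ∧ schur H' = B ∧
      ∀ j : Fin n, 4 * nrm (H' 0 j.succ) ≤ 3 * hnorm H (Fin.cons 1 0) ^ 2 := by
  obtain ⟨W, rfl⟩ := hB
  set m := hnorm H (Fin.cons 1 0) with hm
  have hm0 : 0 < m := hnorm_pos hH fun h => by simpa using congrFun h 0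
  set t : Fin n → Eis := fun j => -star (rquo (∑ i : Fin n, H 0 i.succ * star (W.1 j i)) m)
  obtain ⟨U, hU⟩ := isUnit_lower t W
  refine ⟨_, ⟨U, rfl⟩, ?_, ?_, fun j => ?_⟩
  · rw [hU, lower_congr_zero_zero]
  · rw [hU, schur_lower_congr]
  · rw [hU, lower_congr_zero_succ, entry_zero_zero hH.isHermitian, ← hm]
    convert nrm_sub_rquo (∑ i : Fin n, H 0 i.succ * star (W.1 j i)) hm0 using 3
    simp only [t, star_neg, star_star]; ring

lemma PD.equi {H H' : Matrix (Fin n) (Fin n) Eis} (hH : PD H) (h : Equi H H') : PD H' := by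
  obtain ⟨U, rfl⟩ := h
  exact hH.congr (κ := Fin n) U.mul_inv

lemma finite_classes (n : ℕ) (d : ℤ) : ∃ S : Set (Matrix (Fin n) (Fin n) Eis), S.Finite ∧
    ∀ H, PD H → H.det.re = d → ∃ H' ∈ S, Equi H H' := by
  induction n generalizing d with
  | zero => exact ⟨Set.univ, Set.finite_univ, fun H _ _ => ⟨H, trivial, .refl H⟩⟩
  | succ n ih =>
    choose S hS hSH using ih
    obtain ⟨K, hK, hb⟩ := exists_hermite (n + 1)
    set D := K * d
    let T : ℤ → Set (Matrix (Fin (n + 1)) (Fin (n + 1)) Eis) := fun m =>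
      {H | H.IsHermitian ∧ H 0 0 = (m : Eis) ∧ H 0 0 ≠ 0 ∧
        (∀ j : Fin n, nrm (H 0 j.succ) ≤ 3 * m ^ 2) ∧
        schur H ∈ ⋃ e ∈ Set.Icc 0 (m ^ n * d), S e}
    refine ⟨⋃ m ∈ Set.Icc 0 D, T m, ?_, fun H hH hd => ?_⟩
    · refine (Set.finite_Icc _ _).biUnion fun m _ => ?_
      have h1 : (⋃ e ∈ Set.Icc 0 (m ^ n * d), S e).Finite :=
        (Set.finite_Icc _ _).biUnion fun e _ => hS e
      have h2 : {c : Fin n → Eis | ∀ j, c j ∈ {z | nrm z ≤ 3 * m ^ 2}}.Finite :=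
        Set.Finite.pi' fun _ => finite_nrm_le _
      refine Set.Finite.of_finite_image (f := fun H => (fun j : Fin n => H 0 j.succ, schur H))
        ((h2.prod h1).subset ?_) ?_
      · rintro _ ⟨H, hH, rfl⟩
        exact ⟨hH.2.2.2.1, hH.2.2.2.2⟩
      · intro H hH H' hH' h
        rw [Prod.mk.injEq] at h
        exact eq_of_schur_eq hH.1 hH'.1 hH.2.2.1 (hH.2.1.trans hH'.2.1.symm)
          (congrFun h.1) h.2
    · obtain ⟨H₁, heq₁, hH₁, hmin⟩ := exists_equi_minimal hH
      have hd1 : H₁.det.re = d := by rw [heq₁.det, hd]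
      have hdpos := hH₁.det_re.2
      obtain ⟨B, hBS, hB⟩ := hSH _ (schur H₁) hH₁.schur rfl
      obtain ⟨H₂, heq₂, h00, hs, hc⟩ := exists_equi_reduced hH₁ hB
      set m := hnorm H₁ (Fin.cons 1 0) with hm
      have hm0 : 0 < m := hnorm_pos hH₁ fun h => by simpa using congrFun h 0
      have hmD := hb H₁ hH₁ m 1 hm0 one_pos fun x hx => by simpa using hmin x hx
      have h00' := entry_zero_zero hH₁.isHermitian
      have hdet := det_schur_re hH₁
      rw [hd1] at hdet hmD hdpos
      rw [← hm] at hdet h00'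
      have hse := hH₁.schur.det_re.2
      refine ⟨H₂, Set.mem_biUnion (x := m) ⟨hm0.le, ?_⟩ ⟨?_, ?_, ?_, fun j => ?_, ?_⟩,
        heq₁.trans heq₂⟩
      · have : m ^ 1 ≤ m ^ (n + 1) := pow_le_pow_right₀ hm0 (by omega)
        simp only [one_pow, mul_one, pow_one] at hmD this
        exact this.trans hmD
      · exact (hH₁.equi heq₂).isHermitian
      · rw [h00, h00']
      · rw [h00, h00']
        exact fun h => hm0.ne' (intCast_injective (by simpa using h))
      · have := hc j
        have := nrm_nonneg (H₂ 0 j.succ)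
        omega
      · rw [hs]
        refine Set.mem_biUnion (x := (schur H₁).det.re) ⟨hse.le, ?_⟩ hBS
        rw [← hdet]
        nlinarith

/-- The setoid of equivalence on unimodular lattices. -/
def ulSetoid (n : ℕ) : Setoid {H : Matrix (Fin n) (Fin n) Eis // IsUL H} where
  r H H' := Equi H.1 H'.1
  iseqv := ⟨fun H => .refl H.1, Equi.symm, Equi.trans⟩

/-- Isometry classes of unimodular lattices of rank `n`. -/
def Cls (n : ℕ) : Type := Quotient (ulSetoid n)

instance (n : ℕ) : Finite (Cls n) := by
  obtain ⟨S, hS, h⟩ := finite_classes n 1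
  have := hS.to_subtype
  have hf : ∀ c : Cls n, ∃ H' : S, Equi (Quotient.out c).1 H' := fun c => by
    have hc := (Quotient.out c).2
    obtain ⟨H', hH', he⟩ := h _ hc.pd (by rw [hc.det, QuadraticAlgebra.re_one])
    exact ⟨⟨H', hH'⟩, he⟩
  choose f hf using hf
  refine Finite.of_injective f fun c c' hcc => ?_
  have h1 := hf c
  rw [hcc] at h1
  have h2 : (ulSetoid n).r (Quotient.out c) (Quotient.out c') := h1.trans (hf c').symm
  exact Quotient.out_equiv_out.1 h2

instance (n : ℕ) : Fintype (Cls n) := Fintype.ofFinite _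

/-- A representative of a class. -/
def Cls.rep {n : ℕ} (c : Cls n) : Matrix (Fin n) (Fin n) Eis := (Quotient.out c).1

lemma Cls.isUL (c : Cls n) : IsUL c.rep := (Quotient.out c).2

lemma Cls.eq_of_equi {c c' : Cls n} (h : Equi c.rep c'.rep) : c = c' :=
  Quotient.out_equiv_out.1 (show (ulSetoid n).r (Quotient.out c) (Quotient.out c') from h)

lemma Cls.exists_equi {H : Matrix (Fin n) (Fin n) Eis} (hH : IsUL H) :
    ∃ c : Cls n, Equi H c.rep := by
  refine ⟨Quotient.mk (ulSetoid n) ⟨H, hH⟩, ?_⟩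
  have h : (ulSetoid n).r (Quotient.out (Quotient.mk (ulSetoid n) ⟨H, hH⟩)) ⟨H, hH⟩ :=
    Quotient.mk_out (s := ulSetoid n) _
  exact Equi.symm h

end

section
variable {n : ℕ}

/-- The isometries between two Gram matrices. -/
def Isom (H K : Matrix (Fin n) (Fin n) Eis) : Set (Matrix (Fin n) (Fin n) Eis)ˣ :=
  {U | (U : Matrix (Fin n) (Fin n) Eis) * H * (U : Matrix (Fin n) (Fin n) Eis)ᴴ = K}

lemma Isom.finite {H : Matrix (Fin n) (Fin n) Eis} (hH : PD H) (K : Matrix (Fin n) (Fin n) Eis) :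
    (Isom H K).Finite :=
  Set.Finite.of_finite_image
    ((finite_congr_eq hH K).subset (by rintro _ ⟨U, hU, rfl⟩; exact hU))
    (f := fun U : (Matrix (Fin n) (Fin n) Eis)ˣ => (U : Matrix (Fin n) (Fin n) Eis))
    (Units.val_injective.injOn)

lemma Isom.mul {H K L : Matrix (Fin n) (Fin n) Eis} {U V : (Matrix (Fin n) (Fin n) Eis)ˣ}
    (hU : U ∈ Isom K L) (hV : V ∈ Isom H K) : U * V ∈ Isom H L := by
  have hU : (U : Matrix (Fin n) (Fin n) Eis) * K * (U : Matrix (Fin n) (Fin n) Eis)ᴴ = L := hU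
  have hV : (V : Matrix (Fin n) (Fin n) Eis) * H * (V : Matrix (Fin n) (Fin n) Eis)ᴴ = K := hV
  show ((U * V : (Matrix (Fin n) (Fin n) Eis)ˣ) : Matrix (Fin n) (Fin n) Eis) * H *
    ((U * V : (Matrix (Fin n) (Fin n) Eis)ˣ) : Matrix (Fin n) (Fin n) Eis)ᴴ = L
  rw [← hU, ← hV]
  simp [Matrix.mul_assoc]

lemma Isom.inv {H K : Matrix (Fin n) (Fin n) Eis} {U : (Matrix (Fin n) (Fin n) Eis)ˣ}
    (hU : U ∈ Isom H K) : U⁻¹ ∈ Isom K H := by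
  have hU : (U : Matrix (Fin n) (Fin n) Eis) * H * (U : Matrix (Fin n) (Fin n) Eis)ᴴ = K := hU
  show ((U⁻¹ : (Matrix (Fin n) (Fin n) Eis)ˣ) : Matrix (Fin n) (Fin n) Eis) * K *
    ((U⁻¹ : (Matrix (Fin n) (Fin n) Eis)ˣ) : Matrix (Fin n) (Fin n) Eis)ᴴ = H
  rw [← hU, ← Matrix.mul_assoc, ← Matrix.mul_assoc, U.inv_mul, Matrix.one_mul, Matrix.mul_assoc,
    unit_conj_cancel, Matrix.mul_one]

lemma Isom.one_mem (H : Matrix (Fin n) (Fin n) Eis) : 1 ∈ Isom H H := by simp [Isom]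

lemma Isom.ncard_eq {H K : Matrix (Fin n) (Fin n) Eis} {U : (Matrix (Fin n) (Fin n) Eis)ˣ}
    (hU : U ∈ Isom H K) : (Isom H K).ncard = (Isom H H).ncard := by
  refine Set.ncard_congr (fun V _ => U⁻¹ * V) (fun V hV => Isom.mul (Isom.inv hU) hV)
    (fun V V' _ _ h => mul_left_cancel h) fun V hV => ⟨U * V, Isom.mul hU hV, by simp⟩

/-- The order of the automorphism group. -/
def autN (H : Matrix (Fin n) (Fin n) Eis) : ℕ := (Isom H H).ncard

lemma autN_pos {H : Matrix (Fin n) (Fin n) Eis} (hH : PD H) : 0 < autN H :=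
  (Set.ncard_pos (Isom.finite hH H)).2 ⟨1, Isom.one_mem H⟩

/-- The weight of a class. -/
def Cls.w (c : Cls n) : ℚ := 1 / (autN c.rep : ℚ)

lemma Cls.autN_ne (c : Cls n) : (autN c.rep : ℚ) ≠ 0 := by
  exact_mod_cast (autN_pos c.isUL.pd).ne'

/-- The mass in rank `n`. -/
def mass (n : ℕ) : ℚ := ∑ c : Cls n, c.w

/-- The number of vectors of norm `m`. -/
def repN (H : Matrix (Fin n) (Fin n) Eis) (m : ℤ) : ℕ := {x | hnorm H x = m}.ncard

lemma finite_hnorm_eq {H : Matrix (Fin n) (Fin n) Eis} (hH : PD H) (m : ℤ) :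
    {x | hnorm H x = m}.Finite :=
  (finite_hnorm_le hH m).subset fun _ h => le_of_eq h

/-- The mass-weighted number of vectors of norm `m`. -/
def wrep (n : ℕ) (m : ℤ) : ℚ := ∑ c : Cls n, c.w * repN c.rep m

/-- Counting a disjoint family of torsors. -/
lemma sum_torsor {B S X : Type*} [Fintype B] (g : B → ℕ) (hg : ∀ b, g b ≠ 0) (f : B → ℚ)
    (Q : B → Set X) (hQ : ∀ b, (Q b).Finite) (π : X → S) (T : Finset S)
    (hπ : ∀ b, ∀ x ∈ Q b, π x ∈ T) (F : S → ℚ)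
    (h : ∀ s ∈ T, ∃ b₀, f b₀ = F s ∧ (∀ b, ∀ x ∈ Q b, π x = s → b = b₀) ∧
      {x | x ∈ Q b₀ ∧ π x = s}.ncard = g b₀) :
    ∑ b, 1 / (g b : ℚ) * f b * (Q b).ncard = ∑ s ∈ T, F s := by
  classical
  have h1 : ∀ b, (Q b).ncard = ∑ s ∈ T, {x | x ∈ Q b ∧ π x = s}.ncard := fun b => by
    rw [Set.ncard_eq_toFinset_card _ (hQ b), Finset.card_eq_sum_card_fiberwise (f := π) (t := T)]
    · refine Finset.sum_congr rfl fun s _ => ?_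
      rw [← Set.ncard_coe_finset]
      congr 1
      ext x; simp
    · intro x hx
      exact hπ b x (by simpa using hx)
  simp_rw [h1]
  push_cast
  simp_rw [Finset.mul_sum]
  rw [Finset.sum_comm]
  refine Finset.sum_congr rfl fun s hs => ?_
  obtain ⟨b₀, hf, hu, hc⟩ := h s hs
  rw [Finset.sum_eq_single b₀]
  · rw [hc, hf]
    have := hg b₀
    field_simp
  · intro b _ hb
    have : {x | x ∈ Q b ∧ π x = s} = ∅ := by
      ext x; simp only [Set.mem_ofPred_eq, Set.mem_empty_iff_false, iff_false]
      rintro ⟨hx, hxs⟩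
      exact hb (hu b x hx hxs)
    simp [this]
  · simp

lemma lower_mul {R : Type*} [CommRing R] (U V : Matrix (Fin n) (Fin n) R) :
    lower 0 U * lower 0 V = lower 0 (U * V) := by
  ext i j
  rw [mul_apply, Fin.sum_univ_succ]
  refine Fin.cases ?_ (fun i => ?_) i
  · simp [lower_zero]
  · refine Fin.cases ?_ (fun j => ?_) j
    · simp [lower_zero, lower_succ]
    · simp [lower_zero, lower_succ, mul_apply]

lemma lower_one {R : Type*} [CommRing R] : lower 0 (1 : Matrix (Fin n) (Fin n) R) = 1 := by
  ext i j
  refine Fin.cases ?_ (fun i => ?_) i <;> refine Fin.cases ?_ (fun j => ?_) j <;>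
    simp [lower_zero, lower_succ, one_apply, (Fin.succ_ne_zero _).symm]

/-- Bordering by `1` as a monoid homomorphism. -/
def lowerHom (n : ℕ) : Matrix (Fin n) (Fin n) Eis →* Matrix (Fin (n + 1)) (Fin (n + 1)) Eis where
  toFun := lower 0
  map_one' := lower_one
  map_mul' U V := (lower_mul U V).symm

lemma schur_lower {R : Type*} [CommRing R] (H : Matrix (Fin n) (Fin n) R) :
    schur (lower 0 H) = H := by
  ext i j; simp [schur, lower_zero, lower_succ]

lemma exists_lower_of_row {H K : Matrix (Fin n) (Fin n) Eis}
    {Z : (Matrix (Fin (n + 1)) (Fin (n + 1)) Eis)ˣ}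
    (h0 : (Z : Matrix (Fin (n + 1)) (Fin (n + 1)) Eis) 0 = Fin.cons 1 0)
    (hZ : Z ∈ Isom (lower 0 H) (lower 0 K)) :
    ∃ Z' ∈ Isom H K, Units.map (lowerHom n) Z' = Z := by
  have hZ : (Z : Matrix (Fin (n + 1)) (Fin (n + 1)) Eis) * lower 0 H *
    (Z : Matrix (Fin (n + 1)) (Fin (n + 1)) Eis)ᴴ = lower 0 K := hZ
  set t : Fin n → Eis := fun j => (Z : Matrix (Fin (n + 1)) (Fin (n + 1)) Eis) j.succ 0
  set W : Matrix (Fin n) (Fin n) Eis := of fun i j =>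
    (Z : Matrix (Fin (n + 1)) (Fin (n + 1)) Eis) i.succ j.succ
  have hZl : (Z : Matrix (Fin (n + 1)) (Fin (n + 1)) Eis) = lower t W := by
    refine Matrix.ext fun i j => ?_
    refine Fin.cases ?_ (fun i => ?_) i
    · rw [h0, lower_zero]
    · refine Fin.cases ?_ (fun j => ?_) j <;> simp [lower_succ, t, W]
  rw [hZl] at hZ
  have ht : t = 0 := by
    funext j
    have := lower_congr_zero_succ (lower 0 H) t W j
    rw [hZ] at this
    simp only [lower_zero, Fin.cons_zero, Fin.cons_succ, Pi.zero_apply, zero_mul,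
      Finset.sum_const_zero, add_zero, one_mul] at this
    simpa using this.symm
  have hW : IsUnit W := by
    rw [Matrix.isUnit_iff_isUnit_det, ← det_lower t W, ← hZl]
    exact (Matrix.isUnit_iff_isUnit_det _).1 Z.isUnit
  obtain ⟨W', hW'⟩ := hW
  refine ⟨W', ?_, ?_⟩
  · show W'.1 * H * W'.1ᴴ = K
    rw [hW', ← schur_lower K, ← hZ, schur_lower_congr, schur_lower]
  · ext1
    rw [hZl, ht, ← hW']; rfl

lemma lower_zero_conj {R : Type*} [CommRing R] [StarRing R] (W H : Matrix (Fin n) (Fin n) R) :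
    lower 0 W * lower 0 H * (lower 0 W)ᴴ = lower 0 (W * H * Wᴴ) := by
  have : (lower 0 W)ᴴ = lower 0 Wᴴ := by
    ext i j
    refine Fin.cases ?_ (fun i => ?_) i <;> refine Fin.cases ?_ (fun j => ?_) j <;>
      simp [lower_zero, lower_succ, conjTranspose_apply]
  rw [this, lower_mul, lower_mul]

lemma Isom.lower {H K : Matrix (Fin n) (Fin n) Eis} {U : (Matrix (Fin n) (Fin n) Eis)ˣ}
    (hU : U ∈ Isom H K) : Units.map (lowerHom n) U ∈ Isom (lower 0 H) (lower 0 K) := by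
  have hU : U.1 * H * U.1ᴴ = K := hU
  show EisMass.lower 0 U.1 * _ * (EisMass.lower 0 U.1)ᴴ = _
  rw [lower_zero_conj, hU]

lemma lowerHom_injective : Function.Injective (Units.map (lowerHom n)) := fun U V h => by
  have h1 : lower 0 U.1 = lower 0 V.1 := congrArg Units.val h
  ext1
  rw [← schur_lower U.1, h1, schur_lower]

lemma PD.lower {H : Matrix (Fin n) (Fin n) Eis} (hH : PD H) : PD (lower 0 H) := by
  unfold PD
  rw [posDef_iff_hf]
  have h0 : (EisMass.lower 0 H).map toC = EisMass.lower 0 (H.map toC) := by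
    ext i j
    refine Fin.cases ?_ (fun i => ?_) i <;> refine Fin.cases ?_ (fun j => ?_) j <;>
      simp [lower_zero, lower_succ]
  rw [h0]
  refine ⟨?_, fun x hx => ?_⟩
  · ext i j
    have := fun i j => hH.1.apply i j
    refine Fin.cases ?_ (fun i => ?_) i <;> refine Fin.cases ?_ (fun j => ?_) j <;>
      simp [lower_zero, lower_succ, conjTranspose_apply]
    exact this i j
  · have h1 := hf_schur (EisMass.lower 0 (H.map toC)) x x
    have h2 : (EisMass.lower 0 (H.map toC)) 0 0 = 1 := rfl
    rw [schur_lower, hf_cons_one, hf_cons_one_left, h2] at h1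
    simp only [lower_zero, lower_succ, Fin.cons_zero, Fin.cons_succ, Pi.zero_apply, mul_zero,
      Finset.sum_const_zero, add_zero, one_mul, zero_mul] at h1
    rw [h1]
    have h3 : 0 ≤ x 0 * star (x 0) := mul_star_self_nonneg _
    by_cases hx0 : Fin.tail x = 0
    · have : x 0 ≠ 0 := fun h => hx (by
        rw [← Fin.cons_self_tail x, hx0, h]
        funext i; refine Fin.cases ?_ (fun i => ?_) i <;> simp)
      have h4 : 0 < x 0 * star (x 0) := lt_of_le_of_ne h3 (by simpa using this)
      rw [hx0]; simpa [hf] using h4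
    · have h4 := (posDef_iff_hf.1 hH).2 _ hx0
      exact add_pos_of_nonneg_of_pos h3 h4

lemma IsUL.lower {H : Matrix (Fin n) (Fin n) Eis} (hH : IsUL H) : IsUL (lower 0 H) :=
  ⟨hH.pd.lower, by rw [det_lower, hH.det]⟩

lemma exists_isom_lower {H : Matrix (Fin (n + 1)) (Fin (n + 1)) Eis} (hH : IsUL H)
    {v : Fin (n + 1) → Eis} (hv : hnorm H v = 1) :
    ∃ c : Cls n, ∃ W ∈ Isom H (lower 0 c.rep), (W : Matrix (Fin (n + 1)) (Fin (n + 1)) Eis) 0 = v := by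
  have hv0 : v ≠ 0 := by rintro rfl; rw [hnorm_zero] at hv; exact absurd hv (by norm_num)
  obtain ⟨W, hW⟩ := exists_unit_of_minimal hH.pd hv0 fun x hx => by
    rw [hv]; exact hnorm_pos hH.pd hx
  set H₁ := W.1 * H * W.1ᴴ with hH₁
  have hU₁ : IsUL H₁ := hH.congr W
  have h00 : H₁ 0 0 = 1 := by
    rw [hH₁, congr_apply, hW, hf_self hH.pd.isHermitian, hv, Int.cast_one]
  have hd := det_schur H₁
  rw [h00, hU₁.det] at hd
  have hs : IsUL (schur H₁) := ⟨hU₁.pd.schur, by simpa using hd⟩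
  obtain ⟨c, V, hV⟩ := Cls.exists_equi hs
  obtain ⟨U, hU⟩ := isUnit_lower (fun j => -star (∑ i : Fin n, H₁ 0 i.succ * star (V.1 j i))) V
  refine ⟨c, U * W, ?_, ?_⟩
  · show (U.1 * W.1) * H * (U.1 * W.1)ᴴ = _
    have e : (U.1 * W.1) * H * (U.1 * W.1)ᴴ = U.1 * H₁ * U.1ᴴ := by
      rw [hH₁, conjTranspose_mul]; simp only [Matrix.mul_assoc]
    rw [e, hU]
    have hUL : IsUL (U.1 * H₁ * U.1ᴴ) := hU₁.congr U
    rw [hU] at hUL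
    apply eq_of_schur_eq hUL.pd.isHermitian c.isUL.pd.lower.isHermitian
    · rw [lower_congr_zero_zero, h00]; exact one_ne_zero
    · rw [lower_congr_zero_zero, h00]; rfl
    · intro j
      rw [lower_congr_zero_succ, h00]
      simp [lower_zero]
    · rw [schur_lower_congr, schur_lower, hV]
  · rw [← hW, Units.val_mul, hU]
    funext j
    simp [mul_apply, lower_zero, Fin.sum_univ_succ]

lemma row_zero_mul (U : Matrix (Fin n) (Fin n) Eis) (W : Matrix (Fin (n + 1)) (Fin (n + 1)) Eis) :
    (lower 0 U * W) 0 = W 0 := by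
  funext j; simp [mul_apply, lower_zero, Fin.sum_univ_succ]

lemma row_zero_mul_inv {W W' : (Matrix (Fin (n + 1)) (Fin (n + 1)) Eis)ˣ}
    (h : W.1 0 = W'.1 0) : (W' * W⁻¹).1 0 = Fin.cons 1 0 := by
  have h1 : (W * W⁻¹).1 0 = Fin.cons 1 0 := by
    rw [mul_inv_cancel]
    funext j; refine Fin.cases ?_ (fun j => ?_) j <;>
      simp [one_apply, (Fin.succ_ne_zero _).symm]
  rw [← h1]
  funext j
  rw [Units.val_mul, Units.val_mul, mul_apply, mul_apply, h]

lemma sum_isom_lower {H : Matrix (Fin (n + 1)) (Fin (n + 1)) Eis} (hH : IsUL H) :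
    ∑ b : Cls n, b.w * (Isom H (lower 0 b.rep)).ncard = repN H 1 := by
  have hfin := finite_hnorm_eq hH.pd 1
  have := sum_torsor (fun b : Cls n => autN b.rep) (fun b => (autN_pos b.isUL.pd).ne') (fun _ => 1)
    (fun b => Isom H (lower 0 b.rep)) (fun b => Isom.finite hH.pd _)
    (fun W => (W : Matrix (Fin (n + 1)) (Fin (n + 1)) Eis) 0) hfin.toFinset
    (fun b W hW => ?_) (fun _ => 1) (fun v hv => ?_)
  · rw [repN, Set.ncard_eq_toFinset_card _ hfin]
    simpa [Cls.w] using this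
  · have hW : W.1 * H * W.1ᴴ = lower 0 b.rep := hW
    have h1 := congr_apply H W.1 0 0
    rw [hW] at h1
    simp only [Set.Finite.mem_toFinset, Set.mem_ofPred_eq, hnorm]
    rw [← h1]; simp [lower_zero, QuadraticAlgebra.re_one]
  · obtain ⟨b, W, hW, hWv⟩ := exists_isom_lower hH (by simpa using hv)
    refine ⟨b, rfl, fun b' W' hW' hv' => ?_, ?_⟩
    · obtain ⟨Z, hZ, _⟩ := exists_lower_of_row (row_zero_mul_inv (hWv.trans hv'.symm))
        (Isom.mul hW' (Isom.inv hW))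
      exact (Cls.eq_of_equi ⟨Z, Eq.symm hZ⟩).symm
    · symm
      refine Set.ncard_congr (fun U _ => Units.map (lowerHom n) U * W) (fun U hU => ?_)
        (fun U V _ _ h => lowerHom_injective (mul_right_cancel h)) fun W' hW' => ?_
      · refine ⟨Isom.mul (Isom.lower hU) hW, ?_⟩
        rw [← hWv]
        exact row_zero_mul _ _
      · obtain ⟨Z, hZ, hZW⟩ := exists_lower_of_row (row_zero_mul_inv (hWv.trans hW'.2.symm))
          (Isom.mul hW'.1 (Isom.inv hW))
        exact ⟨Z, hZ, by rw [hZW, inv_mul_cancel_right]⟩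

lemma sum_isom_to {K : Matrix (Fin n) (Fin n) Eis} (hK : IsUL K) :
    ∑ a : Cls n, a.w * (Isom a.rep K).ncard = 1 := by
  obtain ⟨a, U, hU⟩ := Cls.exists_equi hK
  have hU : U ∈ Isom K a.rep := Eq.symm hU
  rw [Finset.sum_eq_single a]
  · rw [Isom.ncard_eq (Isom.inv hU), Cls.w, autN]
    exact one_div_mul_cancel a.autN_ne
  · intro a' _ ha'
    have : Isom a'.rep K = ∅ := by
      ext V; simp only [Set.mem_empty_iff_false, iff_false]
      intro hV
      exact ha' (Cls.eq_of_equi ⟨U * V, Eq.symm (Isom.mul hU hV)⟩)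
    simp [this]
  · simp

/-- Vectors of norm one split off. -/
theorem wrep_one (n : ℕ) : wrep (n + 1) 1 = mass n := by
  unfold wrep mass
  simp_rw [← fun c : Cls (n + 1) => sum_isom_lower c.isUL, Finset.mul_sum]
  rw [Finset.sum_comm]
  refine Finset.sum_congr rfl fun b _ => ?_
  calc ∑ a : Cls (n + 1), a.w * (b.w * (Isom a.rep (lower 0 b.rep)).ncard)
      = b.w * ∑ a : Cls (n + 1), a.w * (Isom a.rep (lower 0 b.rep)).ncard := by
        rw [Finset.mul_sum]; exact Finset.sum_congr rfl fun a _ => by ring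
    _ = b.w := by rw [sum_isom_to b.isUL.lower, mul_one]

theorem mass_zero : mass 0 = 1 := by
  have h1 : ∀ H K : Matrix (Fin 0) (Fin 0) Eis, H = K := fun H K => Subsingleton.elim _ _
  have : IsUL (1 : Matrix (Fin 0) (Fin 0) Eis) :=
    ⟨by unfold PD; rw [posDef_iff_hf]; exact ⟨Subsingleton.elim _ _,
      fun x hx => (hx (Subsingleton.elim _ _)).elim⟩, by simp⟩
  have h2 := sum_isom_to this
  rw [← h2]
  unfold mass
  refine Finset.sum_congr rfl fun a _ => ?_
  have : Isom a.rep 1 = {1} := by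
    ext U; simp only [Set.mem_singleton_iff]
    exact ⟨fun _ => Subsingleton.elim _ _, fun _ => Subsingleton.elim _ _⟩
  rw [this]; simp

end

section
variable {n : ℕ}

/-- Vectors divisible by two. -/
def Ev (v : Fin n → Eis) : Prop := ∃ u, v = (2 : Eis) • u

lemma Eis.dvd_intCast_iff {k : ℤ} {z : Eis} : (k : Eis) ∣ z ↔ k ∣ z.re ∧ k ∣ z.im := by
  constructor
  · rintro ⟨w, rfl⟩
    simp
  · rintro ⟨⟨a, ha⟩, ⟨b, hb⟩⟩
    exact ⟨⟨a, b⟩, by ext <;> simp [ha, hb]⟩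

lemma Eis.two_dvd_iff {z : Eis} : (2 : Eis) ∣ z ↔ 2 ∣ z.re ∧ 2 ∣ z.im := by
  simpa using Eis.dvd_intCast_iff (k := 2) (z := z)

lemma Eis.star_dvd_star {k : ℤ} {z : Eis} (h : (k : Eis) ∣ z) : (k : Eis) ∣ star z := by
  obtain ⟨w, rfl⟩ := h
  exact ⟨star w, by rw [star_mul, star_intCast, mul_comm]⟩

lemma Eis.two_dvd_star {z : Eis} (h : (2 : Eis) ∣ z) : (2 : Eis) ∣ star z := by
  simpa using Eis.star_dvd_star (k := 2) (by simpa using h)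

lemma Eis.four_dvd_star {z : Eis} (h : (4 : Eis) ∣ z) : (4 : Eis) ∣ star z := by
  simpa using Eis.star_dvd_star (k := 4) (by simpa using h)

lemma Eis.exists_inv_mod_two {z : Eis} (h : ¬ (2 : Eis) ∣ z) : ∃ c k, c * z = 1 + 2 * k := by
  have h1 : nrm z % 2 = 1 := by
    rw [Eis.two_dvd_iff] at h
    unfold nrm
    have := Int.emod_two_eq_zero_or_one z.re
    have := Int.emod_two_eq_zero_or_one z.im
    have e1 : (z.re ^ 2 - z.re * z.im + z.im ^ 2) % 2 =
      ((z.re % 2) ^ 2 - (z.re % 2) * (z.im % 2) + (z.im % 2) ^ 2) % 2 := by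
      simp [Int.add_emod, Int.sub_emod, Int.mul_emod, pow_two]
    rw [e1]
    rcases this with h2 | h2 <;> rcases ‹z.re % 2 = 0 ∨ _› with h3 | h3 <;> rw [h2, h3] <;>
      norm_num <;> omega
  refine ⟨star z, ((nrm z / 2 : ℤ) : Eis), ?_⟩
  rw [mul_comm, mul_star_self]
  have : nrm z = 1 + 2 * (nrm z / 2) := by omega
  conv_lhs => rw [this]
  push_cast; ring

lemma two_ne_zero_eis : (2 : Eis) ≠ 0 := fun h => by
  have : ((2 : ℤ) : Eis) = ((0 : ℤ) : Eis) := by simpa using h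
  exact absurd (intCast_injective this) (by norm_num)

lemma star_two_eis : star (2 : Eis) = 2 := by simp

lemma four_eq : (4 : Eis) = 2 * 2 := by norm_num

/-- An inverse for a unimodular Gram matrix. -/
lemma IsUL.exists_inv {H : Matrix (Fin n) (Fin n) Eis} (hH : IsUL H) :
    ∃ J : Matrix (Fin n) (Fin n) Eis, H * J = 1 ∧ J * H = 1 := by
  have : IsUnit H.det := by rw [hH.det]; exact isUnit_one
  exact ⟨H⁻¹, mul_nonsing_inv H this, nonsing_inv_mul H this⟩

lemma IsUL.dvd_of_forall {H : Matrix (Fin n) (Fin n) Eis} (hH : IsUL H) {d : Eis}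
    (hd : star d = d) {z : Fin n → Eis} (h : ∀ x, d ∣ hf H x z) : ∃ u, z = d • u := by
  obtain ⟨J, -, hJ⟩ := hH.exists_inv
  have h1 : ∀ i, d ∣ (H *ᵥ star z) i := fun i => by
    have := h (Pi.single i 1)
    rwa [hf, single_one_dotProduct] at this
  choose t ht using h1
  have h2 : H *ᵥ star z = d • t := funext ht
  have h3 : star z = d • (J *ᵥ t) := by
    rw [← mulVec_smul, ← h2, mulVec_mulVec, hJ, one_mulVec]
  refine ⟨star (J *ᵥ t), ?_⟩
  rw [← star_star z, h3]
  ext i <;> simp [hd]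

lemma IsUL.exists_dual {H : Matrix (Fin n) (Fin n) Eis} (hH : IsUL H) {v : Fin n → Eis}
    (hv : ¬ Ev v) : ∃ w k, hf H w v = 1 + 2 * k := by
  have : ∃ x, ¬ (2 : Eis) ∣ hf H x v := by
    by_contra! h
    exact hv (hH.dvd_of_forall star_two_eis h)
  obtain ⟨x, hx⟩ := this
  obtain ⟨c, k, hc⟩ := Eis.exists_inv_mod_two hx
  exact ⟨c • x, k, by rw [hf_smul_left, hc]⟩

/-- The neighbour of the lattice attached to a vector `v`, as a sublattice scaled by two. -/
def nbr (H : Matrix (Fin n) (Fin n) Eis) (v : Fin n → Eis) : Submodule Eis (Fin n → Eis) where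
  carrier := {z | (∃ (a : Eis) (u : Fin n → Eis), z = a • v + (2 : Eis) • u) ∧ 4 ∣ hf H z v}
  add_mem' := by
    rintro _ _ ⟨⟨a, u, rfl⟩, h⟩ ⟨⟨b, u', rfl⟩, h'⟩
    refine ⟨⟨a + b, u + u', ?_⟩, by rw [hf_add_left]; exact dvd_add h h'⟩
    rw [add_smul, smul_add]; abel
  zero_mem' := ⟨⟨0, 0, by simp⟩, by simp [hf]⟩
  smul_mem' := by
    rintro c _ ⟨⟨a, u, rfl⟩, h⟩
    refine ⟨⟨c * a, c • u, ?_⟩, by rw [hf_smul_left]; exact h.mul_left c⟩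
    rw [smul_add, smul_smul, smul_comm c (2 : Eis) u]

lemma mem_nbr {H : Matrix (Fin n) (Fin n) Eis} {v z : Fin n → Eis} : z ∈ nbr H v ↔
    (∃ (a : Eis) (u : Fin n → Eis), z = a • v + (2 : Eis) • u) ∧ 4 ∣ hf H z v := Iff.rfl

variable {H : Matrix (Fin n) (Fin n) Eis} {v : Fin n → Eis}

lemma self_mem_nbr (hv : 4 ∣ hf H v v) : v ∈ nbr H v :=
  ⟨⟨1, 0, by simp⟩, hv⟩

lemma mem_nbr_iff (hv : 4 ∣ hf H v v) {a : Eis} {u : Fin n → Eis} :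
    a • v + (2 : Eis) • u ∈ nbr H v ↔ 2 ∣ hf H u v := by
  rw [mem_nbr, and_iff_right ⟨a, u, rfl⟩, hf_add_left, hf_smul_left, hf_smul_left,
    dvd_add_right (hv.mul_left a), four_eq, mul_dvd_mul_iff_left two_ne_zero_eis]

lemma two_smul_mem_nbr (hv : 4 ∣ hf H v v) {u : Fin n → Eis} :
    (2 : Eis) • u ∈ nbr H v ↔ 2 ∣ hf H u v := by
  simpa using mem_nbr_iff hv (a := 0) (u := u)

lemma exists_of_mem_nbr (hv : 4 ∣ hf H v v) {z : Fin n → Eis} (hz : z ∈ nbr H v) :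
    ∃ (a : Eis) (u : Fin n → Eis), z = a • v + (2 : Eis) • u ∧ 2 ∣ hf H u v := by
  obtain ⟨a, u, rfl⟩ := hz.1
  exact ⟨a, u, rfl, (mem_nbr_iff hv).1 hz⟩

lemma nbr_isotropic (hH : H.IsHermitian) (hv : 4 ∣ hf H v v) {z z' : Fin n → Eis}
    (hz : z ∈ nbr H v) (hz' : z' ∈ nbr H v) : 4 ∣ hf H z z' := by
  obtain ⟨a, u, rfl, k, hk⟩ := exists_of_mem_nbr hv hz
  obtain ⟨b, u', rfl, k', hk'⟩ := exists_of_mem_nbr hv hz'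
  have h1 : hf H v u' = 2 * star k' := by
    rw [← hf_star hH, hk', star_mul, star_two_eis, mul_comm]
  simp only [hf_add_left, hf_add_right, hf_smul_left, hf_smul_right, star_two_eis, h1, hk]
  obtain ⟨c, hc⟩ := hv
  rw [hc]
  exact ⟨star b * (a * c) + star b * k + a * star k' + hf H u u', by ring⟩

lemma nbr_le_of_mem (hH : H.IsHermitian) (hv : 4 ∣ hf H v v) {v' : Fin n → Eis}
    (hv' : v' ∈ nbr H v) (hE : ¬ Ev v') : nbr H v ≤ nbr H v' := by
  intro z hz
  refine ⟨?_, nbr_isotropic hH hv hz hv'⟩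
  obtain ⟨a, u, rfl⟩ := hv'.1
  obtain ⟨b, x, rfl⟩ := hz.1
  have ha : ¬ (2 : Eis) ∣ a := by
    rintro ⟨k, rfl⟩
    exact hE ⟨k • v + u, by rw [smul_add, smul_smul]⟩
  obtain ⟨c, k, hc⟩ := Eis.exists_inv_mod_two ha
  refine ⟨b * c, x - (b * c) • u - (b * k) • v, ?_⟩
  have h1 : b * c * a = b + 2 * (b * k) := by linear_combination b * hc
  ext1 i
  simp only [Pi.add_apply, Pi.smul_apply, Pi.sub_apply, smul_eq_mul]
  linear_combination -(v i) * h1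

lemma nbr_eq_of_mem (hH : H.IsHermitian) (hv : 4 ∣ hf H v v) (hE : ¬ Ev v) {v' : Fin n → Eis}
    (hv' : v' ∈ nbr H v) (hE' : ¬ Ev v') : nbr H v' = nbr H v := by
  have h1 := nbr_le_of_mem hH hv hv' hE'
  exact le_antisymm (nbr_le_of_mem hH (nbr_isotropic hH hv hv' hv') (h1 (self_mem_nbr hv)) hE) h1

/-- Neighbours are self-dual for the form divided by four. -/
lemma nbr_dual (hH : IsUL H) (hv : 4 ∣ hf H v v) (hE : ¬ Ev v) {z : Fin n → Eis}
    (h : ∀ x ∈ nbr H v, 4 ∣ hf H x z) : z ∈ nbr H v := by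
  obtain ⟨w, k, hw⟩ := hH.exists_dual hE
  have h1 : ∀ x, 2 ∣ hf H x (z - star (hf H w z) • v) := fun x => by
    have hu : 2 ∣ hf H (x - hf H x v • w) v := by
      rw [sub_eq_add_neg, ← neg_smul, hf_add_left, hf_smul_left, hw]
      exact ⟨-hf H x v * k, by ring⟩
    have h2 := h _ ((two_smul_mem_nbr hv).2 hu)
    rw [hf_smul_left, four_eq, mul_dvd_mul_iff_left two_ne_zero_eis, sub_eq_add_neg, ← neg_smul,
      hf_add_left, hf_smul_left] at h2
    rw [sub_eq_add_neg, ← neg_smul, hf_add_right, hf_smul_right, star_neg, star_star]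
    convert h2 using 1; ring
  obtain ⟨u, hu⟩ := hH.dvd_of_forall star_two_eis h1
  refine ⟨⟨star (hf H w z), u, by rw [← hu]; abel⟩, ?_⟩
  rw [← hf_star hH.pd.isHermitian]
  exact Eis.four_dvd_star (h v (self_mem_nbr hv))

/-- The set of neighbours. -/
def nbrs (H : Matrix (Fin n) (Fin n) Eis) : Set (Submodule Eis (Fin n → Eis)) :=
  {N | ∃ v, ¬ Ev v ∧ 4 ∣ hf H v v ∧ N = nbr H v}

lemma unique_nbr (hH : H.IsHermitian) {x : Fin n → Eis} (hE : ¬ Ev x) (hx : 4 ∣ hf H x x) :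
    {N | N ∈ nbrs H ∧ x ∈ N} = {nbr H x} := by
  ext N
  simp only [Set.mem_ofPred_eq, Set.mem_singleton_iff]
  constructor
  · rintro ⟨⟨v, hv, hv4, rfl⟩, hxN⟩
    exact (nbr_eq_of_mem hH hv4 hv hxN hE).symm
  · rintro rfl
    exact ⟨⟨x, hE, hx, rfl⟩, self_mem_nbr hx⟩

end

section
variable {n : ℕ}

lemma mul_eq_smul_one_comm {R : Type*} [CommRing R] [IsDomain R] {X W : Matrix (Fin n) (Fin n) R}
    {c : R} (hc : c ≠ 0) (h : X * W = c • (1 : Matrix (Fin n) (Fin n) R)) :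
    W * X = c • (1 : Matrix (Fin n) (Fin n) R) := by
  have hX : X.det ≠ 0 := fun h0 => by
    have := congrArg Matrix.det h
    rw [det_mul, h0, zero_mul, det_smul, det_one, mul_one] at this
    exact pow_ne_zero _ hc this.symm
  have h1 : X.det • (W * X) = X.det • (c • (1 : Matrix (Fin n) (Fin n) R)) := by
    calc X.det • (W * X) = X.adjugate * X * (W * X) := by rw [adjugate_mul]; simp
      _ = X.adjugate * (X * W) * X := by simp only [Matrix.mul_assoc]
      _ = X.det • (c • (1 : Matrix (Fin n) (Fin n) R)) := by
        rw [h, Matrix.mul_smul, Matrix.mul_one, Matrix.smul_mul, adjugate_mul, smul_comm]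
  exact smul_right_injective _ hX h1

lemma four_ne_zero_eis : (4 : Eis) ≠ 0 := by
  rw [four_eq]; exact mul_ne_zero two_ne_zero_eis two_ne_zero_eis

/-- Bases of neighbours of `A` isometric (after scaling) to `B`. -/
def Frames (A B : Matrix (Fin n) (Fin n) Eis) : Set (Matrix (Fin n) (Fin n) Eis) :=
  {Y | Y * A * Yᴴ = (4 : Eis) • B ∧ (∃ c r Z, Y = vecMulVec c r + (2 : Eis) • Z) ∧
    ¬ ∃ Z, Y = (2 : Eis) • Z}

/-- The span of the rows. -/
def rowspan (Y : Matrix (Fin n) (Fin n) Eis) : Submodule Eis (Fin n → Eis) :=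
  LinearMap.range Y.vecMulLinear

lemma mem_rowspan {Y : Matrix (Fin n) (Fin n) Eis} {z : Fin n → Eis} :
    z ∈ rowspan Y ↔ ∃ t, t ᵥ* Y = z := Iff.rfl

variable {A B C Y Y' : Matrix (Fin n) (Fin n) Eis}

lemma Frames.finite (hA : PD A) (B : Matrix (Fin n) (Fin n) Eis) : (Frames A B).Finite :=
  (finite_congr_eq hA ((4 : Eis) • B)).subset fun _ h => h.1

lemma Frames.exists_right (hB : IsUL B) (hY : Y ∈ Frames A B) :
    ∃ V, Y * V = (4 : Eis) • (1 : Matrix (Fin n) (Fin n) Eis) ∧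
      V * Y = (4 : Eis) • (1 : Matrix (Fin n) (Fin n) Eis) := by
  obtain ⟨J, hJ, -⟩ := hB.exists_inv
  have h : Y * (A * Yᴴ * J) = (4 : Eis) • (1 : Matrix (Fin n) (Fin n) Eis) := by
    rw [← Matrix.mul_assoc, ← Matrix.mul_assoc, hY.1, Matrix.smul_mul, hJ]
  exact ⟨_, h, mul_eq_smul_one_comm four_ne_zero_eis h⟩

lemma Frames.mul_right_cancel (hB : IsUL B) (hY : Y ∈ Frames A B)
    {S T : Matrix (Fin n) (Fin n) Eis} (h : S * Y = T * Y) : S = T := by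
  obtain ⟨V, hV, -⟩ := Frames.exists_right hB hY
  have := congrArg (· * V) h
  simp only [Matrix.mul_assoc, hV, Matrix.mul_smul, Matrix.mul_one] at this
  exact smul_right_injective _ four_ne_zero_eis this

lemma Frames.vecMul_injective (hB : IsUL B) (hY : Y ∈ Frames A B) :
    Function.Injective fun t : Fin n → Eis => t ᵥ* Y := by
  obtain ⟨V, hV, -⟩ := Frames.exists_right hB hY
  intro s t h
  have := congrArg (· ᵥ* V) h
  simp only [vecMul_vecMul, hV, vecMul_smul, vecMul_one] at this
  exact smul_right_injective _ four_ne_zero_eis this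

lemma Frames.rowspan_mem_nbrs (hA : IsUL A) (hB : IsUL B) (hY : Y ∈ Frames A B) :
    rowspan Y ∈ nbrs A := by
  obtain ⟨h1, ⟨c, r, Z, hYc⟩, h3⟩ := hY
  have h4 : ∃ i, ¬ Ev (Y i) := by
    by_contra! h
    choose Z hZ using h
    exact h3 ⟨of Z, Matrix.ext fun i j => by rw [hZ i]; rfl⟩
  obtain ⟨i, hi⟩ := h4
  have hrow : ∀ t : Fin n → Eis, t ᵥ* Y = (t ⬝ᵥ c) • r + (2 : Eis) • (t ᵥ* Z) := fun t => by
    rw [hYc, vecMul_add, vecMul_smul]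
    congr 1
    funext j
    simp [vecMul, dotProduct, vecMulVec_apply, Finset.sum_mul, mul_assoc]
  have hYi : Y i = c i • r + (2 : Eis) • Z i := by
    have := hrow (Pi.single i 1)
    rwa [single_one_vecMul, single_one_vecMul, single_one_dotProduct] at this
  have hYij : ∀ j k, hf A (Y j) (Y k) = 4 * B j k := fun j k => by
    rw [← congr_apply, h1]; rfl
  have hiso : 4 ∣ hf A (Y i) (Y i) := ⟨_, hYij i i⟩
  have hci : ¬ (2 : Eis) ∣ c i := by
    rintro ⟨k, hk⟩
    exact hi ⟨k • r + Z i, by rw [hYi, hk, smul_add, smul_smul]⟩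
  obtain ⟨d, k, hd⟩ := Eis.exists_inv_mod_two hci
  have hle : ∀ t : Fin n → Eis, t ᵥ* Y ∈ nbr A (Y i) := fun t => by
    refine ⟨⟨t ⬝ᵥ c * d, t ᵥ* Z - (t ⬝ᵥ c * d) • Z i - (t ⬝ᵥ c * k) • r, ?_⟩, ?_⟩
    · rw [hrow, hYi]
      funext j
      simp only [Pi.add_apply, Pi.smul_apply, Pi.sub_apply, smul_eq_mul]
      linear_combination -(t ⬝ᵥ c) * (r j) * hd
    · refine ⟨hf B t (Pi.single i 1), ?_⟩
      rw [← hf_smul_matrix, ← h1, hf_congr, single_one_vecMul]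
      rfl
  refine ⟨Y i, hi, hiso, le_antisymm (by rintro _ ⟨t, rfl⟩; exact hle t) fun z hz => ?_⟩
  have hz2 : ∀ j, ∃ s, hf A z (Y j) = 4 * s := fun j => by
    refine nbr_isotropic hA.pd.isHermitian hiso hz ?_
    have := hle (Pi.single j 1)
    rwa [single_one_vecMul] at this
  choose s hs using hz2
  obtain ⟨J, hJ, -⟩ := hB.exists_inv
  have h5 : Y * (A * Yᴴ * J) = (4 : Eis) • (1 : Matrix (Fin n) (Fin n) Eis) := by
    rw [← Matrix.mul_assoc, ← Matrix.mul_assoc, h1, Matrix.smul_mul, hJ]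
  have h6 := mul_eq_smul_one_comm four_ne_zero_eis h5
  have h7 : z ᵥ* (A * Yᴴ) = (4 : Eis) • s := by
    funext j
    rw [Pi.smul_apply, smul_eq_mul, ← hs, hf, dotProduct_mulVec, ← vecMul_vecMul]
    rfl
  refine ⟨(s ᵥ* J), ?_⟩
  refine smul_right_injective _ four_ne_zero_eis (?_ : (4 : Eis) • ((s ᵥ* J) ᵥ* Y) = (4 : Eis) • z)
  rw [← smul_vecMul, ← smul_vecMul, ← h7, vecMul_vecMul, vecMul_vecMul, ← Matrix.mul_assoc, h6, vecMul_smul,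
    vecMul_one]

lemma Frames.unit_mul (hY : Y ∈ Frames A B) {U : (Matrix (Fin n) (Fin n) Eis)ˣ}
    (hU : U ∈ Isom B C) : (U : Matrix (Fin n) (Fin n) Eis) * Y ∈ Frames A C := by
  obtain ⟨h1, ⟨c, r, Z, h2⟩, h3⟩ := hY
  have hU : (U : Matrix (Fin n) (Fin n) Eis) * B * (U : Matrix (Fin n) (Fin n) Eis)ᴴ = C := hU
  refine ⟨?_, ⟨U *ᵥ c, r, U * Z, ?_⟩, ?_⟩
  · calc _ = (U : Matrix (Fin n) (Fin n) Eis) * (Y * A * Yᴴ) *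
          (U : Matrix (Fin n) (Fin n) Eis)ᴴ := by
          simp only [conjTranspose_mul, Matrix.mul_assoc]
      _ = _ := by rw [h1, Matrix.mul_smul, Matrix.smul_mul, hU]
  · rw [h2, Matrix.mul_add, Matrix.mul_smul, mul_vecMulVec]
  · rintro ⟨Z, hZ⟩
    refine h3 ⟨((U⁻¹ : (Matrix (Fin n) (Fin n) Eis)ˣ) : Matrix (Fin n) (Fin n) Eis) * Z, ?_⟩
    rw [← Matrix.mul_smul, ← hZ, ← Matrix.mul_assoc, U.inv_mul, Matrix.one_mul]

lemma rowspan_le (S : Matrix (Fin n) (Fin n) Eis) : rowspan (S * Y) ≤ rowspan Y := by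
  rintro _ ⟨t, rfl⟩
  exact ⟨t ᵥ* S, by simp [vecMul_vecMul]⟩

lemma rowspan_unit_mul (U : (Matrix (Fin n) (Fin n) Eis)ˣ) :
    rowspan ((U : Matrix (Fin n) (Fin n) Eis) * Y) = rowspan Y := by
  refine le_antisymm (rowspan_le _) ?_
  have := rowspan_le (Y := (U : Matrix (Fin n) (Fin n) Eis) * Y)
    ((U⁻¹ : (Matrix (Fin n) (Fin n) Eis)ˣ) : Matrix (Fin n) (Fin n) Eis)
  rwa [← Matrix.mul_assoc, U.inv_mul, Matrix.one_mul] at this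

lemma exists_mul_of_rowspan_le {W : Matrix (Fin n) (Fin n) Eis} (h : ∀ i, W i ∈ rowspan Y) :
    ∃ S : Matrix (Fin n) (Fin n) Eis, W = S * Y := by
  choose S hS using h
  refine ⟨of S, Matrix.ext fun i j => ?_⟩
  rw [← hS i]; rfl

lemma row_mem_rowspan (i : Fin n) : Y i ∈ rowspan Y := mem_rowspan.2 ⟨Pi.single i 1, single_one_vecMul _ _⟩

lemma Frames.exists_unit (hB : IsUL B) (hC : IsUL C) (hY : Y ∈ Frames A B)
    (hY' : Y' ∈ Frames A C) (h : rowspan Y' = rowspan Y) :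
    ∃ U ∈ Isom B C, Y' = (U : Matrix (Fin n) (Fin n) Eis) * Y := by
  obtain ⟨S, hS⟩ := exists_mul_of_rowspan_le (Y := Y) (W := Y') fun i => h ▸ row_mem_rowspan i
  obtain ⟨T, hT⟩ := exists_mul_of_rowspan_le (Y := Y') (W := Y) fun i => h ▸ row_mem_rowspan i
  have h1 : T * S = 1 := Frames.mul_right_cancel hB hY (by rw [Matrix.mul_assoc, ← hS, ← hT, Matrix.one_mul])
  have h2 : S * T = 1 := Frames.mul_right_cancel hC hY' (by rw [Matrix.mul_assoc, ← hT, ← hS, Matrix.one_mul])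
  refine ⟨⟨S, T, h2, h1⟩, ?_, hS⟩
  refine smul_right_injective _ four_ne_zero_eis (?_ : (4 : Eis) • (S * B * Sᴴ) = (4 : Eis) • C)
  rw [← hY'.1, hS, conjTranspose_mul]
  calc _ = S * ((4 : Eis) • B) * Sᴴ := by rw [Matrix.mul_smul, Matrix.smul_mul]
    _ = _ := by rw [← hY.1]; simp only [Matrix.mul_assoc]

lemma Frames.fiber_ncard (hB : IsUL B) (hY : Y ∈ Frames A B) :
    {X | X ∈ Frames A B ∧ rowspan X = rowspan Y}.ncard = autN B := by
  unfold autN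
  symm
  refine Set.ncard_congr (fun U _ => (U : Matrix (Fin n) (Fin n) Eis) * Y) ?_ ?_ ?_
  · exact fun U hU => ⟨Frames.unit_mul hY hU, rowspan_unit_mul U⟩
  · exact fun U V _ _ h => Units.ext (Frames.mul_right_cancel hB hY h)
  · rintro X ⟨hX, h⟩
    obtain ⟨U, hU, rfl⟩ := Frames.exists_unit hB hB hY hX h
    exact ⟨U, hU, rfl⟩

lemma Frames.vec_ncard (hB : IsUL B) (hY : Y ∈ Frames A B) (m : ℤ) :
    {x | x ∈ rowspan Y ∧ hnorm A x = 4 * m}.ncard = repN B m := by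
  have h1 : ∀ t, hnorm A (t ᵥ* Y) = 4 * hnorm B t := fun t => by
    rw [← hnorm_congr, hY.1, hnorm, hf_smul_matrix, hnorm]
    have : (4 : Eis) = ((4 : ℤ) : Eis) := by norm_num
    rw [this, Eis.mul_re, QuadraticAlgebra.re_intCast, QuadraticAlgebra.im_intCast]
    simp
  unfold repN
  symm
  refine Set.ncard_congr (fun t _ => t ᵥ* Y) ?_ ?_ ?_
  · intro t ht
    have ht : hnorm B t = m := ht
    exact ⟨⟨t, rfl⟩, by rw [h1, ht]⟩
  · exact fun s t _ _ h => Frames.vecMul_injective hB hY h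
  · rintro _ ⟨⟨t, rfl⟩, h⟩
    refine ⟨t, ?_, rfl⟩
    have := (h1 t).symm.trans h
    show hnorm B t = m
    omega

end

section
variable {n : ℕ} {A B C Y Y' : Matrix (Fin n) (Fin n) Eis}

lemma exists_rowspan_eq {N : Submodule Eis (Fin n → Eis)}
    (hN : ∀ x, (4 : Eis) • x ∈ N) : ∃ Y : Matrix (Fin n) (Fin n) Eis, rowspan Y = N := by
  have h1 : Module.finrank Eis N = n := by
    refine le_antisymm ((Submodule.finrank_le N).trans (by simp)) ?_
    let f : (Fin n → Eis) →ₗ[Eis] N :=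
      LinearMap.codRestrict N ((4 : Eis) • LinearMap.id) hN
    have hf : Function.Injective f := fun x y h => by
      have h := congrArg Subtype.val h
      exact smul_right_injective _ four_ne_zero_eis h
    have := LinearMap.finrank_le_finrank_of_injective hf
    simpa using this
  let b := Module.finBasisOfFinrankEq Eis N h1
  have h2 : ∀ t : Fin n → Eis, t ᵥ* (of fun i => (b i : Fin n → Eis)) =
      ((∑ i, t i • b i : N) : Fin n → Eis) := fun t => by
    funext j
    simp [vecMul, dotProduct, Finset.sum_apply]
  refine ⟨of fun i => (b i : Fin n → Eis), le_antisymm ?_ fun z hz => ?_⟩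
  · rintro _ ⟨t, rfl⟩
    rw [vecMulLinear_apply, h2]
    exact Subtype.coe_prop _
  · refine ⟨b.repr ⟨z, hz⟩, ?_⟩
    rw [vecMulLinear_apply, h2, b.sum_repr]

lemma toC_four : toC 4 = 4 := by
  have : (4 : Eis) = ((4 : ℤ) : Eis) := by norm_num
  rw [this, map_intCast]; norm_num

lemma PD.of_four_smul {K : Matrix (Fin n) (Fin n) Eis} (h : PD ((4 : Eis) • K)) : PD K := by
  have h1 : K.map toC = (1 / 4 : ℝ) • (((4 : Eis) • K).map toC) := by
    refine Matrix.ext fun i j => ?_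
    simp [Matrix.map_apply, toC_four]
  unfold PD
  rw [h1]
  exact Matrix.PosDef.smul h (by norm_num)

lemma exists_frame (hA : IsUL A) {N : Submodule Eis (Fin n → Eis)} (hN : N ∈ nbrs A) :
    ∃ c : Cls n, ∃ Y ∈ Frames A c.rep, rowspan Y = N := by
  obtain ⟨v, hE, hv, rfl⟩ := hN
  have h4 : ∀ x, (4 : Eis) • x ∈ nbr A v := fun x => by
    rw [four_eq, ← smul_smul, two_smul_mem_nbr hv, hf_smul_left]
    exact dvd_mul_right _ _
  obtain ⟨Y, hY⟩ := exists_rowspan_eq h4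
  have hrow : ∀ i, Y i ∈ nbr A v := fun i => hY ▸ row_mem_rowspan i
  obtain ⟨V, hV⟩ := exists_mul_of_rowspan_le (Y := Y)
    (W := (4 : Eis) • (1 : Matrix (Fin n) (Fin n) Eis)) fun i => by
      rw [hY]; exact h4 _
  have hV' : Y * V = (4 : Eis) • (1 : Matrix (Fin n) (Fin n) Eis) :=
    mul_eq_smul_one_comm four_ne_zero_eis hV.symm
  choose K hK using fun i j => nbr_isotropic hA.pd.isHermitian hv (hrow i) (hrow j)
  have hYK : Y * A * Yᴴ = (4 : Eis) • of K := Matrix.ext fun i j => by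
    rw [congr_apply, hK]; rfl
  have hKpd : PD (of K) := by
    refine PD.of_four_smul ?_
    rw [← hYK]
    unfold PD
    rw [map_mul_toC, map_mul_toC, map_conjTranspose]
    refine Matrix.PosDef.mul_mul_conjTranspose_same hA.pd ?_
    have h5 : Y.map toC * V.map toC = (4 : ℂ) • (1 : Matrix (Fin n) (Fin n) ℂ) := by
      rw [← map_mul_toC, hV']
      refine Matrix.ext fun i j => ?_
      rcases eq_or_ne i j with rfl | hij <;> simp [toC_four, one_apply, *, -hV, -hV']
    intro s t h
    have := congrArg (· ᵥ* V.map toC) h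
    simp only [vecMul_vecMul, h5, vecMul_smul, vecMul_one] at this
    exact smul_right_injective _ (by norm_num : (4 : ℂ) ≠ 0) this
  obtain ⟨J, hJ, -⟩ := hA.exists_inv
  obtain ⟨S, hS⟩ := exists_mul_of_rowspan_le (Y := Y) (W := Vᴴ * Jᴴ) fun j => by
    rw [hY]
    refine nbr_dual hA hv hE fun x hx => ?_
    rw [← hY] at hx
    obtain ⟨t, rfl⟩ := hx
    have h6 : ∀ x, hf A (x ᵥ* Y) ((Vᴴ * Jᴴ) j) = 4 * x j := fun x => by
      have h7 : (Vᴴ * Jᴴ) j = Pi.single j 1 ᵥ* (Vᴴ * Jᴴ) := (single_one_vecMul _ _).symm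
      rw [h7, hf, star_vecMul, conjTranspose_mul, conjTranspose_conjTranspose,
        conjTranspose_conjTranspose, ← dotProduct_mulVec, mulVec_mulVec, mulVec_mulVec,
        Matrix.mul_assoc Y, ← Matrix.mul_assoc A, hJ, Matrix.one_mul, hV', dotProduct_mulVec]
      simp [vecMul_smul]
    exact ⟨_, h6 t⟩
  have hKS : of K * Sᴴ = 1 := by
    refine smul_right_injective _ four_ne_zero_eis
      (?_ : (4 : Eis) • (of K * Sᴴ) = (4 : Eis) • (1 : Matrix (Fin n) (Fin n) Eis))
    rw [← Matrix.smul_mul, ← hYK, Matrix.mul_assoc, ← conjTranspose_mul, ← hS, conjTranspose_mul,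
      conjTranspose_conjTranspose, conjTranspose_conjTranspose, Matrix.mul_assoc,
      ← Matrix.mul_assoc A, hJ, Matrix.one_mul, hV']
  have hKul : IsUL (of K) := by
    refine ⟨hKpd, ?_⟩
    have hu : IsUnit (of K).det :=
      IsUnit.of_mul_eq_one (Sᴴ).det (by rw [← det_mul, hKS, det_one])
    obtain ⟨h8, h9⟩ := hKpd.det_re
    have h10 := nrm_eq_one_of_isUnit hu
    rw [h8] at h10 ⊢
    have : (of K).det.re = 1 := by
      simp only [nrm, QuadraticAlgebra.re_intCast, QuadraticAlgebra.im_intCast] at h10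
      norm_num at h10
      rcases h10 with h10 | h10 <;> omega
    rw [this]; simp
  obtain ⟨c, U, hU⟩ := Cls.exists_equi hKul
  have hYf : Y ∈ Frames A (of K) := by
    refine ⟨hYK, ?_, ?_⟩
    · choose a u hau using fun i => (hrow i).1
      exact ⟨a, v, of u, Matrix.ext fun i j => by rw [hau i]; rfl⟩
    · rintro ⟨Z, hZ⟩
      have hvY := self_mem_nbr hv
      rw [← hY] at hvY
      obtain ⟨t, ht⟩ := hvY
      exact hE ⟨t ᵥ* Z, by rw [← ht, vecMulLinear_apply, hZ, vecMul_smul]⟩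
  exact ⟨c, _, Frames.unit_mul hYf hU.symm, by rw [rowspan_unit_mul, hY]⟩

lemma finite_nbrs (hA : IsUL A) : (nbrs A).Finite := by
  refine (Set.finite_iUnion fun c : Cls n => (Frames.finite hA.pd c.rep).image rowspan).subset ?_
  intro N hN
  obtain ⟨c, Y, hY, rfl⟩ := exists_frame hA hN
  exact Set.mem_iUnion.2 ⟨c, Y, hY, rfl⟩

lemma Cls.eq_of_isom {b c : Cls n} {U : (Matrix (Fin n) (Fin n) Eis)ˣ} (h : U ∈ Isom b.rep c.rep) :
    b = c := Cls.eq_of_equi ⟨U, h.symm⟩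

lemma sum_frames (hA : IsUL A) (f : Cls n → ℚ) (F : Submodule Eis (Fin n → Eis) → ℚ)
    (hF : ∀ b : Cls n, ∀ Y ∈ Frames A b.rep, f b = F (rowspan Y)) :
    ∑ b : Cls n, b.w * f b * (Frames A b.rep).ncard = ∑ N ∈ (finite_nbrs hA).toFinset, F N := by
  refine sum_torsor (fun b : Cls n => autN b.rep) (fun b => (autN_pos b.isUL.pd).ne') f
    (fun b => Frames A b.rep) (fun b => Frames.finite hA.pd _) rowspan _ ?_ F ?_
  · intro b Y hY
    rw [Set.Finite.mem_toFinset]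
    exact Frames.rowspan_mem_nbrs hA b.isUL hY
  · intro N hN
    rw [Set.Finite.mem_toFinset] at hN
    obtain ⟨b, Y, hY, rfl⟩ := exists_frame hA hN
    refine ⟨b, hF b Y hY, fun c X hX h => ?_, Frames.fiber_ncard b.isUL hY⟩
    obtain ⟨U, hU, -⟩ := Frames.exists_unit c.isUL b.isUL hX hY h.symm
    exact Cls.eq_of_isom hU

lemma Frames.ncard_le (hA : IsUL A) (hB : IsUL B) :
    (Frames A B).ncard ≤ (Frames B A).ncard := by
  obtain ⟨J, hJ, hJ'⟩ := hB.exists_inv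
  obtain ⟨I, hI, hI'⟩ := hA.exists_inv
  have hAH := hA.pd.isHermitian.eq
  have hJH : B * Jᴴ = 1 := by
    have := congrArg conjTranspose hJ'
    rwa [conjTranspose_mul, hB.pd.isHermitian.eq, conjTranspose_one] at this
  have hcancel : ∀ X X' : Matrix (Fin n) (Fin n) Eis, A * Xᴴ * J = X' → X = (I * X' * B)ᴴ := by
    rintro X _ rfl
    calc X = (I * A * Xᴴ * (J * B))ᴴ := by rw [hI', hJ']; simp
      _ = _ := by simp only [Matrix.mul_assoc]
  refine Set.ncard_le_ncard_of_injOn (fun Y => A * Yᴴ * J) ?_ ?_ (Frames.finite hB.pd A)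
  · rintro Y hY
    obtain ⟨V, hV1, hV2⟩ := Frames.exists_right hB hY
    obtain ⟨h1, ⟨c, r, Z, h2⟩, h3⟩ := hY
    have h6 : A * Yᴴ * J * Y = (4 : Eis) • (1 : Matrix (Fin n) (Fin n) Eis) := by
      refine mul_eq_smul_one_comm four_ne_zero_eis ?_
      rw [← Matrix.mul_assoc, ← Matrix.mul_assoc, h1, Matrix.smul_mul, hJ]
    refine ⟨?_, ⟨A *ᵥ star r, star c ᵥ* J, A * Zᴴ * J, ?_⟩, ?_⟩
    · calc A * Yᴴ * J * B * (A * Yᴴ * J)ᴴ = A * Yᴴ * J * (B * Jᴴ) * Y * A := by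
            simp only [conjTranspose_mul, conjTranspose_conjTranspose, hAH, Matrix.mul_assoc]
        _ = _ := by rw [hJH, Matrix.mul_one, h6, Matrix.smul_mul, Matrix.one_mul]
    · show A * Yᴴ * J = _
      rw [h2, conjTranspose_add, conjTranspose_smul, star_two_eis, conjTranspose_vecMulVec,
        Matrix.mul_add, Matrix.add_mul, mul_vecMulVec, vecMulVec_mul, Matrix.mul_smul,
        Matrix.smul_mul]
    · rintro ⟨Z, hZ⟩
      refine h3 ⟨(I * Z * B)ᴴ, ?_⟩
      rw [hcancel Y _ hZ, Matrix.mul_smul, Matrix.smul_mul, conjTranspose_smul, star_two_eis]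
  · intro X _ Y _ h
    rw [hcancel X _ h, ← hcancel Y _ rfl]

lemma Frames.ncard_comm (hA : IsUL A) (hB : IsUL B) :
    (Frames A B).ncard = (Frames B A).ncard :=
  le_antisymm (Frames.ncard_le hA hB) (Frames.ncard_le hB hA)

lemma sum_nbrs_comm (m : ℤ) :
    ∑ a : Cls n, a.w * ∑ N ∈ (finite_nbrs a.isUL).toFinset,
        ({x | x ∈ N ∧ hnorm a.rep x = 4 * m}.ncard : ℚ) =
      ∑ b : Cls n, b.w * (repN b.rep m * (nbrs b.rep).ncard) := by
  have h1 : ∀ a : Cls n, ∑ N ∈ (finite_nbrs a.isUL).toFinset,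
      ({x | x ∈ N ∧ hnorm a.rep x = 4 * m}.ncard : ℚ) =
      ∑ b : Cls n, b.w * repN b.rep m * (Frames a.rep b.rep).ncard := fun a =>
    (sum_frames a.isUL (fun b => (repN b.rep m : ℚ)) _ fun b Y hY => by
      rw [Frames.vec_ncard b.isUL hY]).symm
  have h2 : ∀ b : Cls n, ((nbrs b.rep).ncard : ℚ) =
      ∑ a : Cls n, a.w * (Frames b.rep a.rep).ncard := fun b => by
    have := sum_frames b.isUL (fun _ => 1) (fun _ => 1) fun _ _ _ => rfl
    simp only [mul_one, Finset.sum_const, nsmul_eq_mul] at this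
    rw [this, Set.ncard_eq_toFinset_card _ (finite_nbrs b.isUL)]
  simp_rw [h1, h2, Finset.mul_sum]
  rw [Finset.sum_comm]
  refine Finset.sum_congr rfl fun b _ => Finset.sum_congr rfl fun a _ => ?_
  rw [Frames.ncard_comm a.isUL b.isUL]
  ring

/-- Vectors of norm `4 m` counted over the neighbours containing them. -/
lemma sum_nbrs (hA : IsUL A) (m : ℤ) (ν : ℕ)
    (hν : ∀ y, hnorm A y = m → {N | N ∈ nbrs A ∧ (2 : Eis) • y ∉ N}.ncard = ν) :
    ∑ N ∈ (finite_nbrs hA).toFinset, ({x | x ∈ N ∧ hnorm A x = 4 * m}.ncard : ℚ) + repN A m =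
      repN A (4 * m) + repN A m * ((nbrs A).ncard - ν) := by
  classical
  set X := (finite_hnorm_eq hA.pd (4 * m)).toFinset with hX
  set Ym := (finite_hnorm_eq hA.pd m).toFinset with hYm
  set T := (finite_nbrs hA).toFinset with hT
  have hnT : ((nbrs A).ncard) = T.card := Set.ncard_eq_toFinset_card _ _
  have h1 : ∀ N ∈ T, {x | x ∈ N ∧ hnorm A x = 4 * m}.ncard = (X.filter (· ∈ N)).card :=
    fun N _ => by
      rw [← Set.ncard_coe_finset]
      congr 1
      ext x
      simp [hX, and_comm]
  have h2 : ∑ N ∈ T, (X.filter (· ∈ N)).card = ∑ x ∈ X, (T.filter (x ∈ ·)).card :=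
    Finset.sum_card_bipartiteAbove_eq_sum_card_bipartiteBelow (fun N x => x ∈ N)
  have hsmul : ∀ y, hnorm A ((2 : Eis) • y) = 4 * hnorm A y := fun y => by
    rw [hnorm_smul hA.pd.isHermitian]
    rfl
  have h3 : X.filter Ev = Ym.image ((2 : Eis) • ·) := by
    ext x
    simp only [hX, hYm, Finset.mem_filter, Set.Finite.mem_toFinset, Set.mem_ofPred_eq,
      Finset.mem_image]
    constructor
    · rintro ⟨h, u, rfl⟩
      rw [hsmul] at h
      exact ⟨u, by omega, rfl⟩
    · rintro ⟨y, h, rfl⟩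
      exact ⟨by rw [hsmul, h], y, rfl⟩
  have h4 : ∑ x ∈ X with Ev x, ((T.filter (x ∈ ·)).card : ℚ) = Ym.card * (T.card - ν) := by
    rw [h3, Finset.sum_image fun a _ b _ h => smul_right_injective _ two_ne_zero_eis h,
      ← nsmul_eq_mul, ← Finset.sum_const]
    refine Finset.sum_congr rfl fun y hy => ?_
    have hy : hnorm A y = m := by simpa [hYm] using hy
    have h5 : (T.filter ((2 : Eis) • y ∉ ·)).card = ν := by
      rw [← hν y hy, ← Set.ncard_coe_finset]
      congr 1
      ext N
      simp [hT]
    have := Finset.card_filter_add_card_filter_not (s := T) (fun N => (2 : Eis) • y ∈ N)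
    rw [h5] at this
    rw [← this]; push_cast; ring
  have h5 : ∑ x ∈ X with ¬ Ev x, ((T.filter (x ∈ ·)).card : ℚ) = (X.filter (¬ Ev ·)).card := by
    rw [Finset.card_eq_sum_ones, Nat.cast_sum]
    refine Finset.sum_congr rfl fun x hx => ?_
    rw [Finset.mem_filter] at hx
    have hx4 : hnorm A x = 4 * m := by simpa [hX] using hx.1
    have := unique_nbr hA.pd.isHermitian hx.2 (by
      rw [hf_self hA.pd.isHermitian, hx4]; exact ⟨m, by push_cast; ring⟩)
    have h6 : (T.filter (x ∈ ·)).card = 1 := by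
      rw [← Set.ncard_singleton (nbr A x), ← this, ← Set.ncard_coe_finset]
      congr 1
      ext N
      simp [hT]
    rw [h6]
  have h7 := Finset.card_filter_add_card_filter_not (s := X) Ev
  rw [h3, Finset.card_image_of_injective _ (smul_right_injective _ two_ne_zero_eis)] at h7
  have hr1 : repN A m = Ym.card := Set.ncard_eq_toFinset_card _ _
  have hr4 : repN A (4 * m) = X.card := Set.ncard_eq_toFinset_card _ _
  rw [Finset.sum_congr rfl fun N hN => by rw [h1 N hN], ← Nat.cast_sum, h2, Nat.cast_sum,
    ← Finset.sum_filter_add_sum_filter_not X Ev, h4, h5, hr1, hr4, hnT, ← h7]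
  push_cast; ring

theorem wrep_four_mul (m : ℤ) (ν : ℕ)
    (hν : ∀ A : Matrix (Fin n) (Fin n) Eis, IsUL A → ∀ y, hnorm A y = m →
      {N | N ∈ nbrs A ∧ (2 : Eis) • y ∉ N}.ncard = ν) :
    wrep n (4 * m) = (1 + ν) * wrep n m := by
  have h1 := sum_nbrs_comm (n := n) m
  have h2 : ∀ a : Cls n, ∑ N ∈ (finite_nbrs a.isUL).toFinset,
      ({x | x ∈ N ∧ hnorm a.rep x = 4 * m}.ncard : ℚ) = _ := fun a =>
    eq_sub_of_add_eq (sum_nbrs a.isUL m ν (hν _ a.isUL))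
  simp_rw [h2] at h1
  unfold wrep
  rw [Finset.mul_sum, ← sub_eq_zero, ← Finset.sum_sub_distrib]
  rw [← sub_eq_zero, ← Finset.sum_sub_distrib] at h1
  rw [← h1]
  exact Finset.sum_congr rfl fun a _ => by ring

end

section

/-- The residue field `𝔽₄` of the Eisenstein integers at two. -/
abbrev F4 : Type := QuadraticAlgebra (ZMod 2) (-1) (-1)

namespace F4

instance : Fintype F4 := Fintype.ofEquiv _ (QuadraticAlgebra.equivProd (-1 : ZMod 2) (-1)).symm

lemma card : Fintype.card F4 = 4 := by
  rw [Fintype.ofEquiv_card]; rfl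

/-- The nontrivial character of `𝔽₂`, evaluated at the first coordinate. -/
def χ (z : F4) : ℤ := if z.re = 0 then 1 else -1

lemma χ_add (z w : F4) : χ (z + w) = χ z * χ w := by
  unfold χ
  rw [QuadraticAlgebra.re_add]
  generalize z.re = a
  generalize w.re = b
  revert a b
  decide

lemma χ_sq (z : F4) : χ z * χ z = 1 := by
  unfold χ; split_ifs <;> norm_num

lemma χ_zero : χ 0 = 1 := rfl

lemma eq_zero_of_star_eq {z : F4} (h : star z = z) : z = 0 ↔ z.re = 0 := by
  have h1 := congrArg QuadraticAlgebra.re h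
  rw [QuadraticAlgebra.re_star] at h1
  have h2 : z.im = 0 := by linear_combination -h1
  constructor
  · rintro rfl; rfl
  · intro h3; ext <;> simp [h2, h3]

lemma exists_trace : ∀ a : F4, a ≠ 0 → ∃ c : F4, χ (star c * a + star (star c * a)) = -1 := by
  decide

/-- The generator of `𝔽₄ˣ`. -/
def w : F4 := ⟨0, 1⟩

lemma w_cube : w ^ 3 = 1 := by decide

lemma w_smul_eq : ∀ a : F4, w * a = a → a = 0 := by decide

lemma w_trace : χ (w + star w) = -1 := by decide

lemma χ_mul_star : ∀ c : F4, χ (c * star c) = if c = 0 then 1 else -1 := by decide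

lemma sum_eq (f : F4 → ℤ) : ∑ c, f c = f 0 + f 1 + f w + f (1 + w) := by
  have : (Finset.univ : Finset F4) = {0, 1, w, 1 + w} := by decide
  rw [this, Finset.sum_insert (by decide), Finset.sum_insert (by decide),
    Finset.sum_insert (by decide), Finset.sum_singleton]
  ring

end F4

open F4

section finite
variable {n : ℕ} {B : Matrix (Fin n) (Fin n) F4}

lemma hf_self_add (hB : B.IsHermitian) (x y : Fin n → F4) :
    hf B (x + y) (x + y) = hf B x x + hf B y y + (hf B y x + star (hf B y x)) := by
  rw [hf_star hB]; simp only [hf_add_left, hf_add_right]; ring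

lemma χ_hf (hB : B.IsHermitian) (x : Fin n → F4) :
    χ (hf B x x) = if hf B x x = 0 then 1 else -1 := by
  unfold χ
  simp only [eq_zero_of_star_eq (hf_star hB x x)]

/-- The Gauss sum of a hermitian form over `𝔽₄`. -/
def gauss (B : Matrix (Fin n) (Fin n) F4) : ℤ := ∑ w, χ (hf B w w)

lemma gauss_sq (hB : B.IsHermitian) (hd : ∀ t, (∀ w, hf B t w = 0) → t = 0) :
    gauss B ^ 2 = 4 ^ n := by
  have h1 : ∀ t ≠ 0, ∑ w, χ (hf B t w + star (hf B t w)) = 0 := fun t ht => by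
    have : ∃ w, hf B t w ≠ 0 := by
      by_contra! h
      exact ht (hd t h)
    obtain ⟨w, hw⟩ := this
    obtain ⟨c, hc⟩ := exists_trace _ hw
    rw [← hf_smul_right] at hc
    have h2 := Equiv.sum_comp (Equiv.addRight (c • w)) fun w => χ (hf B t w + star (hf B t w))
    have h3 : ∀ x, χ (hf B t (x + c • w) + star (hf B t (x + c • w))) =
        -χ (hf B t x + star (hf B t x)) := fun x => by
      rw [hf_add_right, star_add, add_add_add_comm, χ_add, hc]; ring
    simp only [Equiv.coe_addRight, h3, Finset.sum_neg_distrib] at h2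
    omega
  calc gauss B ^ 2 = ∑ w, ∑ x, χ (hf B x x) * χ (hf B w w) := by
        rw [pow_two, gauss, Finset.sum_mul_sum, Finset.sum_comm]
    _ = ∑ w, ∑ t, χ (hf B t t) * χ (hf B t w + star (hf B t w)) := by
        refine Finset.sum_congr rfl fun w _ => ?_
        rw [← Equiv.sum_comp (Equiv.addRight w)]
        refine Finset.sum_congr rfl fun t _ => ?_
        change χ (hf B (t + w) (t + w)) * _ = _
        rw [add_comm t w, hf_self_add hB, χ_add, χ_add]
        linear_combination χ (hf B t t) * χ (hf B t w + star (hf B t w)) * χ_sq (hf B w w)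
    _ = ∑ t, χ (hf B t t) * ∑ w, χ (hf B t w + star (hf B t w)) := by
        rw [Finset.sum_comm]; simp only [Finset.mul_sum]
    _ = χ (hf B 0 0) * ∑ w, χ (hf B 0 w + star (hf B 0 w)) :=
        Finset.sum_eq_single 0 (fun t _ ht => by rw [h1 t ht, mul_zero]) (by simp)
    _ = 4 ^ n := by
        simp [hf, χ_zero, Finset.card_univ, F4.card]

lemma gauss_eq_card (hB : B.IsHermitian) :
    gauss B = 2 * (Fintype.card {w : Fin n → F4 // hf B w w = 0} : ℤ) - 4 ^ n := by
  have h : ∀ w : Fin n → F4, χ (hf B w w) = 2 * (if hf B w w = 0 then 1 else 0) - 1 := fun w => by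
    rw [χ_hf hB]; split_ifs <;> norm_num
  rw [gauss, Finset.sum_congr rfl fun w _ => h w, Finset.sum_sub_distrib, ← Finset.mul_sum,
    Finset.sum_boole, Fintype.card_subtype]
  simp [Finset.card_univ, F4.card]

lemma card_isotropic_mod (B : Matrix (Fin n) (Fin n) F4) :
    Fintype.card {w : Fin n → F4 // hf B w w = 0} ≡ 1 [MOD 3] := by
  let f : Function.End {w : Fin n → F4 // hf B w w = 0} := fun x =>
    ⟨w • x.1, by rw [hf_smul_left, hf_smul_right, x.2, mul_zero, mul_zero]⟩
  have hf3 : f ^ 3 ^ 1 = 1 := by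
    funext x
    apply Subtype.ext
    show w • w • w • x.1 = x.1
    rw [smul_smul, smul_smul, ← pow_two, ← pow_succ, w_cube, one_smul]
  have : Fact (Nat.Prime 3) := ⟨Nat.prime_three⟩
  refine (Equiv.Perm.card_fixedPoints_modEq hf3).trans ?_
  have : Unique (Function.fixedPoints f) := by
    refine ⟨⟨⟨⟨0, by simp [hf]⟩, ?_⟩⟩, ?_⟩
    · apply Subtype.ext
      show w • (0 : Fin n → F4) = 0
      simp
    · rintro ⟨⟨x, hx⟩, h⟩
      have h : w • x = x := congrArg Subtype.val h
      have : x = 0 := funext fun i => w_smul_eq _ (congrFun h i)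
      subst this
      rfl
  rw [Fintype.card_unique]

lemma gauss_eq (hB : B.IsHermitian) (hd : ∀ t, (∀ w, hf B t w = 0) → t = 0) :
    gauss B = (-2) ^ n := by
  have h1 : gauss B ^ 2 = ((-2) ^ n) ^ 2 := by
    rw [gauss_sq hB hd, ← pow_mul, mul_comm n, pow_mul]; norm_num
  have h2 : (4 : ℤ) ^ n ≡ 1 [ZMOD 3] := by
    simpa using (show (4 : ℤ) ≡ 1 [ZMOD 3] by decide).pow n
  have h3 : (-2 : ℤ) ^ n ≡ 1 [ZMOD 3] := by
    simpa using (show (-2 : ℤ) ≡ 1 [ZMOD 3] by decide).pow n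
  have h4 : (Fintype.card {w : Fin n → F4 // hf B w w = 0} : ℤ) ≡ 1 [ZMOD 3] := by
    have := (Int.natCast_modEq_iff).2 (card_isotropic_mod B)
    exact_mod_cast this
  rcases sq_eq_sq_iff_eq_or_eq_neg.1 h1 with h | h
  · exact h
  · exfalso
    rw [gauss_eq_card hB] at h
    unfold Int.ModEq at *
    omega

/-- Isotropic vectors with prescribed product one with `y`. -/
def isoSet (B : Matrix (Fin n) (Fin n) F4) (y : Fin n → F4) : Set (Fin n → F4) :=
  {w | hf B w y = 1 ∧ hf B w w = 0}

lemma card_fiber {y : Fin n → F4} {w₀ : Fin n → F4} (h₀ : hf B w₀ y = 1) (c : F4) :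
    (Finset.univ.filter fun w => hf B w y = c).card =
      (Finset.univ.filter fun w => hf B w y = 0).card := by
  refine Finset.card_bij' (fun w _ => w - c • w₀) (fun w _ => w + c • w₀) ?_ ?_ ?_ ?_
  · intro w hw
    simp only [Finset.mem_filter, Finset.mem_univ, true_and] at hw ⊢
    rw [sub_eq_add_neg, ← neg_smul, hf_add_left, hf_smul_left, hw, h₀]; ring
  · intro w hw
    simp only [Finset.mem_filter, Finset.mem_univ, true_and] at hw ⊢
    rw [hf_add_left, hf_smul_left, hw, h₀]; ring
  · intro w _; simp
  · intro w _; simp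

lemma sum_fiber (y : Fin n → F4) (f : (Fin n → F4) → ℤ) :
    ∑ w, f w = ∑ c, ∑ w with hf B w y = c, f w :=
  (Finset.sum_fiberwise Finset.univ (fun w => hf B w y) f).symm

lemma isoSet_ncard {B : Matrix (Fin (n + 1)) (Fin (n + 1)) F4} (hB : B.IsHermitian)
    {y w₀ : Fin (n + 1) → F4} (h₀ : hf B w₀ y = 1) :
    2 * ((isoSet B y).ncard : ℤ) = 4 ^ n + ∑ w with hf B w y = 1, χ (hf B w w) := by
  have h1 : 4 * ((Finset.univ.filter fun w => hf B w y = 1).card : ℤ) = 4 * 4 ^ n := by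
    have h2 := sum_fiber (B := B) y fun _ => 1
    simp only [Finset.sum_const, nsmul_eq_mul, mul_one, card_fiber h₀, Finset.card_univ,
      Fintype.card_pi, F4.card, Finset.prod_const, Fintype.card_fin] at h2
    rw [card_fiber h₀]
    push_cast at h2
    linarith [pow_succ (4 : ℤ) n]
  have h3 : ∀ w : Fin (n + 1) → F4, χ (hf B w w) = 2 * (if hf B w w = 0 then 1 else 0) - 1 :=
    fun w => by rw [χ_hf hB]; split_ifs <;> norm_num
  have h4 : (isoSet B y).ncard =
      (Finset.univ.filter fun w => hf B w y = 1 ∧ hf B w w = 0).card := by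
    rw [← Set.ncard_coe_finset]; congr 1; ext w; simp [isoSet]
  rw [Finset.sum_congr rfl fun w _ => h3 w, Finset.sum_sub_distrib, ← Finset.mul_sum,
    Finset.sum_boole, Finset.filter_filter, ← h4]
  simp only [Finset.sum_const, nsmul_eq_mul, mul_one]
  linarith

lemma isoSet_ncard_of_even {B : Matrix (Fin (n + 1)) (Fin (n + 1)) F4} (hB : B.IsHermitian)
    {y w₀ : Fin (n + 1) → F4} (h₀ : hf B w₀ y = 1) (hy : hf B y y = 0) :
    2 * ((isoSet B y).ncard : ℤ) = 4 ^ n := by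
  rw [isoSet_ncard hB h₀, add_eq_left]
  have h1 : ∑ w with hf B w y = 1, χ (hf B w w) = ∑ w with hf B w y = 1, -χ (hf B w w) := by
    refine Finset.sum_nbij' (fun x => x + w • y) (fun x => x - w • y) ?_ ?_ ?_ ?_ ?_
    · intro x hx
      simp only [Finset.mem_filter, Finset.mem_univ, true_and] at hx ⊢
      rw [hf_add_left, hf_smul_left, hx, hy, mul_zero, add_zero]
    · intro x hx
      simp only [Finset.mem_filter, Finset.mem_univ, true_and] at hx ⊢
      rw [sub_eq_add_neg, ← neg_smul, hf_add_left, hf_smul_left, hx, hy, mul_zero, add_zero]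
    · intro x _; simp
    · intro x _; simp
    · intro x hx
      simp only [Finset.mem_filter, Finset.mem_univ, true_and] at hx
      have hx' : hf B y x = 1 := by rw [← hf_star hB, hx, star_one]
      rw [hf_self_add hB, hf_smul_left, hf_smul_left, hf_smul_right, hy, hx', mul_zero, mul_zero,
        add_zero, mul_one, χ_add, w_trace]
      ring
  rw [Finset.sum_neg_distrib] at h1
  omega

lemma isoSet_ncard_of_odd {B : Matrix (Fin (n + 1)) (Fin (n + 1)) F4} (hB : B.IsHermitian)
    (hd : ∀ t, (∀ w, hf B t w = 0) → t = 0) {y : Fin (n + 1) → F4} (hy : hf B y y = 1) :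
    2 * ((isoSet B y).ncard : ℤ) = 4 ^ n - (-2) ^ n := by
  rw [isoSet_ncard hB hy]
  have h1 : ∀ c, ∑ w with hf B w y = c, χ (hf B w w) =
      (if c = 0 then 1 else -1) * ∑ w with hf B w y = 0, χ (hf B w w) := fun c => by
    rw [Finset.mul_sum]
    refine Finset.sum_nbij' (fun x => x - c • y) (fun x => x + c • y) ?_ ?_ ?_ ?_ ?_
    · intro x hx
      simp only [Finset.mem_filter, Finset.mem_univ, true_and] at hx ⊢
      rw [sub_eq_add_neg, ← neg_smul, hf_add_left, hf_smul_left, hx, hy]; ring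
    · intro x hx
      simp only [Finset.mem_filter, Finset.mem_univ, true_and] at hx ⊢
      rw [hf_add_left, hf_smul_left, hx, hy]; ring
    · intro x _; simp
    · intro x _; simp
    · intro x hx
      simp only [Finset.mem_filter, Finset.mem_univ, true_and] at hx
      obtain ⟨z, rfl⟩ : ∃ z, x = z + c • y := ⟨x - c • y, by simp⟩
      have hz : hf B z y = 0 := by
        rw [hf_add_left, hf_smul_left, hy] at hx; linear_combination hx
      have hz' : hf B y z = 0 := by rw [← hf_star hB, hz, star_zero]
      rw [add_sub_cancel_right, hf_self_add hB, hf_smul_left, hf_smul_left, hf_smul_right, hy, hz',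
        mul_zero, star_zero, add_zero, add_zero, mul_one, χ_add, χ_mul_star]
      ring
  have h2 := sum_fiber (B := B) y fun w => χ (hf B w w)
  rw [← gauss, gauss_eq hB hd, F4.sum_eq, h1 1, h1 w, h1 (1 + w),
    if_neg (by decide), if_neg (by decide), if_neg (by decide), pow_succ] at h2
  rw [h1 1, if_neg (by decide)]
  linarith

end finite

end

section

/-- Reduction modulo two. -/
def red : Eis →+* F4 where
  toFun z := ⟨z.re, z.im⟩
  map_one' := by ext <;> simp [QuadraticAlgebra.re_one, QuadraticAlgebra.im_one]
  map_mul' z w := by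
    ext
    · rw [QuadraticAlgebra.re_mul]; simp
    · rw [QuadraticAlgebra.im_mul]; simp
  map_zero' := by ext <;> simp
  map_add' z w := by ext <;> simp

lemma red_star (z : Eis) : red (star z) = star (red z) := by
  ext
  · rw [QuadraticAlgebra.re_star]; simp [red]
  · rw [QuadraticAlgebra.im_star]; simp [red]

lemma red_eq_zero {z : Eis} : red z = 0 ↔ 2 ∣ z := by
  have h (k : ℤ) : 2 ∣ k ↔ (k : ZMod 2) = 0 := (ZMod.intCast_zmod_eq_zero_iff_dvd k 2).symm
  rw [Eis.two_dvd_iff, h, h]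
  constructor
  · intro h
    exact ⟨congrArg QuadraticAlgebra.re h, congrArg QuadraticAlgebra.im h⟩
  · rintro ⟨h1, h2⟩
    exact QuadraticAlgebra.ext h1 h2

lemma red_eq_one {z : Eis} : red z = 1 ↔ ∃ k, z = 1 + 2 * k := by
  rw [← sub_eq_zero, ← map_one red, ← map_sub, red_eq_zero]
  constructor
  · rintro ⟨k, hk⟩; exact ⟨k, by linear_combination hk⟩
  · rintro ⟨k, rfl⟩; exact ⟨k, by ring⟩

lemma red_surjective : Function.Surjective red := fun z => by
  obtain ⟨a, ha⟩ := ZMod.intCast_surjective z.re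
  obtain ⟨b, hb⟩ := ZMod.intCast_surjective z.im
  exact ⟨⟨a, b⟩, QuadraticAlgebra.ext ha hb⟩

lemma red_two : red 2 = 0 := red_eq_zero.2 dvd_rfl

variable {n : ℕ} {A : Matrix (Fin n) (Fin n) Eis}

lemma red_hf (A : Matrix (Fin n) (Fin n) Eis) (x y : Fin n → Eis) :
    red (hf A x y) = hf (A.map red) (red ∘ x) (red ∘ y) := by
  simp [hf, dotProduct, mulVec, red_star]

lemma red_smul (a : Eis) (x : Fin n → Eis) : red ∘ (a • x) = red a • (red ∘ x) :=
  funext fun i => by simp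

lemma red_add (x y : Fin n → Eis) : red ∘ (x + y) = red ∘ x + red ∘ y :=
  funext fun i => by simp

lemma red_two_smul (x : Fin n → Eis) : red ∘ ((2 : Eis) • x) = 0 := by
  rw [red_smul, red_two, zero_smul]

lemma red_comp_eq_zero {x : Fin n → Eis} (h : red ∘ x = 0) : Ev x := by
  choose u hu using fun i => red_eq_zero.1 (congrFun h i)
  exact ⟨u, funext hu⟩

lemma exists_red (w : Fin n → F4) : ∃ x : Fin n → Eis, red ∘ x = w := by
  choose x hx using fun i => red_surjective (w i)
  exact ⟨x, funext hx⟩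

lemma red_isHermitian (hA : A.IsHermitian) : (A.map red).IsHermitian := by
  refine Matrix.ext fun i j => ?_
  rw [conjTranspose_apply, map_apply, map_apply, ← red_star]
  exact congrArg red (congrFun (congrFun hA.eq i) j)

lemma hf_self_add_two (hA : A.IsHermitian) (x u : Fin n → Eis) :
    hf A (x + (2 : Eis) • u) (x + (2 : Eis) • u) =
      hf A x x + 2 * (hf A u x + star (hf A u x)) + 4 * hf A u u := by
  rw [hf_star hA]
  simp only [hf_add_left, hf_add_right, hf_smul_left, hf_smul_right, star_two_eis]
  ring

lemma star_add_two_mul (a k : Eis) : star (a + 2 * k) = star a + 2 * star k := by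
  rw [star_add, star_mul, star_two_eis, mul_comm]

lemma exists_lift (hA : IsUL A) {y : Fin n → Eis} {w : Fin n → F4}
    (hw : w ∈ isoSet (A.map red) (red ∘ y)) : ∃ v, red ∘ v = w ∧ 4 ∣ hf A v v := by
  have hH := hA.pd.isHermitian
  obtain ⟨x, rfl⟩ := exists_red w
  obtain ⟨h1, h2⟩ := hw
  rw [← red_hf, red_eq_one] at h1
  rw [← red_hf, hf_self hH, red_eq_zero] at h2
  obtain ⟨k, hk⟩ := h1
  have hk' : hf A y x = 1 + 2 * star k := by
    rw [← hf_star hH, hk, star_add_two_mul, star_one]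
  have h3 : (2 : ℤ) ∣ hnorm A x := by simpa using (Eis.two_dvd_iff.1 h2).1
  have h4 : hnorm A x % 4 = 0 ∨ hnorm A x % 4 = 2 := by omega
  rcases h4 with h4 | h4
  · refine ⟨x, rfl, ?_⟩
    rw [hf_self hH]
    exact_mod_cast map_dvd (Int.castRingHom Eis) (Int.dvd_of_emod_eq_zero h4)
  · let w : Eis := ⟨0, 1⟩
    have hw : w + star w = -1 := by decide
    refine ⟨x + (2 : Eis) • w • y, by rw [red_add, red_two_smul, add_zero], ?_⟩
    obtain ⟨j, hj⟩ : ∃ j, hnorm A x = 2 + 4 * j := ⟨hnorm A x / 4, by omega⟩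
    rw [hf_self_add_two hH, hf_smul_left, hk', hf_self hH, hj, mul_add w, mul_one, mul_left_comm,
      star_add_two_mul]
    have h5 : ∀ z : Eis, ∃ t : Eis, z + star z = t := fun z => ⟨_, rfl⟩
    refine ⟨j + (w * star k + star (w * star k)) + hf A (w • y) (w • y), ?_⟩
    push_cast
    linear_combination 2 * hw

/-- The two neighbours attached to a residue vector. -/
lemma twist_props (hA : IsUL A) {y v : Fin n → Eis} (h1 : red (hf A v y) = 1)
    (h4 : 4 ∣ hf A v v) (ε : Bool) :
    let x := v + (2 : Eis) • ((if ε then 1 else 0 : Eis) • y)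
    4 ∣ hf A x x ∧ red (hf A x y) = 1 ∧ ¬ Ev x ∧ (2 : Eis) • y ∉ nbr A x := by
  intro x
  have hH := hA.pd.isHermitian
  obtain ⟨k, hk⟩ := red_eq_one.1 h1
  have hk' : hf A y v = 1 + 2 * star k := by
    rw [← hf_star hH, hk, star_add_two_mul, star_one]
  have hx4 : 4 ∣ hf A x x := by
    rw [hf_self_add_two hH, hf_smul_left, hk']
    obtain ⟨j, hj⟩ := h4
    rw [hj]
    cases ε
    · exact ⟨j + hf A ((if false = true then 1 else 0 : Eis) • y)
        ((if false = true then 1 else 0 : Eis) • y), by simp; ring⟩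
    · refine ⟨j + (1 + star k + k) + hf A ((if true = true then 1 else 0 : Eis) • y)
        ((if true = true then 1 else 0 : Eis) • y), ?_⟩
      rw [if_pos rfl, one_mul, star_add_two_mul, star_star, star_one]
      ring
  have hxy : red (hf A x y) = 1 := by
    rw [hf_add_left, hf_smul_left, map_add, map_mul, red_two, zero_mul, add_zero, h1]
  have hyx : red (hf A y x) = 1 := by rw [← hf_star hH, red_star, hxy, star_one]
  refine ⟨hx4, hxy, ?_, ?_⟩
  · rintro ⟨u, hu⟩
    rw [hu, hf_smul_left, map_mul, red_two, zero_mul] at hxy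
    exact zero_ne_one hxy
  · rw [two_smul_mem_nbr hx4, ← red_eq_zero, hyx]
    exact one_ne_zero

lemma two_dvd_trace {z : Eis} (h : 2 ∣ z + star z) : red z = 0 ∨ red z = 1 := by
  have h1 := (Eis.two_dvd_iff.1 h).1
  rw [QuadraticAlgebra.re_add, star_re] at h1
  have h2 : ((z.im : ℤ) : ZMod 2) = 0 := by
    rw [ZMod.intCast_zmod_eq_zero_iff_dvd]
    push_cast
    omega
  have h3 : ∀ a : ZMod 2, a = 0 ∨ a = 1 := by decide
  rcases h3 (z.re : ZMod 2) with h | h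
  · exact Or.inl (QuadraticAlgebra.ext h h2)
  · exact Or.inr (QuadraticAlgebra.ext h h2)

lemma nbrs_not_mem_ncard (hA : IsUL A) (y : Fin n → Eis) :
    {N | N ∈ nbrs A ∧ (2 : Eis) • y ∉ N}.ncard = 2 * (isoSet (A.map red) (red ∘ y)).ncard := by
  classical
  have hH := hA.pd.isHermitian
  set S := isoSet (A.map red) (red ∘ y) with hS
  choose! s hs1 hs4 using fun w (hw : w ∈ S) => exists_lift hA hw
  have hs : ∀ w ∈ S, red (hf A (s w) y) = 1 := fun w hw => by
    rw [red_hf, hs1 w hw]; exact hw.1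
  let x : (Fin n → F4) × Bool → Fin n → Eis := fun p =>
    s p.1 + (2 : Eis) • ((if p.2 then 1 else 0 : Eis) • y)
  have hx : ∀ w ∈ S, ∀ ε, 4 ∣ hf A (x (w, ε)) (x (w, ε)) ∧ red (hf A (x (w, ε)) y) = 1 ∧
      ¬ Ev (x (w, ε)) ∧ (2 : Eis) • y ∉ nbr A (x (w, ε)) := fun w hw ε =>
    twist_props hA (hs w hw) (hs4 w hw) ε
  have hxr : ∀ w ∈ S, ∀ ε, red ∘ x (w, ε) = w := fun w hw ε => by
    rw [red_add, red_two_smul, add_zero, hs1 w hw]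
  have hcard : (S ×ˢ (Set.univ : Set Bool)).ncard = 2 * S.ncard := by
    rw [Set.ncard_prod, Set.ncard_univ]; simp [mul_comm]
  rw [← hcard]
  symm
  refine Set.ncard_congr (fun p _ => nbr A (x p)) ?_ ?_ ?_
  · rintro ⟨w, ε⟩ ⟨hw, -⟩
    obtain ⟨h1, h2, h3, h4⟩ := hx w hw ε
    exact ⟨⟨_, h3, h1, rfl⟩, h4⟩
  · rintro ⟨w, ε⟩ ⟨w', ε'⟩ ⟨hw, -⟩ ⟨hw', -⟩ h
    have hw : w ∈ S := hw
    have hw' : w' ∈ S := hw'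
    have h : nbr A (x (w, ε)) = nbr A (x (w', ε')) := h
    obtain ⟨h1, h2, h3, h4⟩ := hx w hw ε
    obtain ⟨h1', h2', h3', h4'⟩ := hx w' hw' ε'
    have h5 := self_mem_nbr h1
    rw [h] at h5
    obtain ⟨a, u, h6, -⟩ := exists_of_mem_nbr h1' h5
    have h7 : w = red a • w' := by
      have := congrArg (red ∘ ·) h6
      simpa only [red_add, red_smul, red_two, zero_smul, add_zero, hxr w hw, hxr w' hw'] using this
    have h8 : red a = 1 := by
      have := hw.1
      rwa [h7, hf_smul_left, hw'.1, mul_one] at this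
    rw [h8, one_smul] at h7
    subst h7
    refine Prod.ext rfl ?_
    show ε = ε'
    have h9 := self_mem_nbr h1'
    rw [← h] at h5
    rw [← h] at h9
    have h10 := sub_mem h5 h9
    have h11 := sub_mem h9 h5
    rcases ε with _ | _ <;> rcases ε' with _ | _
    · rfl
    · exact absurd (by simpa [x] using h11) h4
    · exact absurd (by simpa [x] using h10) h4
    · rfl
  · rintro N ⟨⟨v, hE, hv, rfl⟩, hyN⟩
    rw [two_smul_mem_nbr hv] at hyN
    have h1 : ¬ 2 ∣ hf A v y := fun h => hyN (by
      rw [← hf_star hH]; exact Eis.two_dvd_star h)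
    obtain ⟨c, k, hc⟩ := Eis.exists_inv_mod_two h1
    rw [← hf_smul_left] at hc
    have hcv : c • v ∈ nbr A v := Submodule.smul_mem _ _ (self_mem_nbr hv)
    have hred : red (hf A (c • v) y) = 1 := red_eq_one.2 ⟨k, hc⟩
    have hcE : ¬ Ev (c • v) := by
      rintro ⟨u, hu⟩
      rw [hu, hf_smul_left, map_mul, red_two, zero_mul] at hred
      exact zero_ne_one hred
    have hc4 : 4 ∣ hf A (c • v) (c • v) := nbr_isotropic hH hv hcv hcv
    have hw : red ∘ (c • v) ∈ S := by
      refine ⟨by rw [← red_hf, hred], ?_⟩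
      rw [← red_hf, red_eq_zero]
      exact dvd_trans ⟨2, by norm_num⟩ hc4
    have key : ∃ ε, c • v ∈ nbr A (x (red ∘ (c • v), ε)) := by
      set w := red ∘ (c • v) with hwdef
      obtain ⟨u, hu⟩ : Ev (c • v - s w) := red_comp_eq_zero (by
        refine funext fun i => ?_
        rw [Function.comp_apply, Pi.sub_apply, map_sub, Pi.zero_apply, sub_eq_zero]
        exact (congrFun (hs1 w hw) i).symm)
      have hcv' : c • v = s w + (2 : Eis) • u := by rw [← hu]; abel
      have h5 := hc4
      rw [hcv', hf_self_add_two hH, dvd_add_left (dvd_mul_right _ _), dvd_add_right (hs4 w hw),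
        four_eq, mul_dvd_mul_iff_left two_ne_zero_eis] at h5
      rcases two_dvd_trace h5 with h6 | h6
      · refine ⟨false, ?_⟩
        have := (mem_nbr_iff (hx w hw false).1 (a := 1) (u := u)).2
        simp only [x, Bool.false_eq_true, if_false, zero_smul, smul_zero, add_zero, one_smul] at this ⊢
        rw [hcv']
        exact this (red_eq_zero.1 h6)
      · refine ⟨true, ?_⟩
        have := (mem_nbr_iff (hx w hw true).1 (a := 1) (u := u - y)).2 (by
          have hyx : red (hf A y (x (w, true))) = 1 := by
            rw [← hf_star hH, red_star, (hx w hw true).2.1, star_one]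
          have hux : red (hf A u (x (w, true))) = 1 := by
            rw [hf_add_right, hf_smul_right, star_two_eis, map_add, map_mul, red_two, zero_mul,
              add_zero, h6]
          rw [← red_eq_zero, sub_eq_add_neg, ← neg_one_smul Eis y, hf_add_left, hf_smul_left,
            map_add, map_mul, hyx, hux]
          simp)
        convert this using 1
        rw [hcv']
        simp only [x, if_true, one_smul, smul_sub]
        abel
    obtain ⟨ε, hε⟩ := key
    refine ⟨(red ∘ (c • v), ε), ⟨hw, trivial⟩, ?_⟩
    obtain ⟨h1, h2, h3, h4⟩ := hx _ hw ε
    show nbr A (x (red ∘ (c • v), ε)) = nbr A v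
    rw [← nbr_eq_of_mem hH h1 h3 hε hcE, nbr_eq_of_mem hH hv hE hcv hcE]

lemma red_nondegenerate (hA : IsUL A) (t : Fin n → F4)
    (h : ∀ w, hf (A.map red) t w = 0) : t = 0 := by
  obtain ⟨x, rfl⟩ := exists_red t
  by_contra hx
  have hE : ¬ Ev x := by
    rintro ⟨u, rfl⟩
    exact hx (red_two_smul u)
  obtain ⟨w, k, hw⟩ := hA.exists_dual hE
  have h1 := h (red ∘ w)
  rw [← red_hf, ← hf_star hA.pd.isHermitian, red_star, red_eq_one.2 ⟨k, hw⟩, star_one] at h1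
  exact one_ne_zero h1

lemma red_hf_self (hA : IsUL A) (y : Fin n → Eis) :
    hf (A.map red) (red ∘ y) (red ∘ y) = (hnorm A y : F4) := by
  rw [← red_hf, hf_self hA.pd.isHermitian, map_intCast]

theorem wrep_four (n : ℕ) :
    wrep (n + 1) 4 = (1 + 4 ^ n - (-2) ^ n) * wrep (n + 1) 1 := by
  have h0 : (0 : ℤ) ≤ 4 ^ n - (-2) ^ n := by
    have : |(-2 : ℤ) ^ n| ≤ 4 ^ n := by
      rw [abs_pow]; exact pow_le_pow_left₀ (by norm_num) (by norm_num) n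
    have := le_abs_self ((-2 : ℤ) ^ n)
    omega
  have := wrep_four_mul (n := n + 1) 1 (4 ^ n - (-2) ^ n : ℤ).toNat fun A hA y hy => by
    rw [nbrs_not_mem_ncard hA]
    have := isoSet_ncard_of_odd (red_isHermitian hA.pd.isHermitian) (red_nondegenerate hA)
      (y := red ∘ y) (by rw [red_hf_self hA, hy]; simp)
    zify
    rw [Int.toNat_of_nonneg h0]
    exact_mod_cast this
  have h1 : (((4 ^ n - (-2) ^ n : ℤ).toNat : ℕ) : ℚ) = 4 ^ n - (-2) ^ n := by
    have := Int.toNat_of_nonneg h0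
    rw [← Int.cast_natCast, this]; push_cast; ring
  rw [h1] at this
  norm_num at this
  rw [this]; ring

theorem wrep_eight (n : ℕ) : wrep (n + 1) 8 = (1 + 4 ^ n) * wrep (n + 1) 2 := by
  have := wrep_four_mul (n := n + 1) 2 (4 ^ n) fun A hA y hy => by
    rw [nbrs_not_mem_ncard hA]
    have hE : ¬ Ev y := by
      rintro ⟨u, rfl⟩
      rw [hnorm_smul hA.pd.isHermitian, show nrm 2 = 4 from rfl] at hy
      omega
    obtain ⟨w₀, k, hw⟩ := hA.exists_dual hE
    have := isoSet_ncard_of_even (red_isHermitian hA.pd.isHermitian) (y := red ∘ y)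
      (w₀ := red ∘ w₀) (by rw [← red_hf, red_eq_one]; exact ⟨k, hw⟩)
      (by rw [red_hf_self hA, hy]; rfl)
    exact_mod_cast this
  norm_num at this
  exact this

end

section

open scoped Real ComplexConjugate

lemma summable_gauss_int {c : ℝ} (hc : 0 < c) (u : ℝ) :
    Summable fun p : ℤ => Real.exp (-c * (p + u) ^ 2) := by
  have h := ((summable_jacobiTheta₂_term_iff (I * (c * u / π : ℝ)) (I * (c / π : ℝ))).2
    (by rw [I_mul_im, ofReal_re]; positivity)).norm.mul_left (Real.exp (-c * u ^ 2))
  refine h.congr fun p => ?_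
  rw [norm_jacobiTheta₂_term, ← Real.exp_add, I_mul_im, I_mul_im, ofReal_re, ofReal_re]
  congr 1
  field_simp
  ring

lemma summable_gauss_eis {c : ℝ} (hc : 0 < c) (b : ℂ) :
    Summable fun y : Eis => Real.exp (-c * normSq (toC y - b)) := by
  set v : ℝ := 2 / √3 * b.im with hv
  have h := (summable_gauss_int (half_pos hc) (-(b.re + v / 2))).mul_of_nonneg
    (summable_gauss_int (half_pos hc) (-v)) (fun _ => (Real.exp_pos _).le)
    (fun _ => (Real.exp_pos _).le)
  have h2 := (QuadraticAlgebra.equivProd (-1 : ℤ) (-1)).summable_iff.2 h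
  refine h2.of_nonneg_of_le (fun _ => (Real.exp_pos _).le) fun y => ?_
  have h3 : √3 ^ 2 = 3 := Real.sq_sqrt (by norm_num)
  have h4 : b.im = √3 / 2 * v := by rw [hv]; field_simp
  simp only [Function.comp_apply, QuadraticAlgebra.equivProd, Equiv.coe_fn_mk, ← Real.exp_add]
  rw [Real.exp_le_exp, normSq_apply, sub_re, sub_im, toC_re, toC_im, h4]
  set P := (y.re : ℝ) - (b.re + v / 2)
  set Q := (y.im : ℝ) - v
  have h5 : ((y.re : ℝ) - y.im / 2 - b.re) = P - Q / 2 := by simp only [P, Q]; ring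
  have h6 : (y.im : ℝ) * (√3 / 2) - √3 / 2 * v = √3 / 2 * Q := by simp only [Q]; ring
  have h7 : (P - Q / 2) * (P - Q / 2) + √3 / 2 * Q * (√3 / 2 * Q) = P ^ 2 - P * Q + Q ^ 2 := by
    linear_combination (Q ^ 2 / 4) * h3
  rw [h5, h6, h7, ← sub_eq_add_neg, ← sub_eq_add_neg]
  change _ ≤ -(c / 2) * P ^ 2 + -(c / 2) * Q ^ 2
  nlinarith [mul_nonneg hc.le (sq_nonneg (P - Q))]

/-- One-dimensional Poisson summation for shifted Gaussians. -/
lemma poisson_int {τ : ℂ} (hτ : 0 < τ.im) (u s : ℂ) :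
    ∑' p : ℤ, cexp (π * I * τ * (p + u) ^ 2 + 2 * π * I * p * s) =
      1 / (-I * τ) ^ (1 / 2 : ℂ) *
        ∑' k : ℤ, cexp (-π * I * (k - s) ^ 2 / τ + 2 * π * I * u * (k - s)) := by
  have h0 : τ ≠ 0 := fun h => by simp [h] at hτ
  have h := jacobiTheta₂_functional_equation (τ * u + s) τ
  have e1 : ∑' p : ℤ, cexp (π * I * τ * (p + u) ^ 2 + 2 * π * I * p * s) =
      cexp (π * I * τ * u ^ 2) * jacobiTheta₂ (τ * u + s) τ := by
    rw [jacobiTheta₂, ← tsum_mul_left]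
    refine tsum_congr fun p => ?_
    rw [jacobiTheta₂_term, ← Complex.exp_add]
    congr 1; ring
  rw [e1, h, mul_left_comm, mul_assoc, jacobiTheta₂, ← tsum_mul_left, ← tsum_mul_left]
  congr 1
  refine tsum_congr fun k => ?_
  rw [jacobiTheta₂_term, ← Complex.exp_add, ← Complex.exp_add]
  congr 1
  field_simp
  ring

/-- The real pairing on `ℂ` for which the Eisenstein integers are self-dual. -/
def pair (x b : ℂ) : ℝ := 2 / √3 * (x * conj b).im

def ek (x b : ℂ) : ℂ := cexp (2 * π * I * pair x b)

def gk (β v : ℂ) : ℂ := cexp (2 * π * I * β * normSq v)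

lemma norm_ek (x b : ℂ) : ‖ek x b‖ = 1 := by
  rw [ek, show 2 * (π : ℂ) * I * pair x b = (2 * π * pair x b : ℝ) * I by push_cast; ring,
    norm_exp_ofReal_mul_I]

lemma norm_gk (β v : ℂ) : ‖gk β v‖ = Real.exp (-(2 * π * β.im) * normSq v) := by
  rw [gk, norm_exp]
  congr 1
  simp

lemma neg_inv_im_pos {z : ℂ} (hz : 0 < z.im) : 0 < (-1 / (3 * z)).im := by
  have h0 : 0 < normSq z := normSq_pos.2 fun h => by simp [h] at hz
  have : (-1 / (3 * z)).im = z.im / (3 * normSq z) := by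
    rw [neg_div, one_div, mul_inv, neg_im, Complex.mul_im, inv_re, inv_im, inv_re, inv_im]
    simp
    field_simp
  rw [this]
  positivity

lemma cpow_half_mul {w : ℂ} : ((2 : ℝ) * w) ^ (1 / 2 : ℂ) * ((3 / 2 : ℝ) * w) ^ (1 / 2 : ℂ) =
    √3 * w := by
  rcases eq_or_ne w 0 with rfl | hw
  · simp
  have h (r : ℝ) (hr : 0 < r) : ((r : ℂ) * w) ^ (1 / 2 : ℂ) = (√r : ℝ) * w ^ (1 / 2 : ℂ) := by
    have hr' : (r : ℂ) ≠ 0 := by exact_mod_cast hr.ne'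
    rw [cpow_def_of_ne_zero (mul_ne_zero hr' hw), Complex.log_ofReal_mul hr hw, add_mul,
      Complex.exp_add, ← cpow_def_of_ne_zero hw, Real.sqrt_eq_rpow, Real.rpow_def_of_pos hr]
    push_cast
    rfl
  rw [h 2 two_pos, h (3 / 2) (by norm_num), mul_mul_mul_comm, ← cpow_add _ _ hw, ← ofReal_mul,
    ← Real.sqrt_mul two_pos.le]
  norm_num

lemma norm_exp_gauss (τ : ℂ) (x y : ℝ) :
    ‖cexp (π * I * τ * x ^ 2 + 2 * π * I * y)‖ = Real.exp (-(π * τ.im) * x ^ 2) := by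
  rw [norm_exp, ← ofReal_pow]
  congr 1
  simp [-ofReal_pow]

lemma coe_normSq_add (x v : ℂ) :
    (normSq (x + v) : ℂ) = (x.re + v.re) ^ 2 + (x.im + v.im) ^ 2 := by
  rw [normSq_apply]; push_cast [add_re, add_im]; ring

lemma gk_mul_ek (β u b : ℂ) (U B : ℝ) (hu : u.im = √3 / 2 * U) (hb : b.im = √3 / 2 * B)
    (p q : ℤ) : gk β (toC ⟨p, q⟩ + u) * ek (toC ⟨p, q⟩) b =
      cexp (π * I * (2 * β) * (p + (u.re - q / 2)) ^ 2 + 2 * π * I * p * -B) *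
        cexp (π * I * (3 / 2 * β) * (q + U) ^ 2 + 2 * π * I * q * (b.re + B / 2)) := by
  have hs3 : (√3 : ℂ) ≠ 0 := by exact_mod_cast (by positivity : √3 ≠ 0)
  have hs32 : (√3 : ℂ) ^ 2 = 3 := by exact_mod_cast Real.sq_sqrt (by norm_num : (0 : ℝ) ≤ 3)
  have h1 : (normSq (toC ⟨p, q⟩ + u) : ℂ) = (p - q / 2 + u.re) ^ 2 + 3 / 4 * (q + U) ^ 2 := by
    rw [coe_normSq_add, toC_re, toC_im, hu]
    push_cast
    linear_combination ((q + U : ℂ) ^ 2 / 4) * hs32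
  have h2 : (pair (toC ⟨p, q⟩) b : ℂ) = q * b.re - (p - q / 2) * B := by
    rw [pair, Complex.mul_im, conj_re, conj_im, toC_re, toC_im, hb]
    push_cast
    field_simp
    ring
  rw [gk, ek, h1, h2, ← Complex.exp_add, ← Complex.exp_add]
  congr 1
  ring

lemma gk_mul_ek_dual (β u b : ℂ) (hβ : β ≠ 0) (U B : ℝ) (hu : u.im = √3 / 2 * U)
    (hb : b.im = √3 / 2 * B) (k l : ℤ) :
    cexp (-π * I * (l - (b.re - k / 2)) ^ 2 / (3 / 2 * β) +
        2 * π * I * U * (l - (b.re - k / 2))) *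
      cexp (-π * I * (k + B) ^ 2 / (2 * β) + 2 * π * I * u.re * (k + B)) =
    gk (-1 / (3 * β)) (toC ⟨l, -k⟩ - b) * ek u (toC ⟨l, -k⟩ - b) := by
  have hs3 : (√3 : ℂ) ≠ 0 := by exact_mod_cast (by positivity : √3 ≠ 0)
  have hs32 : (√3 : ℂ) ^ 2 = 3 := by exact_mod_cast Real.sq_sqrt (by norm_num : (0 : ℝ) ≤ 3)
  have h1 : (normSq (toC ⟨l, -k⟩ - b) : ℂ) = (l + k / 2 - b.re) ^ 2 + 3 / 4 * (k + B) ^ 2 := by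
    rw [sub_eq_add_neg, coe_normSq_add, toC_re, toC_im, neg_re, neg_im, hb]
    push_cast
    linear_combination ((k + B : ℂ) ^ 2 / 4) * hs32
  have h2 : (pair u (toC ⟨l, -k⟩ - b) : ℂ) = U * (l + k / 2 - b.re) + u.re * (k + B) := by
    rw [pair, Complex.mul_im, conj_re, conj_im, sub_re, sub_im, toC_re, toC_im, hb, hu]
    push_cast
    field_simp
    ring
  rw [gk, ek, h1, h2, ← Complex.exp_add, ← Complex.exp_add]
  congr 1
  field_simp
  ring

theorem poisson_eis {β : ℂ} (hβ : 0 < β.im) (u b : ℂ) :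
    ∑' x : Eis, gk β (toC x + u) * ek (toC x) b =
      (√3 * (-I * β))⁻¹ * ∑' y : Eis, gk (-1 / (3 * β)) (toC y - b) * ek u (toC y - b) := by
  have hβ0 : β ≠ 0 := fun h => by simp [h] at hβ
  set U : ℝ := 2 / √3 * u.im with hU
  set B : ℝ := 2 / √3 * b.im with hB
  let a : ℤ → ℤ → ℂ := fun q p => gk β (toC ⟨p, q⟩ + u) * ek (toC ⟨p, q⟩) b
  let m : ℤ → ℤ → ℂ := fun q k =>
    cexp (-π * I * (k + B) ^ 2 / (2 * β) + 2 * π * I * (u.re - q / 2) * (k + B)) *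
      cexp (π * I * (3 / 2 * β) * (q + U) ^ 2 + 2 * π * I * q * (b.re + B / 2))
  let d : ℤ → ℤ → ℂ := fun k l =>
    gk (-1 / (3 * β)) (toC ⟨l, -k⟩ - b) * ek u (toC ⟨l, -k⟩ - b)
  have hb : b.im = √3 / 2 * B := by rw [hB]; field_simp
  have hu : u.im = √3 / 2 * U := by rw [hU]; field_simp
  have sa : Summable fun x : ℤ × ℤ => a x.1 x.2 := by
    rw [← (QuadraticAlgebra.equivProd (-1 : ℤ) (-1)).summable_iff.trans (Equiv.prodComm ℤ ℤ).summable_iff]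
    refine Summable.of_norm ((summable_gauss_eis (c := 2 * π * β.im) (by positivity) (-u)).congr
      fun x => ?_)
    simp [a, norm_gk, norm_ek, QuadraticAlgebra.equivProd]
  have sd : Summable fun x : ℤ × ℤ => d x.1 x.2 := by
    have := neg_inv_im_pos hβ
    rw [← (QuadraticAlgebra.equivProd (-1 : ℤ) (-1)).summable_iff.trans
      (((Equiv.prodComm ℤ ℤ).trans ((Equiv.neg ℤ).prodCongr (Equiv.refl ℤ))).summable_iff)]
    refine Summable.of_norm ((summable_gauss_eis (c := 2 * π * (-1 / (3 * β)).im)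
      (by positivity) b).congr fun x => ?_)
    simp [d, norm_gk, norm_ek, QuadraticAlgebra.equivProd]
  have hm (q k : ℤ) : ‖m q k‖ = Real.exp (-(π * (3 / 2 * (-1 / (3 * β)).im)) * (k + B) ^ 2) *
      Real.exp (-(π * (3 / 2 * β.im)) * (q + U) ^ 2) := by
    have e1 : (3 / 2 * (-1 / (3 * β)).im) = ((3 / 2 : ℝ) * (-1 / (3 * β))).im := by
      rw [im_ofReal_mul]
    have e2 : (3 / 2 * β.im) = ((3 / 2 : ℝ) * β).im := by rw [im_ofReal_mul]
    rw [e1, e2, ← norm_exp_gauss _ (k + B) ((u.re - q / 2) * (k + B)),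
      ← norm_exp_gauss _ (q + U) (q * (b.re + B / 2)), ← norm_mul]
    refine congrArg norm (congrArg₂ (· * ·) (congrArg cexp ?_) (congrArg cexp ?_))
    · push_cast; field_simp
    · push_cast; ring
  have sm : Summable fun x : ℤ × ℤ => m x.1 x.2 := by
    have := neg_inv_im_pos hβ
    have h := (summable_gauss_int (c := π * (3 / 2 * β.im)) (by positivity) U).mul_of_nonneg
      (summable_gauss_int (c := π * (3 / 2 * (-1 / (3 * β)).im)) (by positivity) B)
      (fun _ => (Real.exp_pos _).le) (fun _ => (Real.exp_pos _).le)
    refine Summable.of_norm (h.congr fun x => ?_)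
    rw [hm, mul_comm]
  have h1 (q : ℤ) : ∑' p, a q p = 1 / (-I * (2 * β)) ^ (1 / 2 : ℂ) * ∑' k, m q k := by
    have e := poisson_int (τ := 2 * β) (by simpa using hβ) (u.re - q / 2) (-B)
    set C := cexp (π * I * (3 / 2 * β) * (q + U) ^ 2 + 2 * π * I * q * (b.re + B / 2)) with hC
    have e1 : ∑' p, a q p = (∑' p : ℤ, cexp (π * I * (2 * β) * (p + (u.re - q / 2)) ^ 2 +
        2 * π * I * p * -B)) * C := by
      rw [← tsum_mul_right]
      refine tsum_congr fun p => ?_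
      exact gk_mul_ek β u b U B hu hb p q
    rw [e1, e, mul_assoc, ← tsum_mul_right]
    congr 1
    refine tsum_congr fun k => ?_
    simp only [m, sub_neg_eq_add, hC]
  have h2 (k : ℤ) : ∑' q, m q k = 1 / (-I * (3 / 2 * β)) ^ (1 / 2 : ℂ) * ∑' l, d k l := by
    have e := poisson_int (τ := 3 / 2 * β) (by
      rw [show (3 / 2 * β : ℂ) = (3 / 2 : ℝ) * β by push_cast; ring, im_ofReal_mul]
      positivity) U (b.re - k / 2)
    set C := cexp (-π * I * (k + B) ^ 2 / (2 * β) + 2 * π * I * u.re * (k + B)) with hC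
    have e1 : ∑' q, m q k = (∑' q : ℤ, cexp (π * I * (3 / 2 * β) * (q + U) ^ 2 +
        2 * π * I * q * (b.re - k / 2))) * C := by
      rw [← tsum_mul_right]
      refine tsum_congr fun p => ?_
      simp only [m, hC, ← Complex.exp_add]
      congr 1
      ring
    rw [e1, e, mul_assoc, ← tsum_mul_right]
    congr 1
    refine tsum_congr fun l => ?_
    exact gk_mul_ek_dual β u b hβ0 U B hu hb k l
  have h3 : ∑' x : Eis, gk β (toC x + u) * ek (toC x) b = ∑' q, ∑' p, a q p := by
    rw [← Summable.tsum_prod' sa fun q => sa.comp_injective (Prod.mk_right_injective q)]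
    exact (((QuadraticAlgebra.equivProd (-1 : ℤ) (-1)).trans (Equiv.prodComm ℤ ℤ)).tsum_eq
      fun x : ℤ × ℤ => a x.1 x.2)
  have h4 : ∑' y : Eis, gk (-1 / (3 * β)) (toC y - b) * ek u (toC y - b) = ∑' k, ∑' l, d k l := by
    rw [← Summable.tsum_prod' sd fun q => sd.comp_injective (Prod.mk_right_injective q)]
    rw [← (((QuadraticAlgebra.equivProd (-1 : ℤ) (-1)).trans ((Equiv.prodComm ℤ ℤ).trans
      ((Equiv.neg ℤ).prodCongr (Equiv.refl ℤ)))).tsum_eq fun x : ℤ × ℤ => d x.1 x.2)]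
    refine tsum_congr fun y => ?_
    simp [d, QuadraticAlgebra.equivProd]
  have h5 : ∑' q, ∑' k, m q k = ∑' k, ∑' q, m q k := (Summable.tsum_comm (f := m) sm).symm
  rw [h3, h4, tsum_congr h1, tsum_mul_left, h5, tsum_congr h2, tsum_mul_left, ← mul_assoc]
  congr 1
  have e1 : -I * (2 * β) = (2 : ℝ) * (-I * β) := by push_cast; ring
  have e2 : -I * (3 / 2 * β) = (3 / 2 : ℝ) * (-I * β) := by push_cast; ring
  rw [← cpow_half_mul, mul_inv, e1, e2]
  simp only [one_div]

end

section
open scoped Real ComplexConjugate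

variable {n : ℕ}

lemma summable_gauss (n : ℕ) {c : ℝ} (hc : 0 < c) (b : Fin n → ℂ) :
    Summable fun y : Fin n → Eis => Real.exp (-c * ∑ i, normSq (toC (y i) - b i)) := by
  induction n with
  | zero => exact Summable.of_finite
  | succ n ih =>
    have h := (summable_gauss_eis hc (b 0)).mul_of_nonneg (ih (Fin.tail b))
      (fun _ => (Real.exp_pos _).le) (fun _ => (Real.exp_pos _).le)
    rw [← (Fin.consEquiv fun _ : Fin (n + 1) => Eis).summable_iff]
    refine h.congr fun p => ?_
    simp [Fin.consEquiv, Fin.sum_univ_succ, ← Real.exp_add, mul_add, Fin.tail]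

/-- The Gaussian attached to a hermitian form. -/
def gh (z : ℂ) (H : Matrix (Fin n) (Fin n) ℂ) (v : Fin n → ℂ) : ℂ :=
  cexp (2 * π * I * z * hf H v v)

def ekn (x b : Fin n → ℂ) : ℂ := ∏ i, ek (x i) (b i)

lemma norm_ekn (x b : Fin n → ℂ) : ‖ekn x b‖ = 1 := by simp [ekn, norm_prod, norm_ek]

lemma ekn_cons (x b : Fin (n + 1) → ℂ) :
    ekn x b = ek (x 0) (b 0) * ekn (Fin.tail x) (Fin.tail b) := Fin.prod_univ_succ _

lemma hf_self_im {H : Matrix (Fin n) (Fin n) ℂ} (hH : H.IsHermitian) (v : Fin n → ℂ) :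
    (hf H v v).im = 0 := Complex.conj_eq_iff_im.1 (hf_star hH v v)

lemma norm_gh {H : Matrix (Fin n) (Fin n) ℂ} (hH : H.IsHermitian) (z : ℂ) (v : Fin n → ℂ) :
    ‖gh z H v‖ = Real.exp (-(2 * π * z.im) * (hf H v v).re) := by
  rw [gh, norm_exp]
  congr 1
  simp [hf_self_im hH]

lemma summable_gh {H : Matrix (Fin n) (Fin n) ℂ} (hH : H.PosDef) {z : ℂ} (hz : 0 < z.im)
    (b : Fin n → ℂ) : Summable fun y : Fin n → Eis => ‖gh z H (toC ∘ y - b)‖ := by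
  obtain ⟨c, hc, h⟩ := exists_lower_bound hH
  refine (summable_gauss n (c := 2 * π * z.im * c) (by positivity) b).of_nonneg_of_le
    (fun _ => norm_nonneg _) fun y => ?_
  rw [norm_gh hH.1, Real.exp_le_exp, neg_mul, neg_mul, neg_le_neg_iff, mul_assoc]
  exact mul_le_mul_of_nonneg_left (h _) (by positivity)

lemma hf_inv {H : Matrix (Fin n) (Fin n) ℂ} (hH : H.PosDef) (w : Fin n → ℂ) :
    hf H⁻¹ (w ᵥ* H) (w ᵥ* H) = hf H w w := by
  have hu : IsUnit H.det := (isUnit_iff_isUnit_det _).1 hH.isUnit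
  rw [← hf_congr, hH.1.eq, mul_nonsing_inv _ hu, one_mul]

lemma hf_inv_schur {H : Matrix (Fin (n + 1)) (Fin (n + 1)) ℂ} (hH : H.PosDef)
    (y : Fin (n + 1) → ℂ) :
    H 0 0 * hf H⁻¹ y y = normSq (y 0) + hf (schur H)⁻¹
      (fun j => H 0 0 * y j.succ - y 0 * H 0 j.succ)
      (fun j => H 0 0 * y j.succ - y 0 * H 0 j.succ) := by
  have hu : IsUnit H.det := (isUnit_iff_isUnit_det _).1 hH.isUnit
  obtain ⟨w, rfl⟩ : ∃ w, y = w ᵥ* H :=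
    ⟨y ᵥ* H⁻¹, by rw [vecMul_vecMul, nonsing_inv_mul _ hu, vecMul_one]⟩
  have h0 : hf H w (Fin.cons 1 0) = (w ᵥ* H) 0 := by
    rw [hf_cons_one]
    simp [vecMul, dotProduct, Fin.sum_univ_succ, mul_comm]
  have h1 : (fun j : Fin n => H 0 0 * (w ᵥ* H) j.succ - (w ᵥ* H) 0 * H 0 j.succ) =
      Fin.tail w ᵥ* schur H := by
    funext j
    simp only [vecMul, dotProduct, Fin.sum_univ_succ, schur, of_apply, mul_sub, add_mul, mul_add,
      Finset.sum_sub_distrib, Finset.mul_sum, Finset.sum_mul, Fin.tail]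
    have e (i : Fin n) : w i.succ * (H 0 0 * H i.succ j.succ) =
      H 0 0 * (w i.succ * H i.succ j.succ) := by ring
    simp only [e, mul_assoc]
    ring
  rw [hf_inv hH, h1, hf_inv (posDef_schur hH), hf_schur, ← hf_star hH.1 w, h0, mul_comm]
  congr 1
  exact Complex.normSq_eq_conj_mul_self.symm

lemma pair_add_right (x b c : ℂ) : pair x (b + c) = pair x b + pair x c := by
  simp [pair]; ring

lemma pair_mul_left (x h c : ℂ) : pair (x * h) c = pair x (c * conj h) := by
  rw [pair, pair, map_mul, conj_conj, mul_assoc, mul_comm h]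

lemma pair_sum_left {ι : Type*} (s : Finset ι) (x : ι → ℂ) (c : ℂ) :
    pair (∑ i ∈ s, x i) c = ∑ i ∈ s, pair (x i) c := by
  simp [pair, Finset.sum_mul, Finset.mul_sum]

lemma ek_sum_mul_ekn (x h b : Fin n → ℂ) (c : ℂ) :
    ek (∑ i, x i * h i) c * ekn x b = ekn x (fun i => b i + c * conj (h i)) := by
  simp only [ek, ekn, ← Complex.exp_sum, ← Complex.exp_add, pair_sum_left, pair_mul_left,
    pair_add_right]
  congr 1
  push_cast
  rw [← Finset.mul_sum, ← Finset.mul_sum, Finset.sum_add_distrib]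
  ring

lemma gh_schur {H : Matrix (Fin (n + 1)) (Fin (n + 1)) ℂ} (hH : H.IsHermitian) (z : ℂ) {a : ℝ}
    (ha : a ≠ 0) (h0 : H 0 0 = a) (x : Fin (n + 1) → ℂ) :
    gh z H x = gk (z * a) (x 0 + ∑ i : Fin n, Fin.tail x i * (H i.succ 0 / a)) *
      gh (z / a) (schur H) (Fin.tail x) := by
  have ha' : (a : ℂ) ≠ 0 := by exact_mod_cast ha
  have h1 : (∑ i : Fin n, Fin.tail x i * (H i.succ 0 / a)) =
      (∑ i : Fin n, x i.succ * H i.succ 0) / a := by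
    rw [Finset.sum_div]; simp [Fin.tail, mul_div_assoc]
  have h2 := hf_schur H x x
  rw [← hf_star hH x (Fin.cons 1 0), hf_cons_one, h0] at h2
  rw [gk, gh, gh, ← Complex.exp_add, h1]
  have h3 : (normSq (x 0 + (∑ i : Fin n, x i.succ * H i.succ 0) / a) : ℂ) =
      (a * x 0 + ∑ i : Fin n, x i.succ * H i.succ 0) *
        star (a * x 0 + ∑ i : Fin n, x i.succ * H i.succ 0) / a ^ 2 := by
    rw [← mul_conj, ← starRingEnd_apply, show ∀ t : ℂ, x 0 + t / a = (a * x 0 + t) / a from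
      fun t => by field_simp, map_div₀, conj_ofReal]
    field_simp
  rw [h3]
  congr 1
  field_simp
  linear_combination z * h2

lemma gk_mul_gh_inv {H : Matrix (Fin (n + 1)) (Fin (n + 1)) ℂ} (hH : H.PosDef) (z : ℂ) {a : ℝ}
    (ha : a ≠ 0) (h0 : H 0 0 = a) (y : Fin (n + 1) → ℂ) :
    gk (-1 / (3 * (z * a))) (y 0) *
        gh (-1 / (3 * (z / a))) (schur H)⁻¹ (fun j => y j.succ - y 0 * (H 0 j.succ / a)) =
      gh (-1 / (3 * z)) H⁻¹ y := by
  have ha' : (a : ℂ) ≠ 0 := by exact_mod_cast ha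
  have h1 := hf_inv_schur hH y
  have h2 : (fun j : Fin n => H 0 0 * y j.succ - y 0 * H 0 j.succ) =
      (a : ℂ) • fun j : Fin n => y j.succ - y 0 * (H 0 j.succ / a) := by
    funext j
    simp [h0]
    field_simp
  rw [h2, hf_smul_left, hf_smul_right, h0, show star (a : ℂ) = a from conj_ofReal a] at h1
  generalize (fun j : Fin n => y j.succ - y 0 * (H 0 j.succ / a)) = v at h1 ⊢
  rw [gk, gh, gh, ← Complex.exp_add]
  congr 1
  rcases eq_or_ne z 0 with rfl | hz
  · simp
  field_simp
  linear_combination h1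

lemma tsum_fin_succ {α : Type*} {f : (Fin (n + 1) → α) → ℂ} (hf : Summable f) :
    ∑' x, f x = ∑' (x₀ : α) (x : Fin n → α), f (Fin.cons x₀ x) := by
  have h : Summable fun p : α × (Fin n → α) => f (Fin.cons p.1 p.2) :=
    (Fin.consEquiv fun _ : Fin (n + 1) => α).summable_iff.2 hf
  rw [← (Fin.consEquiv fun _ : Fin (n + 1) => α).tsum_eq f]
  exact h.tsum_prod

lemma tsum_fin_succ_comm {α : Type*} {f : (Fin (n + 1) → α) → ℂ} (hf : Summable f) :
    ∑' x, f x = ∑' (x : Fin n → α) (x₀ : α), f (Fin.cons x₀ x) := by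
  rw [tsum_fin_succ hf]
  have h : Summable fun p : α × (Fin n → α) => f (Fin.cons p.1 p.2) :=
    (Fin.consEquiv fun _ : Fin (n + 1) => α).summable_iff.2 hf
  exact (Summable.tsum_comm (f := fun (x₀ : α) (x : Fin n → α) => f (Fin.cons x₀ x)) h).symm

lemma gh_mul_ekn_cons {H : Matrix (Fin (n + 1)) (Fin (n + 1)) ℂ} (hH : H.IsHermitian) (z : ℂ)
    {a : ℝ} (ha : a ≠ 0) (h0 : H 0 0 = a) (b : Fin (n + 1) → ℂ) (x₀ : Eis) (x : Fin n → Eis) :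
    gh z H (toC ∘ (Fin.cons x₀ x : Fin (n + 1) → Eis)) *
        ekn (toC ∘ (Fin.cons x₀ x : Fin (n + 1) → Eis)) b =
      (gk (z * a) (toC x₀ + ∑ i : Fin n, toC (x i) * (H i.succ 0 / a)) * ek (toC x₀) (b 0)) *
        (gh (z / a) (schur H) (toC ∘ x) * ekn (toC ∘ x) (Fin.tail b)) := by
  rw [gh_schur hH z ha h0, ekn_cons, mul_mul_mul_comm]
  rfl

theorem theta_poisson (n : ℕ) {H : Matrix (Fin n) (Fin n) ℂ} (hH : H.PosDef) {z : ℂ}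
    (hz : 0 < z.im) (b : Fin n → ℂ) :
    ∑' x : Fin n → Eis, gh z H (toC ∘ x) * ekn (toC ∘ x) b =
      ((√3 * (-I * z)) ^ n)⁻¹ * (H.det)⁻¹ *
        ∑' y : Fin n → Eis, gh (-1 / (3 * z)) H⁻¹ (toC ∘ y - b) := by
  induction n generalizing z with
  | zero => simp [gh, ekn, hf, tsum_fintype]
  | succ n ih =>
    obtain ⟨a, ha, h0⟩ : ∃ a : ℝ, 0 < a ∧ H 0 0 = a := by
      have := posDef_zero_zero hH
      rw [Complex.lt_def] at this
      exact ⟨_, this.1, Complex.ext rfl this.2.symm⟩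
    have hz0 : z ≠ 0 := fun h => by simp [h] at hz
    have ha' : (a : ℂ) ≠ 0 := by exact_mod_cast ha.ne'
    have hza : 0 < (z * a).im := by rw [im_mul_ofReal]; positivity
    have hza' : 0 < (z / a).im := by rw [div_ofReal_im]; positivity
    let σ : (Fin n → Eis) → ℂ := fun x => ∑ i : Fin n, toC (x i) * (H i.succ 0 / a)
    let β : Eis → Fin n → ℂ := fun y i => b i.succ + (toC y - b 0) * (H 0 i.succ / a)
    have hs1 : Summable fun x : Fin (n + 1) → Eis => gh z H (toC ∘ x) * ekn (toC ∘ x) b := by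
      have := summable_gh hH hz 0
      simp only [sub_zero] at this
      refine Summable.of_norm (this.congr fun x => ?_)
      rw [norm_mul, norm_ekn, mul_one]
    have hs2 : Summable fun y : Fin (n + 1) → Eis => gh (-1 / (3 * z)) H⁻¹ (toC ∘ y - b) :=
      Summable.of_norm (summable_gh hH.inv (neg_inv_im_pos hz) b)
    let m : (Fin n → Eis) → Eis → ℂ := fun x y => gk (-1 / (3 * (z * a))) (toC y - b 0) *
      (gh (z / a) (schur H) (toC ∘ x) * ekn (toC ∘ x) (β y))
    have hs3 : Summable (Function.uncurry m) := by
      have h1 := summable_gh (posDef_schur hH) hza' 0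
      simp only [sub_zero] at h1
      have h2 := neg_inv_im_pos hza
      refine Summable.of_norm ((h1.mul_of_nonneg (summable_gauss_eis
        (c := 2 * π * (-1 / (3 * (z * a))).im) (by positivity) (b 0)) (fun _ => norm_nonneg _)
        (fun _ => (Real.exp_pos _).le)).congr fun p => ?_)
      simp only [Function.uncurry, m]
      rw [norm_mul, norm_mul, norm_gk, norm_ekn, mul_one, mul_comm]
    have e2 (x : Fin n → Eis) :
        ∑' x₀ : Eis, gh z H (toC ∘ (Fin.cons x₀ x : Fin (n + 1) → Eis)) *
            ekn (toC ∘ (Fin.cons x₀ x : Fin (n + 1) → Eis)) b =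
          (√3 * (-I * (z * a)))⁻¹ * ∑' y, m x y := by
      simp only [gh_mul_ekn_cons hH.1 z ha.ne' h0]
      rw [tsum_mul_right, poisson_eis hza, mul_assoc, ← tsum_mul_right]
      congr 1
      refine tsum_congr fun y => ?_
      simp only [m]
      rw [mul_assoc, mul_left_comm (ek _ _)]
      congr 2
      refine (ek_sum_mul_ekn (toC ∘ x) (fun i => H i.succ 0 / a) _ _).trans ?_
      congr 1
      funext i
      simp only [β, Fin.tail, map_div₀, conj_ofReal]
      rw [starRingEnd_apply, hH.1.apply]
    have e3 (y : Eis) : ∑' x, m x y = ((√3 * (-I * (z / a))) ^ n)⁻¹ * ((schur H).det)⁻¹ *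
        ∑' y', gh (-1 / (3 * z)) H⁻¹ (toC ∘ (Fin.cons y y' : Fin (n + 1) → Eis) - b) := by
      simp only [m]
      rw [tsum_mul_left, ih (posDef_schur hH) hza', mul_left_comm, ← tsum_mul_left]
      congr 1
      refine tsum_congr fun y' => ?_
      rw [← gk_mul_gh_inv hH z ha.ne' h0]
      congr 2
      funext i
      simp [β]
      ring
    rw [tsum_fin_succ_comm hs1, tsum_congr e2, tsum_mul_left, (Summable.tsum_comm (f := m) hs3).symm, tsum_congr e3,
      tsum_mul_left, tsum_fin_succ hs2, ← mul_assoc]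
    congr 1
    have hd := det_schur H
    rw [h0] at hd
    have hd' : (schur H).det = a ^ n * H.det / a := by rw [← hd]; field_simp
    have h5 : H.det ≠ 0 := hH.det_pos.ne'
    have hs : (√3 : ℂ) ≠ 0 := by exact_mod_cast (by positivity : √3 ≠ 0)
    set w : ℂ := √3 * (-I * z) with hw
    have hw0 : w ≠ 0 := mul_ne_zero hs (mul_ne_zero (neg_ne_zero.2 I_ne_zero) hz0)
    rw [hd', show √3 * (-I * (z * a)) = w * a by rw [hw]; ring,
      show √3 * (-I * (z / a)) = w / a by rw [hw]; ring, div_pow]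
    field_simp
    ring

end

section
open scoped Real ComplexConjugate

variable {n : ℕ}

/-- The value of a power series with complex coefficients. -/
def ev (p : PowerSeries ℂ) (q : ℂ) : ℂ := ∑' m, p.coeff m * q ^ m

/-- The nome `exp (2πiz)`. -/
def nome (z : ℂ) : ℂ := cexp (2 * π * I * z)

lemma norm_nome (z : ℂ) : ‖nome z‖ = Real.exp (-(2 * π) * z.im) := by
  rw [nome, norm_exp]
  congr 1
  simp

lemma norm_nome_lt {z : ℂ} (hz : 0 < z.im) : ‖nome z‖ < 1 := by
  rw [norm_nome, Real.exp_lt_one_iff]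
  have := Real.pi_pos
  nlinarith

lemma exists_nome {q : ℂ} (hq : ‖q‖ < 1) (h0 : q ≠ 0) : ∃ z : ℂ, 0 < z.im ∧ nome z = q := by
  have hp := Real.pi_pos
  refine ⟨-(I * Complex.log q / (2 * π)), ?_, ?_⟩
  · have h1 : (-(I * Complex.log q / (2 * π))).im = -Real.log ‖q‖ / (2 * π) := by
      rw [show -(I * Complex.log q / (2 * π)) = -(I * Complex.log q) / ((2 * π : ℝ) : ℂ) by
        push_cast; ring, Complex.div_ofReal_im]
      simp [Complex.log_re]
    rw [h1]
    have := Real.log_neg (norm_pos_iff.2 h0) hq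
    apply div_pos <;> linarith
  · rw [nome, show 2 * π * I * -(I * Complex.log q / (2 * π)) = -(I * I) * Complex.log q by
      have : (π : ℂ) ≠ 0 := by exact_mod_cast hp.ne'
      field_simp, I_mul_I, neg_neg, one_mul, Complex.exp_log h0]

/-- The series which transform under the Fricke involution `z ↦ -1 / (3z)` like the theta series of
a unimodular lattice of rank `n`. -/
structure IsForm (n : ℕ) (p : PowerSeries ℂ) : Prop where
  summable : ∀ q : ℂ, ‖q‖ < 1 → Summable fun m => ‖p.coeff m * q ^ m‖
  transform : ∀ z : ℂ, 0 < z.im →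
    ev p (nome (-1 / (3 * z))) = (√3 * (-I * z)) ^ n * ev p (nome z)

/-- The theta series of a lattice. -/
def thetaS (H : Matrix (Fin n) (Fin n) Eis) : PowerSeries ℂ :=
  PowerSeries.mk fun m => (repN H m : ℂ)

lemma nome_pow_hnorm {H : Matrix (Fin n) (Fin n) Eis} (hH : PD H) (z : ℂ) (x : Fin n → Eis) :
    gh z (H.map toC) (toC ∘ x) = nome z ^ (hnorm H x).toNat := by
  rw [gh, hf_map_self hH.isHermitian, nome, ← Complex.exp_nat_mul]
  have h : (((hnorm H x).toNat : ℤ) : ℂ) = hnorm H x := by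
    rw [Int.toNat_of_nonneg (hnorm_nonneg hH x)]
  rw [← h]
  push_cast
  ring_nf

lemma card_norm_fiber {H : Matrix (Fin n) (Fin n) Eis} (hH : PD H) (m : ℕ) :
    Nat.card ((fun x => (hnorm H x).toNat) ⁻¹' {m}) = repN H m := by
  rw [Nat.card_coe_set_eq, repN]
  congr 1
  refine Set.ext fun x => ?_
  have := hnorm_nonneg hH x
  simp only [Set.mem_preimage, Set.mem_singleton_iff, Set.mem_ofPred_eq]
  omega

lemma summable_theta {H : Matrix (Fin n) (Fin n) Eis} (hH : PD H) {z : ℂ} (hz : 0 < z.im) :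
    Summable fun x : Fin n → Eis => ‖nome z ^ (hnorm H x).toNat‖ := by
  have := summable_gh (H := H.map toC) hH hz 0
  simp only [sub_zero] at this
  exact this.congr fun x => by rw [nome_pow_hnorm hH]

lemma hasSum_theta {H : Matrix (Fin n) (Fin n) Eis} (hH : PD H) {z : ℂ} (hz : 0 < z.im) :
    HasSum (fun m => (thetaS H).coeff m * nome z ^ m)
      (∑' x : Fin n → Eis, gh z (H.map toC) (toC ∘ x)) := by
  simp only [nome_pow_hnorm hH]
  have h := (summable_theta hH hz).of_norm.hasSum.tsum_fiberwise (fun x => (hnorm H x).toNat)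
  rw [show (fun m => (thetaS H).coeff m * nome z ^ m) = _ from funext fun m => ?_]
  · exact h
  rw [tsum_congr fun x : (fun x => (hnorm H x).toNat) ⁻¹' {m} =>
    congrArg (nome z ^ ·) (show (hnorm H x).toNat = m from x.2), tsum_const, card_norm_fiber hH]
  simp [thetaS]

lemma summable_thetaS {H : Matrix (Fin n) (Fin n) Eis} (hH : PD H) {z : ℂ} (hz : 0 < z.im) :
    Summable fun m => ‖(thetaS H).coeff m * nome z ^ m‖ := by
  have h := (summable_theta hH hz).hasSum.tsum_fiberwise (fun x => (hnorm H x).toNat)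
  refine h.summable.congr fun m => ?_
  rw [tsum_congr fun x : (fun x => (hnorm H x).toNat) ⁻¹' {m} =>
    congrArg (fun k => ‖nome z ^ k‖) (show (hnorm H x).toNat = m from x.2), tsum_const,
    card_norm_fiber hH]
  simp [thetaS]

lemma IsUL.bijective_vecMul {H : Matrix (Fin n) (Fin n) Eis} (hH : IsUL H) :
    Function.Bijective fun w : Fin n → Eis => w ᵥ* H := by
  have hu : IsUnit H.det := by rw [hH.det]; exact isUnit_one
  refine Function.bijective_iff_has_inverse.2 ⟨fun w => w ᵥ* H⁻¹, fun w => ?_, fun w => ?_⟩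
  · simp only [vecMul_vecMul, mul_nonsing_inv _ hu, vecMul_one]
  · simp only [vecMul_vecMul, nonsing_inv_mul _ hu, vecMul_one]

lemma IsUL.theta_transform {H : Matrix (Fin n) (Fin n) Eis} (hH : IsUL H) {z : ℂ}
    (hz : 0 < z.im) :
    ∑' x : Fin n → Eis, gh (-1 / (3 * z)) (H.map toC) (toC ∘ x) =
      (√3 * (-I * z)) ^ n * ∑' x : Fin n → Eis, gh z (H.map toC) (toC ∘ x) := by
  have h := theta_poisson n (H := H.map toC) hH.pd hz 0
  have h1 (x : Fin n → ℂ) : ekn x 0 = 1 := by simp [ekn, ek, pair]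
  have hd : (H.map toC).det = 1 := by
    rw [← RingHom.mapMatrix_apply, ← RingHom.map_det, hH.det, map_one]
  have hw : ((√3 : ℝ) * (-I * z) : ℂ) ≠ 0 :=
    mul_ne_zero (by exact_mod_cast (by positivity : √3 ≠ 0))
      (mul_ne_zero (neg_ne_zero.2 I_ne_zero) (by rintro rfl; simp at hz))
  simp only [h1, mul_one, sub_zero, hd, inv_one] at h
  rw [h, mul_inv_cancel_left₀ (pow_ne_zero _ hw),
    ← (Equiv.ofBijective _ hH.bijective_vecMul).tsum_eq (fun x => gh _ _⁻¹ (toC ∘ x))]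
  refine tsum_congr fun x => ?_
  have e : toC ∘ (x ᵥ* H) = (toC ∘ x) ᵥ* H.map toC := by
    funext i
    simp [vecMul, dotProduct]
  rw [Equiv.ofBijective_apply, e, gh, gh, hf_inv hH.pd]

theorem IsUL.isForm {H : Matrix (Fin n) (Fin n) Eis} (hH : IsUL H) : IsForm n (thetaS H) where
  summable q hq := by
    rcases eq_or_ne q 0 with rfl | h0
    · refine summable_of_ne_finset_zero (s := {0}) fun m hm => ?_
      rw [zero_pow (by simpa using hm), mul_zero, norm_zero]
    · obtain ⟨z, hz, rfl⟩ := exists_nome hq h0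
      exact summable_thetaS hH.pd hz
  transform z hz := by
    rw [ev, ev, (hasSum_theta hH.pd (neg_inv_im_pos hz)).tsum_eq, (hasSum_theta hH.pd hz).tsum_eq,
      hH.theta_transform hz]

lemma IsForm.add {p r : PowerSeries ℂ} (hp : IsForm n p) (hr : IsForm n r) : IsForm n (p + r) := by
  have h (q : ℂ) (hq : ‖q‖ < 1) : ev (p + r) q = ev p q + ev r q := by
    rw [ev, ev, ev, ← (hp.summable q hq).of_norm.tsum_add (hr.summable q hq).of_norm]
    exact tsum_congr fun m => by rw [map_add, add_mul]
  refine ⟨fun q hq => ?_, fun z hz => ?_⟩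
  · refine ((hp.summable q hq).add (hr.summable q hq)).of_nonneg_of_le (fun _ => norm_nonneg _)
      fun m => ?_
    rw [map_add, add_mul]
    exact norm_add_le _ _
  · rw [h _ (norm_nome_lt (neg_inv_im_pos hz)), h _ (norm_nome_lt hz), hp.transform z hz,
      hr.transform z hz, mul_add]

lemma ev_smul (c : ℂ) (p : PowerSeries ℂ) (q : ℂ) : ev (c • p) q = c * ev p q := by
  rw [ev, ev, ← tsum_mul_left]
  exact tsum_congr fun m => by rw [map_smul, smul_eq_mul, mul_assoc]

lemma IsForm.smul {p : PowerSeries ℂ} (hp : IsForm n p) (c : ℂ) : IsForm n (c • p) := by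
  refine ⟨fun q hq => ?_, fun z hz => ?_⟩
  · refine ((hp.summable q hq).mul_left ‖c‖).congr fun m => ?_
    rw [map_smul, smul_eq_mul, mul_assoc c, norm_mul c]
  · rw [ev_smul, ev_smul, hp.transform z hz, mul_left_comm]

lemma IsForm.sub {p r : PowerSeries ℂ} (hp : IsForm n p) (hr : IsForm n r) :
    IsForm n (p - r) := by
  rw [sub_eq_add_neg, ← neg_one_smul ℂ r]
  exact hp.add (hr.smul _)

lemma coeff_mul_mul_pow (p r : PowerSeries ℂ) (q : ℂ) (m : ℕ) :
    (p * r).coeff m * q ^ m = ∑ kl ∈ Finset.HasAntidiagonal.antidiagonal m,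
      (p.coeff kl.1 * q ^ kl.1) * (r.coeff kl.2 * q ^ kl.2) := by
  rw [PowerSeries.coeff_mul, Finset.sum_mul]
  refine Finset.sum_congr rfl fun kl hkl => ?_
  rw [← Finset.HasAntidiagonal.mem_antidiagonal.1 hkl, pow_add]
  ring

lemma ev_mul {p r : PowerSeries ℂ} {q : ℂ} (hp : Summable fun m => ‖p.coeff m * q ^ m‖)
    (hr : Summable fun m => ‖r.coeff m * q ^ m‖) : ev (p * r) q = ev p q * ev r q := by
  rw [ev, ev, ev, tsum_mul_tsum_eq_tsum_sum_antidiagonal_of_summable_norm hp hr]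
  exact tsum_congr fun m => coeff_mul_mul_pow p r q m

lemma IsForm.mul {k : ℕ} {p r : PowerSeries ℂ} (hp : IsForm n p) (hr : IsForm k r) :
    IsForm (n + k) (p * r) := by
  have h (q : ℂ) (hq : ‖q‖ < 1) := ev_mul (hp.summable q hq) (hr.summable q hq)
  refine ⟨fun q hq => ?_, fun z hz => ?_⟩
  · refine (summable_norm_sum_mul_antidiagonal_of_summable_norm (hp.summable q hq)
      (hr.summable q hq)).congr fun m => ?_
    rw [coeff_mul_mul_pow]
  · rw [h _ (norm_nome_lt (neg_inv_im_pos hz)), h _ (norm_nome_lt hz), hp.transform z hz,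
      hr.transform z hz, pow_add]
    ring

lemma ev_one (q : ℂ) : ev 1 q = 1 := by
  rw [ev, tsum_eq_single 0 fun m hm => by rw [PowerSeries.coeff_one, if_neg hm, zero_mul]]
  simp

lemma IsForm.one : IsForm 0 1 := by
  refine ⟨fun q hq => summable_of_ne_finset_zero (s := {0}) fun m hm => ?_, fun z hz => ?_⟩
  · rw [PowerSeries.coeff_one, if_neg (by simpa using hm), zero_mul, norm_zero]
  · simp [ev_one]

lemma IsForm.pow {p : PowerSeries ℂ} (hp : IsForm n p) (k : ℕ) : IsForm (k * n) (p ^ k) := by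
  induction k with
  | zero => simpa using IsForm.one
  | succ k ih => rw [pow_succ, add_mul, one_mul]; exact ih.mul hp

end

section
open scoped Real ComplexConjugate

variable {n : ℕ}

/-- The modular discriminant, as a function on `ℂ`. -/
def dl (z : ℂ) : ℂ := ModularForm.eta z ^ 24

lemma dl_ne_zero {z : ℂ} (hz : 0 < z.im) : dl z ≠ 0 := pow_ne_zero _ (ModularForm.eta_ne_zero hz)

lemma differentiableAt_dl {z : ℂ} (hz : 0 < z.im) : DifferentiableAt ℂ dl z :=
  (ModularForm.differentiableAt_eta_of_mem_upperHalfPlaneSet hz).pow 24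

lemma dl_add_one {z : ℂ} (hz : 0 < z.im) : dl (z + 1) = dl z := by
  have hz' : 0 < (z + 1).im := by simpa using hz
  have h1 := ModularForm.discriminant_eq_q_prod ⟨z, hz⟩
  have h2 := ModularForm.discriminant_eq_q_prod ⟨z + 1, hz'⟩
  have e : Function.Periodic.qParam 1 (z + 1) = Function.Periodic.qParam 1 z := by
    simp [Function.Periodic.qParam, mul_add, Complex.exp_add]
  have e' (m : ℕ) : ModularForm.eta_q m (z + 1) = ModularForm.eta_q m z := by
    rw [ModularForm.eta_q, ModularForm.eta_q, e]
  simp only [ModularForm.discriminant, e, e'] at h1 h2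
  rw [dl, dl, h1, h2]

lemma dl_add_nat {z : ℂ} (hz : 0 < z.im) (k : ℕ) : dl (z + k) = dl z := by
  induction k with
  | zero => simp
  | succ k ih => rw [Nat.cast_succ, ← add_assoc, dl_add_one (by simpa using hz), ih]

lemma csqrt_pow {z : ℂ} (hz : z ≠ 0) : Complex.sqrt z ^ 24 = z ^ 12 := by
  rw [sqrt_eq_exp hz, ← Complex.exp_nat_mul,
    show ((24 : ℕ) : ℂ) * (Complex.log z / 2) = (12 : ℕ) * Complex.log z by push_cast; ring,
    Complex.exp_nat_mul, Complex.exp_log hz]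

lemma dl_neg_inv {z : ℂ} (hz : 0 < z.im) : dl (-1 / z) = z ^ 12 * dl z := by
  have hz0 : z ≠ 0 := by rintro rfl; simp at hz
  have h : ModularForm.eta (-1 / z) = (Complex.sqrt I)⁻¹ * (Complex.sqrt z * ModularForm.eta z) :=
    ModularForm.eta_comp_eq_csqrt_I_inv hz
  have hI : (I : ℂ) ^ 12 = 1 := by rw [show 12 = 4 * 3 by rfl, pow_mul, I_pow_four, one_pow]
  rw [dl, h, mul_pow, mul_pow, inv_pow, csqrt_pow I_ne_zero, csqrt_pow hz0, hI, inv_one, one_mul,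
    dl]

lemma exists_nome_le_dl :
    ∃ C > (0 : ℝ), ∃ Y > (0 : ℝ), ∀ z : ℂ, Y ≤ z.im → ‖nome z‖ ≤ C * ‖dl z‖ := by
  obtain ⟨C, hC, h⟩ := ModularForm.exp_isBigO_discriminant.exists_pos
  obtain ⟨A, hA⟩ := (UpperHalfPlane.atImInfty_mem _).1 h.bound
  refine ⟨C, hC, max A 1, by positivity, fun z hz => ?_⟩
  have hz0 : 0 < z.im := lt_of_lt_of_le (by positivity) hz
  have := hA ⟨z, hz0⟩ ((le_max_left _ _).trans hz)
  simp only [Set.mem_ofPred_eq, Real.norm_eq_abs, Real.abs_exp] at this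
  rw [norm_nome, ← neg_mul]
  exact this

lemma differentiable_nome : Differentiable ℂ nome := by
  unfold nome
  fun_prop

lemma differentiableOn_ev {p : PowerSeries ℂ}
    (hp : ∀ q : ℂ, ‖q‖ < 1 → Summable fun m => ‖p.coeff m * q ^ m‖) :
    DifferentiableOn ℂ (ev p) (Metric.ball 0 1) := by
  intro q hq
  have hq : ‖q‖ < 1 := by simpa using hq
  obtain ⟨r, hr, hr1⟩ := exists_between hq
  have hr0 : 0 ≤ r := (norm_nonneg q).trans hr.le
  have h := Complex.differentiableOn_tsum_of_summable_norm (U := Metric.ball (0 : ℂ) r)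
    (F := fun m q => p.coeff m * q ^ m) (hp (r : ℂ) (by rwa [Complex.norm_of_nonneg hr0]))
    (fun m => by fun_prop) Metric.isOpen_ball (fun m w hw => by
      rw [norm_mul, norm_mul, norm_pow, norm_pow, Complex.norm_of_nonneg hr0]
      have hw : ‖w‖ < r := by simpa using hw
      gcongr)
  exact ((h q (by simpa using hr)).differentiableAt
    (Metric.isOpen_ball.mem_nhds (by simpa using hr))).differentiableWithinAt

lemma summable_shift {p : PowerSeries ℂ} (s : ℕ)
    (hp : ∀ q : ℂ, ‖q‖ < 1 → Summable fun m => ‖p.coeff m * q ^ m‖) (q : ℂ) (hq : ‖q‖ < 1) :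
    Summable fun m => ‖(PowerSeries.mk fun m => p.coeff (m + s)).coeff m * q ^ m‖ := by
  rcases eq_or_ne q 0 with rfl | h0
  · refine summable_of_ne_finset_zero (s := {0}) fun m hm => ?_
    rw [zero_pow (by simpa using hm), mul_zero, norm_zero]
  · refine (((summable_nat_add_iff s).2 (hp q hq)).mul_left ‖(q ^ s)⁻¹‖).congr fun m => ?_
    rw [← norm_mul, PowerSeries.coeff_mk, pow_add]
    congr 1
    field_simp

lemma ev_shift {p : PowerSeries ℂ} {s : ℕ} (h0 : ∀ m < s, p.coeff m = 0) {q : ℂ}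
    (hp : Summable fun m => ‖p.coeff m * q ^ m‖) :
    ev p q = q ^ s * ev (PowerSeries.mk fun m => p.coeff (m + s)) q := by
  rw [ev, ← hp.of_norm.sum_add_tsum_nat_add s, Finset.sum_eq_zero fun m hm => by
    rw [h0 m (Finset.mem_range.1 hm), zero_mul], zero_add, ev, ← tsum_mul_left]
  refine tsum_congr fun m => ?_
  rw [PowerSeries.coeff_mk, pow_add]
  ring

lemma exists_bound_ev {p : PowerSeries ℂ} {s : ℕ} (h0 : ∀ m < s, p.coeff m = 0)
    (hp : ∀ q : ℂ, ‖q‖ < 1 → Summable fun m => ‖p.coeff m * q ^ m‖) :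
    ∃ B > (0 : ℝ), ∀ q : ℂ, ‖q‖ ≤ 1 / 2 → ‖ev p q‖ ≤ B * ‖q‖ ^ s := by
  have hc := (differentiableOn_ev (summable_shift s hp)).continuousOn
  obtain ⟨B, hB⟩ := (isCompact_closedBall (0 : ℂ) (1 / 2)).exists_bound_of_continuousOn
    (hc.mono (Metric.closedBall_subset_ball (by norm_num)))
  refine ⟨max B 1, by positivity, fun q hq => ?_⟩
  rw [ev_shift h0 (hp q (by linarith)), norm_mul, norm_pow, mul_comm]
  gcongr
  exact (hB q (by simpa using hq)).trans (le_max_left _ _)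

lemma eq_zero_of_ev {p : PowerSeries ℂ}
    (hp : ∀ q : ℂ, ‖q‖ < 1 → Summable fun m => ‖p.coeff m * q ^ m‖)
    (h : ∀ q : ℂ, ‖q‖ < 1 → q ≠ 0 → ev p q = 0) : p = 0 := by
  by_contra hne
  have hs : ∃ s, p.coeff s ≠ 0 := by
    by_contra! hs
    exact hne (PowerSeries.ext fun m => by simp [hs m])
  classical
  have h0 : ∀ m < Nat.find hs, p.coeff m = 0 := fun m hm => by simpa using Nat.find_min hs hm
  set r : PowerSeries ℂ := PowerSeries.mk fun m => p.coeff (m + Nat.find hs) with hr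
  have hc : ContinuousAt (ev r) 0 := ((differentiableOn_ev (summable_shift _ hp)).continuousOn
    ).continuousAt (Metric.ball_mem_nhds _ one_pos)
  have h1 : ev r 0 = p.coeff (Nat.find hs) := by
    rw [ev, tsum_eq_single 0 fun m hm => by rw [zero_pow hm, mul_zero]]
    simp [hr]
  have h2 : ev r 0 = 0 := by
    refine tendsto_nhds_unique (f := ev r) (l := nhdsWithin 0 {0}ᶜ)
      (hc.tendsto.mono_left nhdsWithin_le_nhds) ?_
    refine tendsto_const_nhds.congr' ?_
    filter_upwards [self_mem_nhdsWithin,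
      nhdsWithin_le_nhds (Metric.ball_mem_nhds (0 : ℂ) one_pos)] with q hq0 hq1
    have hq1 : ‖q‖ < 1 := by simpa using hq1
    have := h q hq1 hq0
    rw [ev_shift h0 (hp q hq1)] at this
    exact ((mul_eq_zero.1 this).resolve_left (pow_ne_zero _ hq0)).symm
  exact Nat.find_spec hs (h1.symm.trans h2)

end

section
open scoped Real ComplexConjugate

variable {n : ℕ}

/-- A function on the upper half plane invariant under the Fricke group, attached to a form. -/
def phi (n : ℕ) (p : PowerSeries ℂ) (z : ℂ) : ℂ := ev p (nome z) ^ 24 / (dl z * dl (3 * z)) ^ n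

lemma three_mul_im_pos {z : ℂ} (hz : 0 < z.im) : 0 < (3 * z).im := by simpa using hz

lemma phi_fricke {p : PowerSeries ℂ} (hp : IsForm n p) {z : ℂ} (hz : 0 < z.im) :
    phi n p (-1 / (3 * z)) = phi n p z := by
  have hz0 : z ≠ 0 := by rintro rfl; simp at hz
  have e : (3 : ℂ) * (-1 / (3 * z)) = -1 / z := by field_simp
  have h1 := dl_ne_zero hz
  have h2 := dl_ne_zero (three_mul_im_pos hz)
  have h3 : ((√3 : ℝ) : ℂ) ^ 2 = 3 := by
    rw [← Complex.ofReal_pow, Real.sq_sqrt (by norm_num)]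
    norm_num
  have hw : (((√3 : ℝ) : ℂ) * (-I * z)) ^ 24 = (3 * z) ^ 12 * z ^ 12 := by
    have hI : (I : ℂ) ^ 24 = 1 := by rw [show 24 = 4 * 6 by rfl, pow_mul, I_pow_four, one_pow]
    calc (((√3 : ℝ) : ℂ) * (-I * z)) ^ 24 = (((√3 : ℝ) : ℂ) ^ 2) ^ 12 * I ^ 24 * z ^ 24 := by ring
      _ = _ := by rw [h3, hI]; ring
  rw [phi, phi, hp.transform z hz, e, dl_neg_inv (three_mul_im_pos hz), dl_neg_inv hz, mul_pow,
    ← pow_mul, mul_comm n, pow_mul, hw]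
  field_simp
  ring

lemma nome_add_int (z : ℂ) (k : ℤ) : nome (z + k) = nome z := by
  rw [nome, nome, mul_add, Complex.exp_add, mul_comm _ (k : ℂ), Complex.exp_int_mul_two_pi_mul_I,
    mul_one]

lemma dl_add_int {z : ℂ} (hz : 0 < z.im) (k : ℤ) : dl (z + k) = dl z := by
  obtain ⟨m, rfl | rfl⟩ := k.eq_nat_or_neg
  · exact_mod_cast dl_add_nat hz m
  · rw [← dl_add_nat (z := z + (-m : ℤ)) (by simpa using hz) m]
    simp

lemma phi_add_int (p : PowerSeries ℂ) {z : ℂ} (hz : 0 < z.im) (k : ℤ) :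
    phi n p (z + k) = phi n p z := by
  have h := dl_add_int (three_mul_im_pos hz) (3 * k)
  rw [phi, phi, nome_add_int, dl_add_int hz, mul_add]
  push_cast at h
  rw [h]

lemma differentiableOn_phi {p : PowerSeries ℂ} (hp : IsForm n p) :
    DifferentiableOn ℂ (phi n p) {z | 0 < z.im} := by
  intro z hz
  have hz : 0 < z.im := hz
  refine DifferentiableAt.differentiableWithinAt (DifferentiableAt.div ?_ ?_ ?_)
  · refine DifferentiableAt.fun_pow ?_ 24
    refine DifferentiableAt.comp (g := ev p) (f := nome) z ?_ differentiable_nome.differentiableAt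
    exact (differentiableOn_ev hp.summable).differentiableAt
      (Metric.isOpen_ball.mem_nhds (by simpa using norm_nome_lt hz))
  · refine (((differentiableAt_dl hz).fun_mul ?_).fun_pow n)
    exact DifferentiableAt.comp (g := dl) (f := fun z => 3 * z) z
      (differentiableAt_dl (three_mul_im_pos hz)) (by fun_prop)
  · exact pow_ne_zero _ (mul_ne_zero (dl_ne_zero hz) (dl_ne_zero (three_mul_im_pos hz)))

lemma norm_nome_three_mul (z : ℂ) : ‖nome (3 * z)‖ = ‖nome z‖ ^ 3 := by
  rw [norm_nome, norm_nome, ← Real.exp_nat_mul]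
  congr 1
  simp
  ring

lemma pow_estimate {s : ℕ} {f B q δ D : ℝ} (hf : 0 ≤ f) (hq : 0 ≤ q) (hq1 : q ≤ 1)
    (hδ : q ≤ δ) (h : f ≤ B * q ^ s) (hD : q ^ 4 ≤ D) (hs : n < 6 * s) :
    f ^ 24 ≤ B ^ 24 * (δ * D ^ n) :=
  calc f ^ 24 ≤ (B * q ^ s) ^ 24 := pow_le_pow_left₀ hf h _
    _ = B ^ 24 * q ^ (24 * s) := by rw [mul_pow, ← pow_mul, mul_comm s]
    _ ≤ B ^ 24 * q ^ (1 + 4 * n) :=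
        mul_le_mul_of_nonneg_left (pow_le_pow_of_le_one hq hq1 (by omega)) (by positivity)
    _ = B ^ 24 * (q * (q ^ 4) ^ n) := by rw [pow_add, pow_one, ← pow_mul]
    _ ≤ B ^ 24 * (δ * D ^ n) := by
        have := hq.trans hδ
        gcongr

lemma phi_small {p : PowerSeries ℂ} (hp : IsForm n p) {s : ℕ} (h0 : ∀ m < s, p.coeff m = 0)
    (hs : n < 6 * s) {ε : ℝ} (hε : 0 < ε) :
    ∃ Y : ℝ, ∀ z : ℂ, Y ≤ z.im → ‖phi n p z‖ < ε := by
  obtain ⟨C, hC, Y, hY, h⟩ := exists_nome_le_dl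
  obtain ⟨B, hB, hb⟩ := exists_bound_ev h0 hp.summable
  obtain ⟨K, hK⟩ : ∃ K, K = B ^ 24 * (C * C) ^ n := ⟨_, rfl⟩
  have hK0 : 0 < K := by rw [hK]; positivity
  obtain ⟨δ, hδ0, hδ1, hδ⟩ : ∃ δ > 0, δ ≤ 1 / 2 ∧ K * δ < ε :=
    ⟨min (1 / 2) (ε / (2 * K)), by positivity, min_le_left _ _,
      (mul_le_mul_of_nonneg_left (min_le_right _ _) hK0.le).trans_lt (by field_simp; linarith)⟩
  refine ⟨max Y (-Real.log δ / (2 * π)), fun z hz => ?_⟩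
  have hz1 := (le_max_left _ _).trans hz
  have hz0 : 0 < z.im := hY.trans_le hz1
  have hq : ‖nome z‖ ≤ δ := by
    rw [norm_nome, ← Real.le_log_iff_exp_le hδ0]
    have := (le_max_right _ _).trans hz
    rw [div_le_iff₀ (by positivity)] at this
    linarith
  have hq0 : 0 < ‖nome z‖ := norm_pos_iff.2 (Complex.exp_ne_zero _)
  have h1 := hb _ (hq.trans hδ1)
  have h2 := h z hz1
  have h3 := h (3 * z) (by simp; linarith)
  rw [norm_nome_three_mul] at h3
  have hd : 0 < ‖dl z‖ * ‖dl (3 * z)‖ :=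
    mul_pos (norm_pos_iff.2 (dl_ne_zero hz0)) (norm_pos_iff.2 (dl_ne_zero (three_mul_im_pos hz0)))
  have h4 : ‖nome z‖ ^ 4 ≤ C * C * (‖dl z‖ * ‖dl (3 * z)‖) := by
    have := mul_le_mul h2 h3 (pow_nonneg hq0.le 3) (hq0.le.trans h2)
    rwa [← pow_succ', mul_mul_mul_comm] at this
  refine lt_of_le_of_lt ?_ hδ
  rw [phi, norm_div, norm_pow, norm_pow, norm_mul, div_le_iff₀ (pow_pos hd n)]
  rw [show K * δ * (‖dl z‖ * ‖dl (3 * z)‖) ^ n = B ^ 24 * (δ * (C * C *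
    (‖dl z‖ * ‖dl (3 * z)‖)) ^ n) by rw [hK, mul_pow (C * C), mul_left_comm δ, mul_assoc (B ^ 24),
      mul_assoc (B ^ 24), mul_assoc _ δ]]
  exact pow_estimate (norm_nonneg _) hq0.le (hq.trans (by linarith)) hq h1 h4 hs

lemma exists_reduced {p : PowerSeries ℂ} (hp : IsForm n p) (k : ℕ) :
    ∀ z : ℂ, 0 < z.im → 1 / 5 * (7 / 8) ^ k ≤ z.im →
      ∃ z' : ℂ, 1 / 5 ≤ z'.im ∧ |z'.re| ≤ 1 / 2 ∧ phi n p z' = phi n p z := by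
  induction k with
  | zero =>
    intro z hz hk
    refine ⟨z + (-round z.re : ℤ), by simpa using hk, ?_, phi_add_int p hz _⟩
    simpa [← sub_eq_add_neg] using abs_sub_round z.re
  | succ k ih =>
    intro z hz hk
    set w : ℂ := z + (-round z.re : ℤ) with hw
    have hwi : w.im = z.im := by simp [hw]
    have hwr : |w.re| ≤ 1 / 2 := by simpa [hw, ← sub_eq_add_neg] using abs_sub_round z.re
    have hwp : phi n p w = phi n p z := phi_add_int p hz _
    rcases le_or_gt (1 / 5) z.im with h5 | h5
    · exact ⟨w, hwi ▸ h5, hwr, hwp⟩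
    · rw [← hwi] at hz hk h5
      rw [← hwp, ← phi_fricke hp hz]
      refine ih _ (neg_inv_im_pos hz) ?_
      have e : (-1 / (3 * w)).im = w.im / (3 * normSq w) := by
        rw [neg_div, neg_im, one_div, Complex.inv_im, Complex.normSq_mul]
        have : normSq w ≠ 0 := fun h => by simp [normSq_eq_zero.1 h] at hz
        simp
        field_simp
      have hn : 3 * normSq w ≤ 7 / 8 := by
        rw [normSq_apply]
        have := abs_le.1 hwr
        nlinarith
      have hn0 : 0 < 3 * normSq w := by
        rw [normSq_apply]
        nlinarith [mul_self_nonneg w.re, mul_pos hz hz]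
      rw [e, le_div_iff₀ hn0]
      calc 1 / 5 * (7 / 8) ^ k * (3 * normSq w) ≤ 1 / 5 * (7 / 8) ^ k * (7 / 8) := by gcongr
        _ = 1 / 5 * (7 / 8) ^ (k + 1) := by ring
        _ ≤ w.im := hk

/-- A form vanishing to sufficiently high order at infinity is zero. -/
theorem IsForm.eq_zero {p : PowerSeries ℂ} (hp : IsForm n p) {s : ℕ}
    (h0 : ∀ m < s, p.coeff m = 0) (hs : n < 6 * s) : p = 0 := by
  have hred (z : ℂ) (hz : 0 < z.im) :
      ∃ z' : ℂ, 1 / 5 ≤ z'.im ∧ |z'.re| ≤ 1 / 2 ∧ phi n p z' = phi n p z := by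
    obtain ⟨k, hk⟩ := exists_pow_lt_of_lt_one (y := (7 / 8 : ℝ)) (mul_pos (by norm_num : (0:ℝ) < 5) hz)
      (by norm_num)
    exact exists_reduced hp k z hz (by linarith)
  have key (z : ℂ) (hz : 0 < z.im) : phi n p z = 0 := by
    by_contra hne
    obtain ⟨w, hw1, hw2, hw⟩ := hred z hz
    rw [← hw] at hne
    have hpos := norm_pos_iff.2 hne
    obtain ⟨Y, hY⟩ := phi_small hp h0 hs hpos
    set K : Set ℂ := Set.Icc (-(1 / 2)) (1 / 2) ×ℂ Set.Icc (1 / 5) (max Y w.im) with hK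
    have hKc : IsCompact K := isCompact_Icc.reProdIm isCompact_Icc
    have hwK : w ∈ K := ⟨abs_le.1 hw2, hw1, le_max_right _ _⟩
    have hd := differentiableOn_phi hp
    obtain ⟨c, hc, hmax⟩ := hKc.exists_isMaxOn ⟨w, hwK⟩ (f := fun z => ‖phi n p z‖)
      (hd.continuousOn.mono fun z hz => lt_of_lt_of_le (by norm_num) hz.2.1).norm
    have hmax' : IsMaxOn (norm ∘ phi n p) {z | 0 < z.im} c := by
      intro u hu
      obtain ⟨v, hv1, hv2, hv⟩ := hred u hu
      show ‖phi n p u‖ ≤ ‖phi n p c‖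
      rw [← hv]
      rcases le_or_gt v.im (max Y w.im) with h | h
      · exact hmax ⟨abs_le.1 hv2, hv1, h⟩
      · exact (hY v ((le_max_left _ _).trans h.le)).le.trans (hmax hwK)
    have hc0 : 0 < c.im := lt_of_lt_of_le (by norm_num) hc.2.1
    have hcon := Complex.eqOn_of_isPreconnected_of_isMaxOn_norm
      (convex_halfSpace_im_gt 0).isPreconnected UpperHalfPlane.isOpen_upperHalfPlaneSet hd hc0 hmax'
    have h1 : phi n p w = phi n p c := hcon (lt_of_lt_of_le (by norm_num) hw1)
    have h2 : phi n p (max Y 1 * I) = phi n p c := hcon (by simp)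
    have h3 := hY (max Y 1 * I) (by simp)
    rw [h2, h1] at h3
    exact lt_irrefl _ h3
  refine eq_zero_of_ev hp.summable fun q hq hq0 => ?_
  obtain ⟨z, hz, rfl⟩ := exists_nome hq hq0
  have h := key z hz
  rw [phi, div_eq_zero_iff] at h
  refine pow_eq_zero_iff (by norm_num : 24 ≠ 0) |>.1 (h.resolve_right ?_)
  exact pow_ne_zero _ (mul_ne_zero (dl_ne_zero hz) (dl_ne_zero (three_mul_im_pos hz)))

end

section
open scoped Real ComplexConjugate MatrixGroups ModularForm
open UpperHalfPlane hiding I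

variable {n : ℕ}

/-- The normalised Eisenstein series of weight six and level one, as a power series. -/
def eis6 : PowerSeries ℂ :=
  PowerSeries.mk fun m => if m = 0 then 1 else -504 * (ArithmeticFunction.sigma 5 m : ℂ)

lemma bernoulli_six : bernoulli 6 = 1 / 42 := by
  rw [bernoulli_eq_bernoulli'_of_ne_one (by norm_num), bernoulli'_def]
  norm_num [Finset.sum_range_succ, bernoulli'_eq_zero_of_odd, bernoulli'_zero, Nat.choose,
    show bernoulli' 5 = 0 from bernoulli'_eq_zero_of_odd (by decide) (by norm_num)]

lemma summable_norm_eis6 {q : ℂ} (hq : ‖q‖ < 1) : Summable fun m => ‖eis6.coeff m * q ^ m‖ := by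
  have h := (summable_norm_pow_mul_geometric_of_norm_lt_one 6 hq).mul_left 505
  refine Summable.of_nonneg_of_le (fun m => norm_nonneg _) (fun m => ?_)
    (h.add (summable_geometric_of_lt_one (norm_nonneg q) hq))
  rw [eis6, PowerSeries.coeff_mk, norm_mul, norm_mul, norm_pow, norm_pow, Complex.norm_natCast]
  have hqm : 0 ≤ ‖q‖ ^ m := by positivity
  split_ifs with h0
  · subst h0; simp
  · have h1 : ((ArithmeticFunction.sigma 5 m : ℕ) : ℝ) ≤ (m : ℝ) ^ 6 := by
      exact_mod_cast ArithmeticFunction.sigma_le_pow_succ 5 m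
    rw [norm_mul, Complex.norm_natCast]
    norm_num
    nlinarith [mul_le_mul_of_nonneg_right h1 hqm, mul_nonneg (pow_nonneg (Nat.cast_nonneg (α := ℝ) m) 6) hqm]

lemma ev_eis6 {z : ℂ} (hz : 0 < z.im) :
    ev eis6 (nome z) = ModularForm.E (k := 6) (by norm_num) ⟨z, hz⟩ := by
  have h := EisensteinSeries.q_expansion_bernoulli (k := 6) (by norm_num) (by decide) ⟨z, hz⟩
  simp_rw [zpow_natCast] at h
  rw [h, tsum_pnat_eq_tsum_succ
    (f := fun n ↦ (ArithmeticFunction.sigma 5 n : ℂ) * cexp (2 * π * I * z) ^ n), ev,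
    (summable_norm_eis6 (norm_nome_lt hz)).of_norm.tsum_eq_zero_add, bernoulli_six,
    ← tsum_mul_left, sub_eq_add_neg, ← tsum_neg]
  congr 1
  · simp [eis6]
  · refine tsum_congr fun m => ?_
    rw [eis6, PowerSeries.coeff_mk, if_neg (Nat.succ_ne_zero m), nome]
    push_cast
    ring

lemma E6_neg_inv {z : ℂ} (hz : 0 < z.im) (hz' : 0 < (-1 / z).im) :
    ModularForm.E (k := 6) (by norm_num) ⟨-1 / z, hz'⟩ =
      z ^ 6 * ModularForm.E (k := 6) (by norm_num) ⟨z, hz⟩ := by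
  have hS : (Matrix.SpecialLinearGroup.mapGL ℝ ModularGroup.S) ∈ 𝒮ℒ := ⟨_, rfl⟩
  have h1 := SlashInvariantForm.slash_action_eqn (ModularForm.E (k := 6) (by norm_num)) _ hS
  have h2 := congrFun h1 ⟨z, hz⟩
  have h3 := SlashInvariantForm.slash_S_apply (ModularForm.E (k := 6) (by norm_num)) (6 : ℕ) ⟨z, hz⟩
  rw [ModularForm.SL_slash] at h3
  have h4 := h3.symm.trans h2
  rw [← h4]
  have e : (⟨-1 / z, hz'⟩ : ℍ) = .mk _ (UpperHalfPlane.im_inv_neg_coe_pos ⟨z, hz⟩) := by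
    ext; simp [neg_div, inv_neg]
  have hz0 : z ≠ 0 := by rintro rfl; simp at hz
  rw [e]
  show _ = z ^ 6 * (_ * z ^ (-6 : ℤ))
  rw [mul_left_comm, ← zpow_natCast, ← zpow_add₀ hz0]
  simp

/-- The substitution `q ↦ q³` on power series. -/
def cubeSubst (p : PowerSeries ℂ) : PowerSeries ℂ :=
  PowerSeries.mk fun m => if 3 ∣ m then p.coeff (m / 3) else 0

lemma cubeSubst_coeff_mul (p : PowerSeries ℂ) (q : ℂ) (m : ℕ) :
    (cubeSubst p).coeff (3 * m) * q ^ (3 * m) = p.coeff m * (q ^ 3) ^ m := by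
  simp [cubeSubst, pow_mul]

lemma cubeSubst_coeff_eq_zero (p : PowerSeries ℂ) {m : ℕ}
    (h : m ∉ Set.range fun k : ℕ => 3 * k) : (cubeSubst p).coeff m = 0 := by
  rw [cubeSubst, PowerSeries.coeff_mk, if_neg]
  rintro ⟨k, rfl⟩
  exact h ⟨k, rfl⟩

lemma injective_three_mul : Function.Injective fun k : ℕ => 3 * k := fun a b h => by
  simpa using h

lemma ev_cubeSubst (p : PowerSeries ℂ) (q : ℂ) : ev (cubeSubst p) q = ev p (q ^ 3) := by
  rw [ev, ev, ← injective_three_mul.tsum_eq]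
  · exact tsum_congr fun m => cubeSubst_coeff_mul p q m
  · intro m hm
    by_contra h
    exact hm (by simp [cubeSubst_coeff_eq_zero p h])

lemma summable_norm_cubeSubst {p : PowerSeries ℂ} {q : ℂ}
    (h : Summable fun m => ‖p.coeff m * (q ^ 3) ^ m‖) :
    Summable fun m => ‖(cubeSubst p).coeff m * q ^ m‖ := by
  rw [← injective_three_mul.summable_iff]
  · exact h.congr fun m => by simp only [Function.comp, cubeSubst_coeff_mul]
  · intro m hm
    simp [cubeSubst_coeff_eq_zero p hm]

lemma nome_pow_three (z : ℂ) : nome z ^ 3 = nome (3 * z) := by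
  rw [nome, nome, ← Complex.exp_nat_mul]
  congr 1
  push_cast
  ring

/-- The Eisenstein series of weight six for the Fricke group of level three. -/
def frickeEis : PowerSeries ℂ := (27 / 26 : ℂ) • cubeSubst eis6 - (1 / 26 : ℂ) • eis6

lemma isForm_frickeEis : IsForm 6 frickeEis := by
  have hq3 {q : ℂ} (hq : ‖q‖ < 1) : ‖q ^ 3‖ < 1 := by
    rw [norm_pow]; exact pow_lt_one₀ (norm_nonneg _) hq (by norm_num)
  have hs {q : ℂ} (hq : ‖q‖ < 1) := summable_norm_cubeSubst (summable_norm_eis6 (hq3 hq))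
  have hev {z : ℂ} (hz : 0 < z.im) : ev frickeEis (nome z) =
      27 / 26 * ev eis6 (nome (3 * z)) - 1 / 26 * ev eis6 (nome z) := by
    rw [← nome_pow_three, ← ev_cubeSubst, ← ev_smul, ← ev_smul, frickeEis, ev, ev, ev,
      ← Summable.tsum_sub]
    · exact tsum_congr fun m => by rw [map_sub, sub_mul]
    · exact ((hs (norm_nome_lt hz)).of_norm.mul_left (27 / 26)).congr fun m => by
        rw [PowerSeries.coeff_smul, smul_eq_mul, mul_assoc]
    · exact ((summable_norm_eis6 (norm_nome_lt hz)).of_norm.mul_left (1 / 26)).congr fun m => by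
        rw [PowerSeries.coeff_smul, smul_eq_mul, mul_assoc]
  refine ⟨fun q hq => ?_, fun z hz => ?_⟩
  · refine Summable.of_nonneg_of_le (fun m => norm_nonneg _) (fun m => ?_)
      (((hs hq).mul_left (27 / 26)).add ((summable_norm_eis6 hq).mul_left (1 / 26)))
    rw [frickeEis, map_sub, sub_mul, PowerSeries.coeff_smul, PowerSeries.coeff_smul, smul_eq_mul,
      smul_eq_mul, mul_assoc, mul_assoc]
    refine (norm_sub_le _ _).trans (le_of_eq ?_)
    rw [norm_mul, norm_mul (1 / 26 : ℂ)]
    norm_num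
  · have hz0 : z ≠ 0 := by rintro rfl; simp at hz
    have hz3 : 0 < (3 * z).im := three_mul_im_pos hz
    have hw : 0 < (-1 / (3 * z)).im := neg_inv_im_pos hz
    have e1 : 3 * (-1 / (3 * z)) = -1 / z := by field_simp
    have hw' : 0 < (-1 / z).im := e1 ▸ three_mul_im_pos hw
    have hI : (√3 * (-I * z)) ^ 6 = -27 * z ^ 6 := by
      have h3 : ((√3 : ℝ) : ℂ) ^ 2 = 3 := by
        rw [← Complex.ofReal_pow, Real.sq_sqrt (by norm_num)]; norm_num
      calc ((√3 : ℝ) * (-I * z) : ℂ) ^ 6 = (((√3 : ℝ) : ℂ) ^ 2) ^ 3 * (I ^ 2) ^ 3 * z ^ 6 := by ring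
        _ = _ := by rw [h3, I_sq]; ring
    rw [hev hw, hev hz, e1, hI, ev_eis6 hw', ev_eis6 hw, ev_eis6 hz, ev_eis6 hz3,
      E6_neg_inv hz, E6_neg_inv hz3]
    ring

end

section
open scoped Real ComplexConjugate

variable {n : ℕ}

lemma isUL_one : IsUL (1 : Matrix (Fin n) (Fin n) Eis) := by
  refine ⟨?_, det_one⟩
  rw [PD, Matrix.map_one _ (map_zero _) (map_one _)]
  exact PosDef.one

lemma repN_one (m : ℕ) : repN (1 : Matrix (Fin 1) (Fin 1) Eis) m = {x : Eis | nrm x = m}.ncard := by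
  rw [repN, ← Set.ncard_image_of_injective _ (Equiv.funUnique (Fin 1) Eis).injective]
  congr 1
  ext x
  simp only [Set.mem_image, Set.mem_ofPred_eq]
  constructor
  · rintro ⟨y, hy, rfl⟩
    rw [← hy]
    simp [hnorm, hf, dotProduct, mul_star_self]
  · intro hx
    refine ⟨fun _ => x, ?_, rfl⟩
    rw [← hx]
    simp [hnorm, hf, dotProduct, mul_star_self]

lemma nrm_card {m : ℕ} (hm : m < 9) : {x : Eis | nrm x = m}.ncard =
    (((Finset.Icc (-3 : ℤ) 3) ×ˢ (Finset.Icc (-3 : ℤ) 3)).filter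
      fun p : ℤ × ℤ => p.1 * p.1 - p.1 * p.2 + p.2 * p.2 = m).card := by
  rw [← Set.ncard_coe_finset]
  refine Set.ncard_congr (fun x _ => (x.re, x.im)) ?_ ?_ ?_
  · intro x hx
    simp only [Set.mem_ofPred_eq, nrm] at hx
    simp only [Finset.coe_filter, Finset.mem_product, Finset.mem_Icc, Set.mem_ofPred_eq]
    have hm' : (m : ℤ) < 9 := by exact_mod_cast hm
    refine ⟨⟨⟨?_, ?_⟩, ⟨?_, ?_⟩⟩, by linarith⟩
    · nlinarith [sq_nonneg (2 * x.im - x.re)]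
    · nlinarith [sq_nonneg (2 * x.im - x.re)]
    · nlinarith [sq_nonneg (2 * x.re - x.im)]
    · nlinarith [sq_nonneg (2 * x.re - x.im)]
  · intro x y _ _ h
    exact QuadraticAlgebra.ext (congrArg Prod.fst h) (congrArg Prod.snd h)
  · rintro ⟨a, b⟩ h
    simp only [Finset.coe_filter, Set.mem_ofPred_eq] at h
    exact ⟨⟨a, b⟩, by simp only [Set.mem_ofPred_eq, nrm]; linarith [h.2], rfl⟩

/-- The first nine coefficients of `p` are the entries of the list `l`. -/
def Trunc (p : PowerSeries ℂ) (l : List ℤ) : Prop := ∀ m < 9, p.coeff m = (l.getD m 0 : ℤ)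

/-- Truncated product of power series given by lists of coefficients. -/
def truncMul (l k : List ℤ) : List ℤ :=
  (List.range 9).map fun m =>
    ((List.range (m + 1)).map fun i => l.getD i 0 * k.getD (m - i) 0).sum

lemma Trunc.mul {p r : PowerSeries ℂ} {l k j : List ℤ} (hp : Trunc p l) (hr : Trunc r k)
    (h : truncMul l k = j) : Trunc (p * r) j := by
  intro m hm
  subst h
  rw [PowerSeries.coeff_mul, Finset.Nat.sum_antidiagonal_eq_sum_range_succ_mk, truncMul,
    List.getD_eq_getElem _ _ (by simpa using hm), List.getElem_map, List.getElem_range,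
    ← List.sum_toFinset _ List.nodup_range, List.toFinset_range, Int.cast_sum]
  refine Finset.sum_congr rfl fun i hi => ?_
  have := Finset.mem_range.1 hi
  rw [hp i (by omega), hr (m - i) (by omega), Int.cast_mul]

/-- The theta series of the lattice of rank one. -/
def hexTheta : PowerSeries ℂ := thetaS (1 : Matrix (Fin 1) (Fin 1) Eis)

lemma isForm_hexTheta_pow (n : ℕ) : IsForm n (hexTheta ^ n) := by
  have h := (isUL_one (n := 1)).isForm.pow n
  rwa [mul_one] at h

lemma trunc_hexTheta : Trunc hexTheta [1, 6, 0, 6, 6, 0, 0, 12, 0] := by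
  intro m hm
  rw [hexTheta, thetaS, PowerSeries.coeff_mk, repN_one, nrm_card hm, ← Int.cast_natCast]
  refine congrArg _ ?_
  revert m
  decide +kernel

/-- The first nine coefficients of the powers of `hexTheta`. -/
def hexList : ℕ → List ℤ
  | 0 => [1]
  | n + 1 => truncMul (hexList n) [1, 6, 0, 6, 6, 0, 0, 12, 0]

lemma trunc_hexTheta_pow : ∀ n : ℕ, Trunc (hexTheta ^ n) (hexList n)
  | 0 => fun m _ => by cases m <;> simp [PowerSeries.coeff_one, hexList]
  | n + 1 => (trunc_hexTheta_pow n).mul trunc_hexTheta rfl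

/-- The cusp form of weight six for the Fricke group of level three. -/
def cuspSix : PowerSeries ℂ := (13 / 216 : ℂ) • (hexTheta ^ 6 - frickeEis)

lemma isForm_cuspSix : IsForm 6 cuspSix := ((isForm_hexTheta_pow 6).sub isForm_frickeEis).smul _

lemma trunc_cuspSix : Trunc cuspSix [0, 1, -6, 9, 4, 6, -54, -40, 168] := by
  intro m hm
  rw [cuspSix, PowerSeries.coeff_smul, map_sub, trunc_hexTheta_pow 6 m hm,
    show hexList 6 = [1, 36, 540, 4356, 20556, 60696, 137916, 325152, 658476] by decide +kernel, frickeEis, map_sub,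
    PowerSeries.coeff_smul, PowerSeries.coeff_smul, cubeSubst, eis6]
  simp only [PowerSeries.coeff_mk, smul_eq_mul]
  have s1 : ArithmeticFunction.sigma 5 1 = 1 := by decide +kernel
  have s2 : ArithmeticFunction.sigma 5 2 = 33 := by decide +kernel
  have s3 : ArithmeticFunction.sigma 5 3 = 244 := by decide +kernel
  have s4 : ArithmeticFunction.sigma 5 4 = 1057 := by decide +kernel
  have s5 : ArithmeticFunction.sigma 5 5 = 3126 := by decide +kernel
  have s6 : ArithmeticFunction.sigma 5 6 = 8052 := by decide +kernel
  have s7 : ArithmeticFunction.sigma 5 7 = 16808 := by decide +kernel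
  have s8 : ArithmeticFunction.sigma 5 8 = 33825 := by decide +kernel
  interval_cases m <;> norm_num [s1, s2, s3, s4, s5, s6, s7, s8]

end

section
open scoped Real ComplexConjugate

variable {n : ℕ}

lemma repN_zero {H : Matrix (Fin n) (Fin n) Eis} (hH : PD H) : repN H 0 = 1 := by
  rw [repN, Set.ncard_eq_one]
  refine ⟨0, Set.eq_singleton_iff_unique_mem.2 ⟨hnorm_zero H, fun x hx => ?_⟩⟩
  by_contra h
  exact (hnorm_pos hH h).ne' hx

lemma coeff_thetaS (H : Matrix (Fin n) (Fin n) Eis) (m : ℕ) :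
    (thetaS H).coeff m = (repN H m : ℂ) := by rw [thetaS, PowerSeries.coeff_mk]

lemma IsForm.ext {p r : PowerSeries ℂ} (hp : IsForm n p) (hr : IsForm n r) {s : ℕ}
    (h : ∀ m < s, p.coeff m = r.coeff m) (hs : n < 6 * s) : p = r :=
  sub_eq_zero.1 <| (hp.sub hr).eq_zero (fun m hm => by rw [map_sub, h m hm, sub_self]) hs

/-- A list of integers as a sequence. -/
abbrev ent (l : List ℤ) (m : ℕ) : ℚ := (l.getD m 0 : ℤ)

lemma Trunc.coeff {p : PowerSeries ℂ} {l : List ℤ} (h : Trunc p l) {m : ℕ} (hm : m < 9) :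
    p.coeff m = ((ent l m : ℚ) : ℂ) := by
  rw [h m hm, ent]; push_cast; rfl

variable {f g h : PowerSeries ℂ} {lf lg lh : List ℤ}

lemma wrep_eq_of_one (hf : IsForm n f) (tf : Trunc f lf) (f0 : ent lf 0 = 1) (hn : n < 6)
    {m : ℕ} (hm : m < 9) : wrep n m = ent lf m * mass n := by
  rw [wrep, mass, Finset.mul_sum]
  refine Finset.sum_congr rfl fun c _ => ?_
  have e : thetaS c.rep = f := c.isUL.isForm.ext hf (s := 1) (fun k hk => ?_) hn
  · have := congrArg (PowerSeries.coeff m) e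
    rw [coeff_thetaS, tf.coeff hm] at this
    rw [show (repN c.rep m : ℚ) = ent lf m by exact_mod_cast this, mul_comm]
  · obtain rfl : k = 0 := by omega
    rw [coeff_thetaS, tf.coeff (by norm_num), f0, Nat.cast_zero, repN_zero c.isUL.pd]
    norm_num

lemma wrep_eq_of_two (hf : IsForm n f) (tf : Trunc f lf) (f0 : ent lf 0 = 1)
    (hg : IsForm n g) (tg : Trunc g lg) (g0 : ent lg 0 = 0) (g1 : ent lg 1 = 1) (hn : n < 12)
    {m : ℕ} (hm : m < 9) :
    wrep n m = ent lf m * mass n + ent lg m * (wrep n 1 - ent lf 1 * mass n) := by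
  rw [wrep, wrep, mass, Finset.mul_sum, Finset.mul_sum, ← Finset.sum_sub_distrib, Finset.mul_sum,
    ← Finset.sum_add_distrib]
  refine Finset.sum_congr rfl fun c _ => ?_
  have e : thetaS c.rep = f + ((((repN c.rep 1 : ℚ) - ent lf 1 : ℚ)) : ℂ) • g :=
    c.isUL.isForm.ext (hf.add (hg.smul _)) (s := 2) (fun k hk => ?_) hn
  · have := congrArg (PowerSeries.coeff m) e
    rw [coeff_thetaS, map_add, PowerSeries.coeff_smul, tf.coeff hm, tg.coeff hm, smul_eq_mul] at this
    rw [show (repN c.rep m : ℚ) = ent lf m + (repN c.rep 1 - ent lf 1) * ent lg m by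
      exact_mod_cast this]
    ring
  · rw [coeff_thetaS, map_add, PowerSeries.coeff_smul, tf.coeff (by omega), tg.coeff (by omega),
      smul_eq_mul]
    interval_cases k
    · rw [f0, g0, Nat.cast_zero, repN_zero c.isUL.pd]; norm_num
    · rw [g1, Nat.cast_one]; push_cast; ring

lemma wrep_eq_of_three (hf : IsForm n f) (tf : Trunc f lf) (f0 : ent lf 0 = 1)
    (hg : IsForm n g) (tg : Trunc g lg) (g0 : ent lg 0 = 0) (g1 : ent lg 1 = 1)
    (hh : IsForm n h) (th : Trunc h lh) (h0 : ent lh 0 = 0) (h1 : ent lh 1 = 0)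
    (h2 : ent lh 2 = 1) (hn : n < 18) {m : ℕ} (hm : m < 9) :
    wrep n m = ent lf m * mass n + ent lg m * (wrep n 1 - ent lf 1 * mass n) +
      ent lh m * (wrep n 2 - ent lf 2 * mass n - ent lg 2 * (wrep n 1 - ent lf 1 * mass n)) := by
  simp only [wrep, mass, Finset.mul_sum, ← Finset.sum_sub_distrib, ← Finset.sum_add_distrib]
  refine Finset.sum_congr rfl fun c _ => ?_
  obtain ⟨u, hu⟩ : ∃ u : ℚ, u = (repN c.rep 1 : ℚ) - ent lf 1 := ⟨_, rfl⟩
  obtain ⟨v, hv⟩ : ∃ v : ℚ, v = (repN c.rep 2 : ℚ) - ent lf 2 - ent lg 2 * u := ⟨_, rfl⟩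
  have e : thetaS c.rep = f + (u : ℂ) • g + (v : ℂ) • h :=
    c.isUL.isForm.ext ((hf.add (hg.smul _)).add (hh.smul _)) (s := 3) (fun k hk => ?_) hn
  · have := congrArg (PowerSeries.coeff m) e
    rw [coeff_thetaS, map_add, map_add, PowerSeries.coeff_smul, PowerSeries.coeff_smul,
      tf.coeff hm, tg.coeff hm, th.coeff hm, smul_eq_mul, smul_eq_mul] at this
    rw [show (repN c.rep m : ℚ) = ent lf m + u * ent lg m + v * ent lh m by
      exact_mod_cast this, hv, hu]
    ring
  · rw [coeff_thetaS, map_add, map_add, PowerSeries.coeff_smul, PowerSeries.coeff_smul,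
      tf.coeff (by omega), tg.coeff (by omega), th.coeff (by omega), smul_eq_mul, smul_eq_mul]
    interval_cases k
    · rw [f0, g0, h0, Nat.cast_zero, repN_zero c.isUL.pd]; norm_num
    · rw [g1, h1, hu, Nat.cast_one]; push_cast; ring
    · rw [h2, hv, hu, Nat.cast_ofNat]; push_cast; ring

end

section

variable {n : ℕ}

/-- The first nine coefficients of `cuspSix`. -/
def cuspList : List ℤ := [0, 1, -6, 9, 4, 6, -54, -40, 168]

/-- The first nine coefficients of `cuspSix ^ 2`. -/
def cuspSqList : List ℤ := [0, 0, 1, -12, 54, -100, 45, -108, 692]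

lemma trunc_cuspSix_sq : Trunc (cuspSix ^ 2) cuspSqList := by
  rw [sq]
  exact trunc_cuspSix.mul trunc_cuspSix (by decide +kernel)

lemma isForm_hexTheta_mul_cuspSix (k : ℕ) : IsForm (k + 6) (hexTheta ^ k * cuspSix) :=
  (isForm_hexTheta_pow k).mul isForm_cuspSix

lemma isForm_hexTheta_mul_cuspSix_sq (k : ℕ) : IsForm (k + 12) (hexTheta ^ k * cuspSix ^ 2) :=
  (isForm_hexTheta_pow k).mul (isForm_cuspSix.pow 2)

lemma trunc_hexTheta_mul_cuspSix (k : ℕ) :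
    Trunc (hexTheta ^ k * cuspSix) (truncMul (hexList k) cuspList) :=
  (trunc_hexTheta_pow k).mul trunc_cuspSix rfl

lemma trunc_hexTheta_mul_cuspSix_sq (k : ℕ) :
    Trunc (hexTheta ^ k * cuspSix ^ 2) (truncMul (hexList k) cuspSqList) :=
  (trunc_hexTheta_pow k).mul trunc_cuspSix_sq rfl

lemma ent_eq {l : List ℤ} {m : ℕ} {a : ℤ} (h : l.getD m 0 = a) : ent l m = a := by rw [ent, h]

lemma ent_hexList_zero {k : ℕ} (hk : k < 15) : ent (hexList k) 0 = 1 := by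
  refine (ent_eq (a := 1) ?_).trans Int.cast_one
  revert k
  decide +kernel

lemma ent_hexList_mul_cuspList_zero {k : ℕ} (hk : k < 9) :
    ent (truncMul (hexList k) cuspList) 0 = 0 := by
  refine (ent_eq (a := 0) ?_).trans Int.cast_zero
  revert k
  decide +kernel

lemma ent_hexList_mul_cuspList_one {k : ℕ} (hk : k < 9) :
    ent (truncMul (hexList k) cuspList) 1 = 1 := by
  refine (ent_eq (a := 1) ?_).trans Int.cast_one
  revert k
  decide +kernel

lemma mass_recurrence_small {k : ℕ} (hk : k < 5) {a : ℤ} (h : (hexList (k + 1)).getD 1 0 = a) :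
    mass k = a * mass (k + 1) := by
  have := wrep_eq_of_one (isForm_hexTheta_pow (k + 1)) (trunc_hexTheta_pow (k + 1))
    (ent_hexList_zero (by omega)) (by omega) (m := 1) (by norm_num)
  rwa [Nat.cast_one, wrep_one, ent_eq h] at this

lemma mass_recurrence_middle {k : ℕ} (hk : k < 6) {a₁ a₄ b₄ : ℤ}
    (h : [(hexList (k + 6)).getD 1 0, (hexList (k + 6)).getD 4 0,
      (truncMul (hexList k) cuspList).getD 4 0] = [a₁, a₄, b₄]) :
    (1 + 4 ^ (k + 5) - (-2) ^ (k + 5)) * mass (k + 5) =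
      a₄ * mass (k + 6) + b₄ * (mass (k + 5) - a₁ * mass (k + 6)) := by
  simp only [List.cons.injEq, and_true] at h
  have := wrep_eq_of_two (isForm_hexTheta_pow (k + 6)) (trunc_hexTheta_pow (k + 6))
    (ent_hexList_zero (by omega)) (isForm_hexTheta_mul_cuspSix k) (trunc_hexTheta_mul_cuspSix k)
    (ent_hexList_mul_cuspList_zero (by omega)) (ent_hexList_mul_cuspList_one (by omega))
    (by omega) (m := 4) (by norm_num)
  rwa [Nat.cast_ofNat, wrep_four, wrep_one, ent_eq h.1, ent_eq h.2.1, ent_eq h.2.2] at this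

lemma ent_hexList_mul_cuspSqList_zero {k : ℕ} (hk : k < 3) :
    ent (truncMul (hexList k) cuspSqList) 0 = 0 := by
  refine (ent_eq (a := 0) ?_).trans Int.cast_zero
  revert k
  decide +kernel

lemma ent_hexList_mul_cuspSqList_one {k : ℕ} (hk : k < 3) :
    ent (truncMul (hexList k) cuspSqList) 1 = 0 := by
  refine (ent_eq (a := 0) ?_).trans Int.cast_zero
  revert k
  decide +kernel

lemma ent_hexList_mul_cuspSqList_two {k : ℕ} (hk : k < 3) :
    ent (truncMul (hexList k) cuspSqList) 2 = 1 := by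
  refine (ent_eq (a := 1) ?_).trans Int.cast_one
  revert k
  decide +kernel

lemma mass_recurrence_large {k : ℕ} (hk : k < 3) {a₁ a₂ a₄ a₈ b₂ b₄ b₈ c₄ c₈ : ℤ}
    (h : [(hexList (k + 12)).getD 1 0, (hexList (k + 12)).getD 2 0, (hexList (k + 12)).getD 4 0,
      (hexList (k + 12)).getD 8 0, (truncMul (hexList (k + 6)) cuspList).getD 2 0,
      (truncMul (hexList (k + 6)) cuspList).getD 4 0,
      (truncMul (hexList (k + 6)) cuspList).getD 8 0,
      (truncMul (hexList k) cuspSqList).getD 4 0, (truncMul (hexList k) cuspSqList).getD 8 0] =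
      [a₁, a₂, a₄, a₈, b₂, b₄, b₈, c₄, c₈]) :
    ∃ t u v : ℚ, u = mass (k + 11) - a₁ * mass (k + 12) ∧ v = t - a₂ * mass (k + 12) - b₂ * u ∧
      (1 + 4 ^ (k + 11) - (-2) ^ (k + 11)) * mass (k + 11) =
        a₄ * mass (k + 12) + b₄ * u + c₄ * v ∧
      (1 + 4 ^ (k + 11)) * t = a₈ * mass (k + 12) + b₈ * u + c₈ * v := by
  simp only [List.cons.injEq, and_true] at h
  obtain ⟨h1, h2, h3, h4, h5, h6, h7, h8, h9⟩ := h
  have key {m : ℕ} (hm : m < 9) := wrep_eq_of_three (isForm_hexTheta_pow (k + 12))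
    (trunc_hexTheta_pow (k + 12)) (ent_hexList_zero (by omega)) (isForm_hexTheta_mul_cuspSix (k + 6))
    (trunc_hexTheta_mul_cuspSix (k + 6)) (ent_hexList_mul_cuspList_zero (by omega))
    (ent_hexList_mul_cuspList_one (by omega)) (isForm_hexTheta_mul_cuspSix_sq k)
    (trunc_hexTheta_mul_cuspSix_sq k) (ent_hexList_mul_cuspSqList_zero hk)
    (ent_hexList_mul_cuspSqList_one hk) (ent_hexList_mul_cuspSqList_two hk) (by omega) hm
  have k4 := key (m := 4) (by norm_num)
  have k8 := key (m := 8) (by norm_num)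
  rw [Nat.cast_ofNat, wrep_four, wrep_one, ent_eq h1, ent_eq h2, ent_eq h3, ent_eq h5, ent_eq h6,
    ent_eq h8] at k4
  rw [Nat.cast_ofNat, wrep_eight, wrep_one, ent_eq h1, ent_eq h2, ent_eq h4, ent_eq h5, ent_eq h7,
    ent_eq h9] at k8
  exact ⟨wrep (k + 12) 2, _, _, rfl, rfl, k4, k8⟩

lemma mass_five : mass 5 = 1/933120 := by
  have h0 := mass_recurrence_small (k := 0) (a := 6) (by norm_num) (by decide +kernel)
  have h1 := mass_recurrence_small (k := 1) (a := 12) (by norm_num) (by decide +kernel)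
  have h2 := mass_recurrence_small (k := 2) (a := 18) (by norm_num) (by decide +kernel)
  have h3 := mass_recurrence_small (k := 3) (a := 24) (by norm_num) (by decide +kernel)
  have h4 := mass_recurrence_small (k := 4) (a := 30) (by norm_num) (by decide +kernel)
  rw [mass_zero] at h0
  norm_num at h0 h1 h2 h3 h4
  linarith

lemma mass_six : mass 6 = 13/235146240 := by
  have h := mass_recurrence_middle (k := 0) (a₁ := 36) (a₄ := 20556) (b₄ := 4) (by norm_num)
    (by decide +kernel)
  norm_num [mass_five] at h
  linarith

lemma mass_seven : mass 7 = 1/201553920 := by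
  have h := mass_recurrence_middle (k := 1) (a₁ := 42) (a₄ := 46914) (b₄ := 64) (by norm_num)
    (by decide +kernel)
  norm_num [mass_six] at h
  linarith

lemma mass_eight : mass 8 = 41/48372940800 := by
  have h := mass_recurrence_middle (k := 2) (a₁ := 48) (a₄ := 92784) (b₄ := -92) (by norm_num)
    (by decide +kernel)
  norm_num [mass_seven] at h
  linarith

lemma mass_nine : mass 9 = 809/2612138803200 := by
  have h := mass_recurrence_middle (k := 3) (a₁ := 54) (a₄ := 165942) (b₄ := -248) (by norm_num)
    (by decide +kernel)
  norm_num [mass_eight] at h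
  linarith

lemma mass_ten : mass 10 = 8899/31345665638400 := by
  have h := mass_recurrence_middle (k := 4) (a₁ := 60) (a₄ := 275460) (b₄ := -188) (by norm_num)
    (by decide +kernel)
  norm_num [mass_nine] at h
  linarith

lemma mass_eleven : mass 11 = 1494223/2068813932134400 := by
  have h := mass_recurrence_middle (k := 5) (a₁ := 66) (a₄ := 431706) (b₄ := 304) (by norm_num)
    (by decide +kernel)
  norm_num [mass_ten] at h
  linarith

lemma mass_twelve : mass 12 = 75373090789/13554868883344588800 := by
  obtain ⟨t, u, v, hu, hv, h4, h8⟩ := mass_recurrence_large (k := 0) (a₁ := 72) (a₂ := 2376)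
    (a₄ := 646344) (a₈ := 1125009864) (b₂ := 30) (b₄ := 1444) (b₈ := 121848) (c₄ := 54) (c₈ := 692)
    (by norm_num) (by decide +kernel)
  norm_num [mass_eleven] at hu hv h4 h8
  subst hu hv
  linarith

lemma mass_thirteen : mass 13 = 630862444823/4468638093410304000 := by
  obtain ⟨t, u, v, hu, hv, h4, h8⟩ := mass_recurrence_large (k := 1) (a₁ := 78) (a₂ := 2808)
    (a₄ := 932334) (a₈ := 2698019064) (b₂ := 36) (b₄ := 3448) (b₈ := -8352) (c₄ := -18) (c₈ := -232)
    (by norm_num) (by decide +kernel)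
  norm_num [mass_twelve] at hu hv h4 h8
  subst hu hv
  linarith

lemma mass_fourteen : mass 14 = 689532652191539/53623657120923648000 := by
  obtain ⟨t, u, v, hu, hv, h4, h8⟩ := mass_recurrence_large (k := 2) (a₁ := 84) (a₂ := 3276)
    (a₄ := 1303932) (a₈ := 5970644316) (b₂ := 42) (b₄ := 6532) (b₈ := -769560) (c₄ := -54) (c₈ := 3524)
    (by norm_num) (by decide +kernel)
  norm_num [mass_thirteen] at hu hv h4 h8
  subst hu hv
  linarith

end

section

variable {n : ℕ}

lemma entriesIn_map (H : Matrix (Fin n) (Fin n) Eis) : EntriesIn (H.map toC) :=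
  fun i j => toC_mem (H i j)

lemma EntriesIn.exists_map {H : Matrix (Fin n) (Fin n) ℂ} (h : EntriesIn H) :
    ∃ K : Matrix (Fin n) (Fin n) Eis, K.map toC = H := by
  choose f hf using fun i j => exists_toC (h i j)
  exact ⟨Matrix.of f, Matrix.ext hf⟩

lemma map_toC_one : (1 : Matrix (Fin n) (Fin n) Eis).map toC = 1 :=
  Matrix.map_one _ (map_zero _) (map_one _)

lemma inGL_map (U : (Matrix (Fin n) (Fin n) Eis)ˣ) :
    InGL ((U : Matrix (Fin n) (Fin n) Eis).map toC) := by
  refine ⟨entriesIn_map _, (U⁻¹).1.map toC, entriesIn_map _, ?_, ?_⟩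
  · rw [← map_mul_toC, U.mul_inv, map_toC_one]
  · rw [← map_mul_toC, U.inv_mul, map_toC_one]

lemma exists_unit_of_inGL {U : Matrix (Fin n) (Fin n) ℂ} (h : InGL U) :
    ∃ V : (Matrix (Fin n) (Fin n) Eis)ˣ, (V : Matrix (Fin n) (Fin n) Eis).map toC = U := by
  obtain ⟨hU, W, hW, h1, h2⟩ := h
  obtain ⟨V, rfl⟩ := EntriesIn.exists_map hU
  obtain ⟨W, rfl⟩ := EntriesIn.exists_map hW
  rw [← map_mul_toC, ← map_toC_one] at h1 h2
  exact ⟨⟨V, W, map_toC_injective h1, map_toC_injective h2⟩, rfl⟩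

lemma map_conj (U H : Matrix (Fin n) (Fin n) Eis) :
    (U * H * Uᴴ).map toC = U.map toC * H.map toC * (U.map toC)ᴴ := by
  rw [map_mul_toC, map_mul_toC, map_conjTranspose]

lemma latIsometric_map_iff {H K : Matrix (Fin n) (Fin n) Eis} :
    LatIsometric (H.map toC) (K.map toC) ↔ Equi H K := by
  constructor
  · rintro ⟨U, hU, h⟩
    obtain ⟨V, rfl⟩ := exists_unit_of_inGL hU
    exact ⟨V, map_toC_injective (h.trans (map_conj _ _).symm)⟩
  · rintro ⟨U, rfl⟩
    exact ⟨_, inGL_map U, map_conj _ _⟩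

lemma toC_det (H : Matrix (Fin n) (Fin n) Eis) : (H.map toC).det = toC H.det :=
  (RingHom.map_det toC H).symm

lemma isUnimodular_map_iff {H : Matrix (Fin n) (Fin n) Eis} :
    IsUnimodular (H.map toC) ↔ IsUL H := by
  constructor
  · rintro ⟨⟨-, -, hp⟩, hd⟩
    exact ⟨hp, toC_injective (by rw [← toC_det, hd, map_one])⟩
  · intro h
    exact ⟨⟨entriesIn_map H, h.pd.1, h.pd⟩, by rw [toC_det, h.det, map_one]⟩

lemma autCard_map (H : Matrix (Fin n) (Fin n) Eis) : autCard (H.map toC) = autN H := by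
  rw [autN, ← Nat.card_coe_set_eq, autCard]
  refine (Nat.card_eq_of_bijective (fun U : Isom H H =>
    (⟨(U.1 : Matrix (Fin n) (Fin n) Eis).map toC, inGL_map U.1, ?_⟩ :
      {U : Matrix (Fin n) (Fin n) ℂ // InGL U ∧ U * H.map toC * Uᴴ = H.map toC})) ⟨?_, ?_⟩).symm
  · rw [← map_conj]
    exact congrArg (fun A : Matrix (Fin n) (Fin n) Eis => A.map toC) U.2
  · intro U V h
    exact Subtype.ext (Units.ext (map_toC_injective (congrArg Subtype.val h)))
  · rintro ⟨U, hU, h⟩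
    obtain ⟨V, rfl⟩ := exists_unit_of_inGL hU
    exact ⟨⟨V, map_toC_injective ((map_conj _ _).trans h)⟩, rfl⟩

end

end EisMass

/-- The set of isometry classes of unimodular hermitian `𝓞`-lattices of rank 14 is
finite, and the mass `M₁₄ = Σ 1/|G(L)|` equals `689532652191539 / (2²⁵·3¹⁹·5³·11)`. -/
theorem stmt_13 :
    ∃ (k : ℕ) (L : Fin k → Matrix (Fin 14) (Fin 14) ℂ),
      (∀ a, IsUnimodular (L a)) ∧
      (∀ a b, LatIsometric (L a) (L b) → a = b) ∧
      (∀ H : Matrix (Fin 14) (Fin 14) ℂ, IsUnimodular H → ∃ a, LatIsometric H (L a)) ∧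
      ∑ a, (1 : ℚ) / (autCard (L a) : ℚ) =
        689532652191539 / (2 ^ 25 * 3 ^ 19 * 5 ^ 3 * 11) := by
  obtain ⟨e⟩ : Nonempty (EisMass.Cls 14 ≃ Fin (Fintype.card (EisMass.Cls 14))) :=
    ⟨Fintype.equivFin _⟩
  refine ⟨_, fun a => (e.symm a).rep.map EisMass.Eis.toC, fun a => ?_, fun a b h => ?_,
    fun H hH => ?_, ?_⟩
  · exact EisMass.isUnimodular_map_iff.2 (e.symm a).isUL
  · exact e.symm.injective (EisMass.Cls.eq_of_equi (EisMass.latIsometric_map_iff.1 h))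
  · obtain ⟨K, rfl⟩ := EisMass.EntriesIn.exists_map hH.1.1
    obtain ⟨c, hc⟩ := EisMass.Cls.exists_equi (EisMass.isUnimodular_map_iff.1 hH)
    exact ⟨e c, by simpa using EisMass.latIsometric_map_iff.2 hc⟩
  · simp only [EisMass.autCard_map]
    rw [e.symm.sum_comp fun c : EisMass.Cls 14 => (1 : ℚ) / (EisMass.autN c.rep : ℚ)]
    refine Eq.trans EisMass.mass_fourteen ?_
    norm_num
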